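/- Let α be an ordinal and let ℳ be practical for κ. Then, in ℳ, a witness collection 𝒰 of certified Ramsey measures on κ satisfies o*_Ram(𝒰) ≥ α if and only if N_U ⊨ o*_Ram(κ) ≥ α for every U ∈ 𝒰. -/

import Mathlib

noncomputable section

namespace MPaper

open ZFSet

attribute [local instance] Classical.propDecidable

/-! ### Basic set-theoretic vocabulary over `ZFSet` -/

/-- The (external) cardinality of a ZFC set. -/
def zcard (x : ZFSet) : Cardinal := Cardinal.mk x.toSet

/-- `x` is a von Neumann ordinal: a transitive set of transitive sets. -/
def IsOrd (x : ZFSet) : Prop := x.IsTransitive ∧ ∀ y ∈ x, ZFSet.IsTransitive y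

/-- `κ` is a cardinal: an ordinal not equinumerous with any of its members. -/
def IsCard (κ : ZFSet) : Prop := IsOrd κ ∧ ∀ α ∈ κ, zcard α < zcard κ

/-- The ordinal `κ⁺`, the cardinal successor of `κ`. -/
def cardSuccOrd (κ : ZFSet) : Ordinal := (Order.succ (zcard κ)).ord

/-- `f` is a set-coded function with domain `d` (a set of Kuratowski pairs). -/
def IsZFunc (d f : ZFSet) : Prop :=
  (∀ p ∈ f, ∃ a ∈ d, ∃ b, p = ZFSet.pair a b) ∧ ∀ a ∈ d, ∃! b, ZFSet.pair a b ∈ f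

/-- Application of a set-coded function. -/
def fapp (f a : ZFSet) : ZFSet :=
  ⋃₀ (ZFSet.sep (fun b => ZFSet.pair a b ∈ f) (⋃₀ (⋃₀ f)))

/-- `f` maps `d` into `y`. -/
def MapsInto (f d y : ZFSet) : Prop := ∀ a ∈ d, fapp f a ∈ y

/-- `f` maps `d` onto `y`. -/
def SurjOnto (f d y : ZFSet) : Prop := MapsInto f d y ∧ ∀ b ∈ y, ∃ a ∈ d, fapp f a = b

/-- `f` is injective on `d`. -/
def InjOnZ (f d : ZFSet) : Prop := ∀ a ∈ d, ∀ b ∈ d, fapp f a = fapp f b → a = b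

/-- `f` is a bijection from `d` onto `y`. -/
def IsBij (f d y : ZFSet) : Prop := IsZFunc d f ∧ SurjOnto f d y ∧ InjOnZ f d

/-- The tail `κ ∖ α = {ξ ∈ κ | α ≤ ξ}` (for ordinals `α ∈ κ`). -/
def tailSet (κ α : ZFSet) : ZFSet := ZFSet.sep (fun ξ => ξ ∉ α) κ

/-- The relative complement `κ ∖ A`. -/
def compl (κ A : ZFSet) : ZFSet := ZFSet.sep (fun ξ => ξ ∉ A) κ

/-! ### First-order satisfaction in ∈-structures -/

/-- First order formulas in the language of set theory, with variables indexed by `ℕ`. -/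
inductive Fml : Type
  | mem : ℕ → ℕ → Fml
  | eq : ℕ → ℕ → Fml
  | impl : Fml → Fml → Fml
  | neg : Fml → Fml
  | all : ℕ → Fml → Fml

/-- Tarskian satisfaction of a formula in the ∈-structure with domain `D`. -/
def Sat (D : Set ZFSet) : Fml → (ℕ → ZFSet) → Prop
  | .mem i j, v => v i ∈ v j
  | .eq i j, v => v i = v j
  | .impl φ ψ, v => Sat D φ v → Sat D ψ v
  | .neg φ, v => ¬ Sat D φ v
  | .all n φ, v => ∀ x ∈ D, Sat D φ (Function.update v n x)

/-- `D` is an elementary substructure of `E` (as ∈-structures). -/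
def ElemSub (D E : Set ZFSet) : Prop :=
  D ⊆ E ∧ ∀ (φ : Fml) (v : ℕ → ZFSet), (∀ n, v n ∈ D) → (Sat D φ v ↔ Sat E φ v)

/-- `r` is a well-ordering of `x` (coded as a set of Kuratowski pairs). -/
def IsWellOrderOn (x r : ZFSet) : Prop :=
  (∀ p ∈ r, ∃ a ∈ x, ∃ b ∈ x, p = ZFSet.pair a b) ∧
  (∀ a ∈ x, ∀ b ∈ x, a = b ∨ ZFSet.pair a b ∈ r ∨ ZFSet.pair b a ∈ r) ∧
  (∀ a ∈ x, ∀ b ∈ x, ∀ c ∈ x,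
    ZFSet.pair a b ∈ r → ZFSet.pair b c ∈ r → ZFSet.pair a c ∈ r) ∧
  (∀ a ∈ x, ZFSet.pair a a ∉ r) ∧
  (∀ S : Set ZFSet, S ⊆ x.toSet → S.Nonempty → ∃ a ∈ S, ∀ b ∈ S, ZFSet.pair b a ∉ r)

/-- A transitive model of `ZFC⁻` (ZFC minus power set): a transitive set closed under
pairing and union, containing `ω`, satisfying the separation and collection schemes for
first-order formulas, and choice in the guise of the well-ordering principle.
(Extensionality and foundation hold automatically in transitive sets.) -/
def IsTransModel (M : ZFSet) : Prop :=
  M.IsTransitive ∧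
  ZFSet.omega ∈ M ∧
  (∀ x ∈ M, ∀ y ∈ M, ({x, y} : ZFSet) ∈ M) ∧
  (∀ x ∈ M, (⋃₀ x : ZFSet) ∈ M) ∧
  (∀ (φ : Fml) (v : ℕ → ZFSet), (∀ n, v n ∈ M) → ∀ a ∈ M,
    ∃ b ∈ M, ∀ x, x ∈ b ↔ x ∈ a ∧ Sat M.toSet φ (Function.update v 0 x)) ∧
  (∀ (φ : Fml) (v : ℕ → ZFSet), (∀ n, v n ∈ M) → ∀ a ∈ M,
    (∀ x ∈ a, ∃ y ∈ M, Sat M.toSet φ (Function.update (Function.update v 0 x) 1 y)) →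
    ∃ b ∈ M, ∀ x ∈ a, ∃ y ∈ b, Sat M.toSet φ (Function.update (Function.update v 0 x) 1 y)) ∧
  (∀ x ∈ M, ∃ r ∈ M, IsWellOrderOn x r)

/-! ### Weak κ-models, κ-models, M-ultrafilters -/

/-- A weak `κ`-model: a transitive model of ZFC⁻ of size `κ` with `κ ∈ M`. -/
def IsWeakModel (κ M : ZFSet) : Prop :=
  IsTransModel M ∧ κ ∈ M ∧ zcard M = zcard κ

/-- `M` is closed under `<κ`-sequences (of its elements). -/
def SeqClosed (κ M : ZFSet) : Prop :=
  ∀ γ ∈ κ, ∀ f : ZFSet, IsZFunc γ f → (∀ a ∈ γ, fapp f a ∈ M) → f ∈ M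

/-- A `κ`-model: a weak `κ`-model closed under `<κ`-sequences. -/
def IsKappaModel (κ M : ZFSet) : Prop := IsWeakModel κ M ∧ SeqClosed κ M

/-- `U` is an `M`-ultrafilter on `κ`: `⟨M, ∈, U⟩` thinks `U` is a normal ultrafilter on `κ`
containing all tail sets. -/
def IsMUltrafilter (κ M U : ZFSet) : Prop :=
  (∀ A ∈ U, A ∈ M ∧ A ⊆ κ) ∧
  (∀ α ∈ κ, tailSet κ α ∈ U) ∧
  (∅ : ZFSet) ∉ U ∧
  (∀ A ∈ U, ∀ B ∈ U, A ∩ B ∈ U) ∧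
  (∀ A ∈ U, ∀ B, B ∈ M → B ⊆ κ → A ⊆ B → B ∈ U) ∧
  (∀ B, B ∈ M → B ⊆ κ → B ∈ U ∨ compl κ B ∈ U) ∧
  (∀ f ∈ M, IsZFunc κ f → ZFSet.sep (fun ξ => fapp f ξ ∈ ξ) κ ∈ U →
    ∃ γ ∈ κ, ZFSet.sep (fun ξ => fapp f ξ = γ) κ ∈ U)

/-- `U` is weakly amenable for `M`: for every `X ∈ M` of size at most `κ` in `M`,
the intersection `X ∩ U` belongs to `M`. -/
def WeaklyAmenable (κ M U : ZFSet) : Prop :=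
  ∀ X ∈ M, (∃ f ∈ M.toSet, IsZFunc κ f ∧ ∀ y ∈ X, ∃ ξ ∈ κ, fapp f ξ = y) →
    X ∩ U ∈ M

/-- `U` is `ω₁`-intersecting: every countable collection of its members has a common element. -/
def OmegaOneIntersecting (U : ZFSet) : Prop :=
  ∀ s : ℕ → ZFSet, (∀ n, s n ∈ U) → ∃ x, ∀ n, x ∈ s n

/-- `M` contains (its version of) `V_κ`, i.e. the set of all sets of rank `< κ`. -/
def HasVkappa (κ M : ZFSet) : Prop :=
  ∃ v ∈ M.toSet, ∀ x, x ∈ v ↔ ZFSet.rank x < ZFSet.rank κ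

/-! ### Small universe measures and the associated models `M_U`, `N_U` -/

/-- `M` is the minimal model associated to `U` (the collection of Mostowski collapses of
well-founded relations on `κ` coded by sets in `U` and their complements): a weak `κ`-model
with `V_κ ∈ M` for which `U` is an `M`-ultrafilter, contained in every transitive
ZFC⁻-model `M'` with `κ ∈ M'` for which `U` is an `M'`-ultrafilter. -/
def IsMUModel (κ U M : ZFSet) : Prop :=
  IsWeakModel κ M ∧ HasVkappa κ M ∧ IsMUltrafilter κ M U ∧
  ∀ M', IsTransModel M' → κ ∈ M' → IsMUltrafilter κ M' U → M ⊆ M'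

/-- A small universe measure on `κ`: a set `U` of subsets of `κ` of size `κ` whose associated
minimal model `M_U` exists (is a weak `κ`-model with `V_κ ∈ M_U` and `U` an `M_U`-ultrafilter). -/
def IsSUMeasure (κ U : ZFSet) : Prop :=
  zcard U = zcard κ ∧ (∀ A ∈ U, A ⊆ κ) ∧ ∃ M, IsMUModel κ U M

/-- The minimal model `M_U` associated to a small universe measure `U`. -/
def MU (κ U : ZFSet) : ZFSet :=
  if h : ∃ M, IsMUModel κ U M then h.choose else ∅

/-- `j : M → N` is (up to isomorphism) the ultrapower embedding of `M` by the
`M`-ultrafilter `U` on `κ`, with `N` transitive (so the ultrapower is well-founded):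
`j` is elementary, every element of `N` has the form `j(f)(κ)` for `f : κ → M` in `M`,
and `U` is the `M`-ultrafilter derived from `j` with seed `κ`. -/
def IsUltrapowerEmb (κ M U N : ZFSet) (j : ZFSet → ZFSet) : Prop :=
  N.IsTransitive ∧
  (∀ x ∈ M, j x ∈ N) ∧
  (∀ (φ : Fml) (v : ℕ → ZFSet), (∀ n, v n ∈ M) →
    (Sat M.toSet φ v ↔ Sat N.toSet φ (fun n => j (v n)))) ∧
  (∀ a ∈ N, ∃ f ∈ M.toSet, IsZFunc κ f ∧ MapsInto f κ M ∧ fapp (j f) κ = a) ∧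
  (∀ A ∈ M, A ⊆ κ → (A ∈ U ↔ κ ∈ j A))

/-- The ultrapower of `M_U` by `U` is well-founded. -/
def UltrapowerWF (κ U : ZFSet) : Prop :=
  ∃ (N : ZFSet) (j : ZFSet → ZFSet), IsUltrapowerEmb κ (MU κ U) U N j

/-- A choice of transitive collapse of the ultrapower of `M_U` by `U`, with its embedding. -/
def upData (κ U : ZFSet) : ZFSet × (ZFSet → ZFSet) :=
  if h : ∃ p : ZFSet × (ZFSet → ZFSet), IsUltrapowerEmb κ (MU κ U) U p.1 p.2
  then h.choose else (∅, id)

/-- `N_U`: the transitive collapse of the ultrapower of `M_U` by `U` (when well-founded). -/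
def NU (κ U : ZFSet) : ZFSet := (upData κ U).1

/-- The ultrapower embedding `j_U : M_U → N_U`. -/
def jU (κ U : ZFSet) : ZFSet → ZFSet := (upData κ U).2

/-- `M_U⋆ = V_{j(κ)}^{N_U}`, the rank-initial segment of `N_U` below `j_U(κ)`. -/
def MUstar (κ U : ZFSet) : ZFSet :=
  ZFSet.sep (fun x => ZFSet.rank x < ZFSet.rank (jU κ U κ)) (NU κ U)

/-! ### Hereditary size, `H_{κ⁺}`, elementarity -/

/-- `x` has hereditary size at most `κ`. -/
def HeredLE (κ : ZFSet) : ZFSet → Prop :=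
  WellFounded.fix ZFSet.mem_wf
    (fun x ih => zcard x ≤ zcard κ ∧ ∀ y, ∀ h : y ∈ x, ih y h)

/-- The class `H_{κ⁺}` of sets of hereditary size at most `κ`. -/
def Hclass (κ : ZFSet) : Set ZFSet := { x | HeredLE κ x }

/-! ### The measures witnessing Ramsey and Ramsey-like cardinals -/

/-- A Ramsey measure on `κ`: a weakly amenable `ω₁`-intersecting small universe measure. -/
def IsRamseyMeasure (κ U : ZFSet) : Prop :=
  IsSUMeasure κ U ∧ WeaklyAmenable κ (MU κ U) U ∧ OmegaOneIntersecting U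

/-- A strong Ramsey measure on `κ`: a weakly amenable small universe measure whose
minimal model `M_U` is a `κ`-model. -/
def IsStrongRamseyMeasure (κ U : ZFSet) : Prop :=
  IsSUMeasure κ U ∧ WeaklyAmenable κ (MU κ U) U ∧ SeqClosed κ (MU κ U)

/-- A super Ramsey measure on `κ`: a strong Ramsey measure with `M_U ≺ H_{κ⁺}`. -/
def IsSuperRamseyMeasure (κ U : ZFSet) : Prop :=
  IsStrongRamseyMeasure κ U ∧ ElemSub (MU κ U).toSet (Hclass κ)

/-- `I` certifies `U`: `I` is an unbounded subset of `κ` and the sets in `U` are exactly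
the subsets of `κ` in `M_U` containing a tail of `I`. -/
def Certifies (κ U : ZFSet) (I : Set ZFSet) : Prop :=
  (∀ ξ ∈ I, ξ ∈ κ) ∧ (∀ α ∈ κ, ∃ ξ ∈ I, ξ ∉ α) ∧
  ∀ X ∈ (MU κ U).toSet, X ⊆ κ →
    (X ∈ U ↔ ∃ α ∈ κ.toSet, ∀ ξ ∈ I, ξ ∉ α → ξ ∈ X)

/-- A certified Ramsey measure on `κ`: a weakly amenable small universe measure which is
certified by some unbounded `I ⊆ κ`. -/
def IsCertifiedRamseyMeasure (κ U : ZFSet) : Prop :=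
  IsSUMeasure κ U ∧ WeaklyAmenable κ (MU κ U) U ∧ ∃ I : Set ZFSet, Certifies κ U I

/-! ### Relativized (internal) versions of the measure predicates -/

/-- `ω₁`-intersecting from the point of view of the transitive model `N`: every
`ω`-sequence of members of `U` lying in `N` has a common element. -/
def OmegaOneIntersectingIn (N U : ZFSet) : Prop :=
  ∀ f ∈ N.toSet, IsZFunc ZFSet.omega f → (∀ n ∈ ZFSet.omega, fapp f n ∈ U) →
    ∃ x, ∀ n ∈ ZFSet.omega, x ∈ fapp f n

/-- `N ⊨ U is a Ramsey measure on κ`, for a transitive ZFC⁻-model `N`: all components are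
absolute except `ω₁`-intersectingness, which is evaluated using sequences in `N`. -/
def RamseyMeasureIn (N κ U : ZFSet) : Prop :=
  U ∈ N ∧ IsSUMeasure κ U ∧ WeaklyAmenable κ (MU κ U) U ∧ OmegaOneIntersectingIn N U

/-- `N ⊨ U is a strong Ramsey measure on κ`: closure of `M_U` under `<κ`-sequences is
evaluated using the sequences lying in `N`. -/
def StrongRamseyMeasureIn (N κ U : ZFSet) : Prop :=
  U ∈ N ∧ IsSUMeasure κ U ∧ WeaklyAmenable κ (MU κ U) U ∧
  ∀ f ∈ N.toSet, ∀ γ ∈ κ, IsZFunc γ f → (∀ a ∈ γ, fapp f a ∈ MU κ U) → f ∈ MU κ U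

/-- The class `H_{κ⁺}` as computed in `N`. -/
def HclassIn (N κ : ZFSet) : Set ZFSet := { x | x ∈ N ∧ HeredLE κ x }

/-- `N ⊨ U is a super Ramsey measure on κ`. -/
def SuperRamseyMeasureIn (N κ U : ZFSet) : Prop :=
  StrongRamseyMeasureIn N κ U ∧ ElemSub (MU κ U).toSet (HclassIn N κ)

/-- `N ⊨ U is a certified Ramsey measure on κ` (the certifying set is required to lie in `N`). -/
def CertifiedRamseyMeasureIn (N κ U : ZFSet) : Prop :=
  U ∈ N ∧ IsSUMeasure κ U ∧ WeaklyAmenable κ (MU κ U) U ∧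
  ∃ I ∈ N.toSet, Certifies κ U I.toSet

/-! ### Goodness, witness collections, and the M-order -/

/-- `U` is `A`-good: `A ∈ M_U`. -/
def AGood (κ A U : ZFSet) : Prop := A ∈ MU κ U

/-- A witness collection of `Pm`-measures on `κ`: a collection of `Pm`-measures containing
an `A`-good one for every `A ⊆ κ`. -/
def IsWitness (Pm : ZFSet → ZFSet → Prop) (κ : ZFSet) (𝒰 : Set ZFSet) : Prop :=
  (∀ U ∈ 𝒰, Pm κ U) ∧ ∀ A : ZFSet, A ⊆ κ → ∃ U ∈ 𝒰, AGood κ A U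

/-- The M-order on witness collections of `Pm`-measures on `κ`; `PmIn N κ U` is the
relativization `N ⊨ U is a Pm-measure on κ`.  `MOrder Pm PmIn κ 𝒰 𝒲` says `𝒰 ◁ 𝒲`. -/
def MOrder (Pm : ZFSet → ZFSet → Prop) (PmIn : ZFSet → ZFSet → ZFSet → Prop)
    (κ : ZFSet) (𝒰 𝒲 : Set ZFSet) : Prop :=
  IsWitness Pm κ 𝒰 ∧ IsWitness Pm κ 𝒲 ∧
  (∀ W ∈ 𝒲, ∀ A ∈ (NU κ W).toSet, A ⊆ κ →
    ∃ U ∈ 𝒰, U ∈ NU κ W ∧ AGood κ A U ∧ PmIn (NU κ W) κ U) ∧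
  (∀ U ∈ 𝒰, ∃ W ∈ 𝒲, U ∈ NU κ W)

/-! ### Ranks -/

/-- The rank of a point in an arbitrary binary relation (`0` at non-accessible points). -/
def relRank {X : Type*} (r : X → X → Prop) (x : X) : Ordinal :=
  if h : Acc r x then h.rank else 0

/-- The M-rank `o_Pm(κ)`: the strict supremum of the M-ranks of all witness collections of
`Pm`-measures on `κ` (and `0` if there are none). -/
def oRank (Pm : ZFSet → ZFSet → Prop) (PmIn : ZFSet → ZFSet → ZFSet → Prop)
    (κ : ZFSet) : Ordinal :=
  sSup { o : Ordinal |
    ∃ 𝒰 : Set ZFSet, IsWitness Pm κ 𝒰 ∧ o = relRank (MOrder Pm PmIn κ) 𝒰 + 1 }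

/-- `N ⊨ o_Pm(κ) ≥ α`, defined by the recursion: for every `A ⊆ κ` in `N` and every `β < α`
there is an `A`-good `Pm`-measure `W` in `N` (in the sense of `N`) whose ultrapower satisfies
`o_Pm(κ) ≥ β`. -/
def oGEin (PmIn : ZFSet → ZFSet → ZFSet → Prop) (κ : ZFSet) : Ordinal → ZFSet → Prop :=
  WellFounded.fix wellFounded_lt fun α ih N =>
    ∀ A ∈ N.toSet, A ⊆ κ → ∀ β, ∀ h : β < α,
      ∃ W ∈ N.toSet, PmIn N κ W ∧ AGood κ A W ∧ ih β h (NU κ W)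

/-- `N ⊨ o_Pm(κ) = α`. -/
def oEQin (PmIn : ZFSet → ZFSet → ZFSet → Prop) (κ : ZFSet) (α : Ordinal) (N : ZFSet) : Prop :=
  oGEin PmIn κ α N ∧ ¬ oGEin PmIn κ (α + 1) N

/-! ### The M-order and M-rank relativized to a model `ℳ` -/

/-- A witness collection (coded as a set) of `Pm`-measures in the sense of the model `ℳ`. -/
def IsWitnessIn (PmIn : ZFSet → ZFSet → ZFSet → Prop) (ℳ κ 𝒰 : ZFSet) : Prop :=
  𝒰 ∈ ℳ ∧ (∀ U ∈ 𝒰, PmIn ℳ κ U) ∧ ∀ A ∈ ℳ.toSet, A ⊆ κ → ∃ U ∈ 𝒰.toSet, AGood κ A U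

/-- The M-order on witness collections as computed in `ℳ`. -/
def MOrderIn (PmIn : ZFSet → ZFSet → ZFSet → Prop) (ℳ κ : ZFSet) (𝒰 𝒲 : ZFSet) : Prop :=
  IsWitnessIn PmIn ℳ κ 𝒰 ∧ IsWitnessIn PmIn ℳ κ 𝒲 ∧
  (∀ W ∈ 𝒲, ∀ A ∈ (NU κ W).toSet, A ⊆ κ →
    ∃ U ∈ 𝒰.toSet, U ∈ NU κ W ∧ AGood κ A U ∧ PmIn (NU κ W) κ U) ∧
  (∀ U ∈ 𝒰, ∃ W ∈ 𝒲.toSet, U ∈ NU κ W)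

/-- The M-rank `o_Pm(κ)` as computed in `ℳ`. -/
def oRankIn (PmIn : ZFSet → ZFSet → ZFSet → Prop) (ℳ κ : ZFSet) : Ordinal :=
  sSup { o : Ordinal |
    ∃ 𝒰 : ZFSet, IsWitnessIn PmIn ℳ κ 𝒰 ∧ o = relRank (MOrderIn PmIn ℳ κ) 𝒰 + 1 }

/-! ### Practical models, cover and approximation properties -/

/-- `ℳ` is practical for `κ`: a transitive ZFC⁻-model containing `κ` in which
`V_{κ+3}` exists. -/
def Practical (κ ℳ : ZFSet) : Prop :=
  IsTransModel ℳ ∧ κ ∈ ℳ ∧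
  ∃ v ∈ ℳ.toSet, ∀ x, x ∈ v ↔ (x ∈ ℳ ∧ ZFSet.rank x < ZFSet.rank κ + 3)

/-- `x` has size less than `δ` as witnessed inside the class `D`:
some `f ∈ D` injects `x` into an ordinal `γ ∈ δ`. -/
def SizeLTin (D : Set ZFSet) (x δ : ZFSet) : Prop :=
  ∃ γ ∈ δ.toSet, ∃ f ∈ D, IsZFunc x f ∧ MapsInto f x γ ∧ InjOnZ f x

/-- The pair `D ⊆ D'` has the `δ`-cover property. -/
def CoverProperty (δ : ZFSet) (D D' : Set ZFSet) : Prop :=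
  ∀ X ∈ D', X.toSet ⊆ D → SizeLTin D' X δ →
    ∃ Y ∈ D, X ⊆ Y ∧ SizeLTin D Y δ

/-- The pair `D ⊆ D'` has the `δ`-approximation property. -/
def ApproxProperty (δ : ZFSet) (D D' : Set ZFSet) : Prop :=
  ∀ X ∈ D', X.toSet ⊆ D → (∀ x ∈ D, SizeLTin D x δ → X ∩ x ∈ D) → X ∈ D

/-- `δ` is a cardinal from the point of view of the class `D`. -/
def IsCardIn (D : Set ZFSet) (δ : ZFSet) : Prop :=
  IsOrd δ ∧ δ ∈ D ∧ ∀ γ ∈ δ, ¬ ∃ f ∈ D, IsZFunc γ f ∧ SurjOnto f γ δ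

/-- `δ` is a regular (infinite) cardinal from the point of view of the class `D`. -/
def IsRegularIn (D : Set ZFSet) (δ : ZFSet) : Prop :=
  IsCardIn D δ ∧ ZFSet.omega ⊆ δ ∧
  ∀ γ ∈ δ, ∀ f ∈ D, IsZFunc γ f → MapsInto f γ δ →
    ∃ β ∈ δ, ∀ a ∈ γ, fapp f a ∈ β

/-- `H_λ` as computed in the model `V`: the members of `V` having, in `V`,
a transitive superset of size `< λ`. -/
def HIn (V lam : ZFSet) : Set ZFSet :=
  { x | x ∈ V ∧ ∃ t ∈ V.toSet, x ⊆ t ∧ t.IsTransitive ∧ SizeLTin V.toSet t lam }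

/-- `V` and `V'` have the same ordinals. -/
def SameOrdinals (D D' : Set ZFSet) : Prop :=
  ∀ α, IsOrd α → (α ∈ D ↔ α ∈ D')

/-- Every `ω`-sequence of elements of `ℳ` lying in `ℳ'` is an element of `ℳ`. -/
def OmegaSeqClosedPair (ℳ ℳ' : ZFSet) : Prop :=
  ∀ f ∈ ℳ'.toSet, IsZFunc ZFSet.omega f → (∀ n ∈ ZFSet.omega, fapp f n ∈ ℳ) → f ∈ ℳ

/-! ### Large cardinal properties -/

/-- `κ` is Ramsey: every `A ⊆ κ` belongs to a weak `κ`-model `M` carrying a weakly amenable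
`ω₁`-intersecting `M`-ultrafilter on `κ`. -/
def IsRamseyCard (κ : ZFSet) : Prop :=
  IsCard κ ∧ ∀ A : ZFSet, A ⊆ κ →
    ∃ M, IsWeakModel κ M ∧ A ∈ M ∧
      ∃ U, IsMUltrafilter κ M U ∧ WeaklyAmenable κ M U ∧ OmegaOneIntersecting U

/-- `κ` is strongly Ramsey: the model `M` can moreover be taken to be a `κ`-model. -/
def IsStronglyRamseyCard (κ : ZFSet) : Prop :=
  IsCard κ ∧ ∀ A : ZFSet, A ⊆ κ →
    ∃ M, IsKappaModel κ M ∧ A ∈ M ∧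
      ∃ U, IsMUltrafilter κ M U ∧ WeaklyAmenable κ M U ∧ OmegaOneIntersecting U

/-- `κ` is super Ramsey: the model `M` can moreover be taken to be a `κ`-model
elementary in `H_{κ⁺}`. -/
def IsSuperRamseyCard (κ : ZFSet) : Prop :=
  IsCard κ ∧ ∀ A : ZFSet, A ⊆ κ →
    ∃ M, IsKappaModel κ M ∧ ElemSub M.toSet (Hclass κ) ∧ A ∈ M ∧
      ∃ U, IsMUltrafilter κ M U ∧ WeaklyAmenable κ M U ∧ OmegaOneIntersecting U

/-- `κ` is weakly super Ramsey: the model `M` is a weak `κ`-model elementary in `H_{κ⁺}`. -/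
def IsWeaklySuperRamseyCard (κ : ZFSet) : Prop :=
  IsCard κ ∧ ∀ A : ZFSet, A ⊆ κ →
    ∃ M, IsWeakModel κ M ∧ ElemSub M.toSet (Hclass κ) ∧ A ∈ M ∧
      ∃ U, IsMUltrafilter κ M U ∧ WeaklyAmenable κ M U ∧ OmegaOneIntersecting U

/-- `κ` is measurable: there is a `κ`-complete nonprincipal ultrafilter on (all) subsets
of `κ`. -/
def IsMeasurableCard (κ : ZFSet) : Prop :=
  IsCard κ ∧ ZFSet.omega ∈ κ ∧
  ∃ 𝒰 : Set ZFSet,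
    (∀ A ∈ 𝒰, A ⊆ κ) ∧ (∅ : ZFSet) ∉ 𝒰 ∧ κ ∈ 𝒰 ∧
    (∀ A ∈ 𝒰, ∀ B : ZFSet, B ⊆ κ → A ⊆ B → B ∈ 𝒰) ∧
    (∀ A : ZFSet, A ⊆ κ → (A ∈ 𝒰 ∨ compl κ A ∈ 𝒰)) ∧
    (∀ γ ∈ κ.toSet, ∀ s : ZFSet → ZFSet, (∀ i ∈ γ, s i ∈ 𝒰) →
      ZFSet.sep (fun ξ => ∀ i ∈ γ, ξ ∈ s i) κ ∈ 𝒰)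

/-! ### Relativized large-cardinal properties -/

/-- `N ⊨ κ is Ramsey` (for a transitive model `N`): the witnessing models and ultrafilters
lie in `N`, smallness of the models is witnessed in `N`, and `ω₁`-intersectingness is
evaluated using the sequences in `N`. -/
def RamseyCardIn (N κ : ZFSet) : Prop :=
  ∀ A ∈ N.toSet, A ⊆ κ →
    ∃ M ∈ N.toSet, A ∈ M ∧ IsTransModel M ∧ κ ∈ M ∧
      (∃ f ∈ N.toSet, IsZFunc κ f ∧ SurjOnto f κ M) ∧
      ∃ U ∈ N.toSet, IsMUltrafilter κ M U ∧ WeaklyAmenable κ M U ∧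
        OmegaOneIntersectingIn N U

/-- `N ⊨ κ is strongly Ramsey`. -/
def StronglyRamseyCardIn (N κ : ZFSet) : Prop :=
  ∀ A ∈ N.toSet, A ⊆ κ →
    ∃ M ∈ N.toSet, A ∈ M ∧ IsTransModel M ∧ κ ∈ M ∧
      (∃ f ∈ N.toSet, IsZFunc κ f ∧ SurjOnto f κ M) ∧
      (∀ f ∈ N.toSet, ∀ γ ∈ κ, IsZFunc γ f → (∀ a ∈ γ, fapp f a ∈ M) → f ∈ M) ∧
      ∃ U ∈ N.toSet, IsMUltrafilter κ M U ∧ WeaklyAmenable κ M U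

/-- `N ⊨ κ is super Ramsey`. -/
def SuperRamseyCardIn (N κ : ZFSet) : Prop :=
  ∀ A ∈ N.toSet, A ⊆ κ →
    ∃ M ∈ N.toSet, A ∈ M ∧ IsTransModel M ∧ κ ∈ M ∧
      (∃ f ∈ N.toSet, IsZFunc κ f ∧ SurjOnto f κ M) ∧
      (∀ f ∈ N.toSet, ∀ γ ∈ κ, IsZFunc γ f → (∀ a ∈ γ, fapp f a ∈ M) → f ∈ M) ∧
      ElemSub M.toSet (HclassIn N κ) ∧
      ∃ U ∈ N.toSet, IsMUltrafilter κ M U ∧ WeaklyAmenable κ M U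

/-! ### ω-special models -/

/-- A weak `κ`-model `M` is `ω`-special: it is the union of a chain
`M₀ ≺ M₁ ≺ ⋯` of elementary substructures of `M` with each `Mₙ ∈ M` and `|Mₙ|^M = κ`. -/
def OmegaSpecial (κ M : ZFSet) : Prop :=
  ∃ s : ℕ → ZFSet,
    (∀ n, s n ∈ M) ∧
    (∀ n, (s n).toSet ⊆ (s (n + 1)).toSet) ∧
    (∀ n, ElemSub (s n).toSet M.toSet) ∧
    (∀ n, ∃ f ∈ M.toSet, IsBij f κ (s n)) ∧
    (∀ x, x ∈ M ↔ ∃ n, x ∈ s n)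

/-! ### Iterated ultrapowers and α-iterability -/

/-- `U` is an `α`-iterable `M`-ultrafilter on `κ`: there is a coherent system of transitive
models `Mod β` (`β ≤ α`), with commuting elementary embeddings `e β γ : Mod β → Mod γ`,
critical sequence `cr β` and ultrafilter sequence `Us β`, starting at `(M, κ, U)`, where each
successor step is given by an ultrapower and each limit step is a (collapsed) direct limit. -/
def IsAlphaIterable (κ M U : ZFSet) (α : Ordinal) : Prop :=
  ∃ (Mod : Ordinal → ZFSet) (cr : Ordinal → ZFSet) (Us : Ordinal → ZFSet)
    (e : Ordinal → Ordinal → ZFSet → ZFSet),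
    Mod 0 = M ∧ cr 0 = κ ∧ Us 0 = U ∧
    (∀ β ≤ α, (Mod β).IsTransitive) ∧
    (∀ β ≤ α, ∀ x ∈ Mod β, e β β x = x) ∧
    (∀ β γ ρ : Ordinal, β ≤ γ → γ ≤ ρ → ρ ≤ α →
      ∀ x ∈ Mod β, e γ ρ (e β γ x) = e β ρ x) ∧
    (∀ β γ : Ordinal, β ≤ γ → γ ≤ α →
      (∀ x ∈ Mod β, e β γ x ∈ Mod γ) ∧
      ∀ (φ : Fml) (v : ℕ → ZFSet), (∀ n, v n ∈ Mod β) →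
        (Sat (Mod β).toSet φ v ↔ Sat (Mod γ).toSet φ (fun n => e β γ (v n)))) ∧
    (∀ β : Ordinal, β + 1 ≤ α →
      IsUltrapowerEmb (cr β) (Mod β) (Us β) (Mod (β + 1)) (e β (β + 1)) ∧
      cr (β + 1) = e β (β + 1) (cr β) ∧
      (∀ A, A ∈ Us (β + 1) ↔
        ∃ X ∈ (Mod β).toSet, X ∩ Us β ∈ Mod β ∧ A ∈ e β (β + 1) (X ∩ Us β))) ∧
    (∀ lam : Ordinal, lam ≤ α → lam ≠ 0 → (∀ β < lam, β + 1 < lam) →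
      (∀ x ∈ Mod lam, ∃ β < lam, ∃ y ∈ (Mod β).toSet, e β lam y = x) ∧
      cr lam = e 0 lam κ ∧
      (∀ A, A ∈ Us lam ↔ ∃ β < lam, ∃ B, B ∈ Us β ∧ e β lam B = A))

/-- `N ⊨ κ is α-iterable`: every `A ⊆ κ` in `N` belongs to a weak `κ`-model `M ∈ N` for
which there is a weakly amenable `α`-iterable `M`-ultrafilter `U ∈ N` on `κ`. -/
def AlphaIterableCardIn (N κ : ZFSet) (α : Ordinal) : Prop :=
  ∀ A ∈ N.toSet, A ⊆ κ →
    ∃ M ∈ N.toSet, A ∈ M ∧ IsTransModel M ∧ κ ∈ M ∧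
      (∃ f ∈ N.toSet, IsZFunc κ f ∧ SurjOnto f κ M) ∧
      ∃ U ∈ N.toSet, IsMUltrafilter κ M U ∧ WeaklyAmenable κ M U ∧
        IsAlphaIterable κ M U α

/-! ### Forcing -/

/-- `R` codes a partial order (of forcing conditions) on `P`: `pair p q ∈ R` means `p ≤ q`. -/
def IsPoset (P R : ZFSet) : Prop :=
  (∀ p ∈ R, ∃ a ∈ P, ∃ b ∈ P, p = ZFSet.pair a b) ∧
  (∀ p ∈ P, ZFSet.pair p p ∈ R) ∧
  (∀ p ∈ P, ∀ q ∈ P, ∀ r ∈ P,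
    ZFSet.pair p q ∈ R → ZFSet.pair q r ∈ R → ZFSet.pair p r ∈ R)

/-- `G` is an `ℳ`-generic filter on the poset `(P, R)`. -/
def IsGenericFilter (ℳ P R : ZFSet) (G : Set ZFSet) : Prop :=
  G ⊆ P.toSet ∧ G.Nonempty ∧
  (∀ p ∈ G, ∀ q ∈ G, ∃ r ∈ G, ZFSet.pair r p ∈ R ∧ ZFSet.pair r q ∈ R) ∧
  (∀ p ∈ G, ∀ q ∈ P.toSet, ZFSet.pair p q ∈ R → q ∈ G) ∧
  ∀ Dset ∈ ℳ.toSet, Dset ⊆ P →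
    (∀ p ∈ P.toSet, ∃ q ∈ Dset.toSet, ZFSet.pair q p ∈ R) →
    ∃ q ∈ G, q ∈ Dset

/-- `ℳ'` is the generic extension `ℳ[G]`: the least transitive ZFC⁻-model containing `ℳ`
and (a set coding) `G`, with the same ordinals as `ℳ`. -/
def IsGenericExt (ℳ ℳ' : ZFSet) (G : Set ZFSet) : Prop :=
  IsTransModel ℳ' ∧ ℳ ⊆ ℳ' ∧ (∃ g ∈ ℳ'.toSet, g.toSet = G) ∧
  SameOrdinals ℳ.toSet ℳ'.toSet ∧
  ∀ N', IsTransModel N' → ℳ ⊆ N' → (∃ g ∈ N'.toSet, g.toSet = G) → ℳ' ⊆ N'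

/-- `f ∈ D` is a cofinal map from `γ` into the ordinal `α`. -/
def CofinalMapIn (D : Set ZFSet) (γ α f : ZFSet) : Prop :=
  f ∈ D ∧ IsZFunc γ f ∧ MapsInto f γ α ∧
  ∀ b ∈ α, ∃ a ∈ γ, b ∈ fapp f a ∨ b = fapp f a

/-- `γ` is the cofinality of the ordinal `α` as computed in `D`. -/
def IsCofIn (D : Set ZFSet) (α γ : ZFSet) : Prop :=
  IsOrd γ ∧ (∃ f, CofinalMapIn D γ α f) ∧ ∀ γ' ∈ γ, ¬ ∃ f, CofinalMapIn D γ' α f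

/-- The pair `ℳ ⊆ ℳ'` preserves all cofinalities. -/
def PreservesCofinalities (ℳ ℳ' : ZFSet) : Prop :=
  ∀ α ∈ ℳ.toSet, IsOrd α → ∀ γ, (IsCofIn ℳ.toSet α γ ↔ IsCofIn ℳ'.toSet α γ)

universe u
set_option linter.all false
variable {M : ZFSet.{u}}

/-! ### Definability toolkit -/

theorem Fml.bound (φ : Fml) : ∃ N : ℕ, ∀ (D : Set ZFSet.{u}) (v w : ℕ → ZFSet.{u}),
    (∀ i < N, v i = w i) → (Sat D φ v ↔ Sat D φ w) := by
  induction φ with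
  | mem i j =>
    refine ⟨max i j + 1, fun D v w h => ?_⟩
    simp only [Sat]; rw [h i (by omega), h j (by omega)]
  | eq i j =>
    refine ⟨max i j + 1, fun D v w h => ?_⟩
    simp only [Sat]; rw [h i (by omega), h j (by omega)]
  | impl φ ψ h1 h2 =>
    obtain ⟨N1, h1⟩ := h1
    obtain ⟨N2, h2⟩ := h2
    refine ⟨max N1 N2, fun D v w h => ?_⟩
    simp only [Sat]
    rw [h1 D v w (fun i hi => h i (by omega)), h2 D v w (fun i hi => h i (by omega))]
  | neg φ h1 =>
    obtain ⟨N1, h1⟩ := h1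
    refine ⟨N1, fun D v w h => ?_⟩
    simp only [Sat]
    rw [h1 D v w h]
  | all n φ h1 =>
    obtain ⟨N1, h1⟩ := h1
    refine ⟨N1, fun D v w h => ?_⟩
    simp only [Sat]
    refine forall₂_congr fun x _ => h1 D _ _ fun i hi => ?_
    by_cases hin : i = n
    · subst hin; simp
    · simp [hin, h i hi]

theorem Fml.rename (φ : Fml) : ∀ ρ : ℕ → ℕ, ∃ ψ : Fml, ∀ (D : Set ZFSet.{u}) (v : ℕ → ZFSet.{u}),
    Sat D ψ v ↔ Sat D φ (fun n => v (ρ n)) := by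
  induction φ with
  | mem i j => exact fun ρ => ⟨.mem (ρ i) (ρ j), fun D v => Iff.rfl⟩
  | eq i j => exact fun ρ => ⟨.eq (ρ i) (ρ j), fun D v => Iff.rfl⟩
  | impl φ ψ h1 h2 =>
    intro ρ
    obtain ⟨a, ha⟩ := h1 ρ
    obtain ⟨b, hb⟩ := h2 ρ
    exact ⟨.impl a b, fun D v => by simp only [Sat]; rw [ha, hb]⟩
  | neg φ h1 =>
    intro ρ
    obtain ⟨a, ha⟩ := h1 ρ
    exact ⟨.neg a, fun D v => by simp only [Sat]; rw [ha]⟩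
  | all n φ h1 =>
    intro ρ
    obtain ⟨N, hN⟩ := Fml.bound.{u} φ
    obtain ⟨k, hk⟩ : ∃ k, ∀ i < N, ρ i < k := by
      refine ⟨(Finset.range N).sup ρ + 1, fun i hi => ?_⟩
      exact Nat.lt_succ_of_le (Finset.le_sup (Finset.mem_range.2 hi))
    obtain ⟨a, ha⟩ := h1 (Function.update ρ n k)
    refine ⟨.all k a, fun D v => ?_⟩
    simp only [Sat]
    refine forall₂_congr fun x _ => ?_
    rw [ha]
    refine hN D _ _ fun i hi => ?_
    by_cases hin : i = n
    · subst hin; simp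
    · have := hk i hi
      simp [hin, this.ne]

/-- valuations into `M` -/
def AM (M : ZFSet.{u}) (v : ℕ → ZFSet.{u}) : Prop := ∀ n, v n ∈ M

def mix (v p : ℕ → ZFSet.{u}) (n : ℕ) : ZFSet.{u} := if n % 2 = 0 then v (n / 2) else p (n / 2)

theorem mix_even (v p : ℕ → ZFSet.{u}) (n : ℕ) : mix v p (2 * n) = v n := by
  simp [mix]

theorem mix_odd (v p : ℕ → ZFSet.{u}) (n : ℕ) : mix v p (2 * n + 1) = p n := by
  have h : (2 * n + 1) % 2 = 1 := by omega
  have h' : (2 * n + 1) / 2 = n := by omega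
  simp [mix, h, h']

/-- Definability with parameters over `M`. -/
def Dp (M : ZFSet.{u}) (P : (ℕ → ZFSet.{u}) → Prop) : Prop :=
  ∃ (φ : Fml) (p : ℕ → ZFSet.{u}), AM M p ∧ ∀ v, AM M v → (Sat M.toSet φ (mix v p) ↔ P v)


theorem nat_even_odd (n : ℕ) : (∃ k, n = 2 * k) ∨ ∃ k, n = 2 * k + 1 := by
  rcases Nat.even_or_odd' n with ⟨k, h | h⟩
  · exact Or.inl ⟨k, h⟩
  · exact Or.inr ⟨k, h⟩

theorem Dp.congr {P Q : (ℕ → ZFSet.{u}) → Prop} (h : Dp M P)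
    (hPQ : ∀ v, AM M v → (P v ↔ Q v)) : Dp M Q := by
  obtain ⟨φ, p, hp, h⟩ := h
  exact ⟨φ, p, hp, fun v hv => (h v hv).trans (hPQ v hv)⟩

theorem Dp.ren {P : (ℕ → ZFSet.{u}) → Prop} (ρ : ℕ → ℕ) (h : Dp M P) :
    Dp M (fun v => P (fun n => v (ρ n))) := by
  obtain ⟨φ, p, hp, h⟩ := h
  obtain ⟨ψ, hψ⟩ := φ.rename (fun n => if n % 2 = 0 then 2 * ρ (n / 2) else n)
  refine ⟨ψ, p, hp, fun v hv => ?_⟩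
  refine (hψ _ _).trans (Iff.trans ?_ (h (fun n => v (ρ n)) (fun n => hv _)))
  have : (fun n => mix v p (if n % 2 = 0 then 2 * ρ (n / 2) else n)) =
      mix (fun n => v (ρ n)) p := by
    funext n
    rcases nat_even_odd n with ⟨k, rfl | rfl⟩ | ⟨k, rfl⟩
    · rw [mix_even]; simp [mix_even]
    · have h1 : (2 * k + 1) % 2 = 1 := by omega
      rw [mix_odd]; simp [h1, mix_odd]
  rw [this]

theorem Dp.joint {P Q : (ℕ → ZFSet.{u}) → Prop} (hP : Dp M P) (hQ : Dp M Q) :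
    ∃ (φ ψ : Fml) (p : ℕ → ZFSet.{u}), AM M p ∧
      (∀ v, AM M v → (Sat M.toSet φ (mix v p) ↔ P v)) ∧
      (∀ v, AM M v → (Sat M.toSet ψ (mix v p) ↔ Q v)) := by
  obtain ⟨φ, p, hp, h⟩ := hP
  obtain ⟨ψ, q, hq, h'⟩ := hQ
  obtain ⟨a, ha⟩ := φ.rename (fun n => if n % 2 = 0 then n else 2 * (n - 1) + 1)
  obtain ⟨b, hb⟩ := ψ.rename (fun n => if n % 2 = 0 then n else 2 * n + 1)
  refine ⟨a, b, mix p q, ?_, fun v hv => ?_, fun v hv => ?_⟩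
  · intro n
    rcases nat_even_odd n with ⟨k, rfl⟩ | ⟨k, rfl⟩
    · rw [mix_even]; exact hp k
    · rw [mix_odd]; exact hq k
  · rw [ha, ← h v hv]
    have : (fun n => mix v (mix p q) (if n % 2 = 0 then n else 2 * (n - 1) + 1)) = mix v p := by
      funext n
      rcases nat_even_odd n with ⟨k, rfl⟩ | ⟨k, rfl⟩
      · simp [mix_even]
      · have h1 : (2 * k + 1) % 2 = 1 := by omega
        simp [h1, mix_odd, mix_even]
    rw [this]
  · rw [hb, ← h' v hv]
    have : (fun n => mix v (mix p q) (if n % 2 = 0 then n else 2 * n + 1)) = mix v q := by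
      funext n
      rcases nat_even_odd n with ⟨k, rfl⟩ | ⟨k, rfl⟩
      · simp [mix_even]
      · have h1 : (2 * k + 1) % 2 = 1 := by omega
        simp only [h1, mix_odd]
        simp [mix_odd]
    rw [this]

theorem Dp.not {P : (ℕ → ZFSet.{u}) → Prop} (hP : Dp M P) : Dp M (fun v => ¬ P v) := by
  obtain ⟨φ, p, hp, h⟩ := hP
  exact ⟨.neg φ, p, hp, fun v hv => by simp only [Sat]; rw [h v hv]⟩

theorem Dp.imp {P Q : (ℕ → ZFSet.{u}) → Prop} (hP : Dp M P) (hQ : Dp M Q) :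
    Dp M (fun v => P v → Q v) := by
  obtain ⟨φ, ψ, p, hp, h, h'⟩ := hP.joint hQ
  exact ⟨.impl φ ψ, p, hp, fun v hv => by simp only [Sat]; rw [h v hv, h' v hv]⟩

theorem Dp.and {P Q : (ℕ → ZFSet.{u}) → Prop} (hP : Dp M P) (hQ : Dp M Q) :
    Dp M (fun v => P v ∧ Q v) :=
  (hP.imp hQ.not).not.congr fun v _ => by tauto

theorem Dp.or {P Q : (ℕ → ZFSet.{u}) → Prop} (hP : Dp M P) (hQ : Dp M Q) :
    Dp M (fun v => P v ∨ Q v) :=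
  (hP.not.imp hQ).congr fun v _ => by tauto

theorem Dp.iff {P Q : (ℕ → ZFSet.{u}) → Prop} (hP : Dp M P) (hQ : Dp M Q) :
    Dp M (fun v => P v ↔ Q v) :=
  ((hP.imp hQ).and (hQ.imp hP)).congr fun v _ => by tauto

/-- cons a value in front of a valuation -/
def vcons (x : ZFSet.{u}) (v : ℕ → ZFSet.{u}) : ℕ → ZFSet.{u}
  | 0 => x
  | n + 1 => v n

theorem AM.cons {x : ZFSet.{u}} {v : ℕ → ZFSet.{u}} (hx : x ∈ M) (hv : AM M v) :
    AM M (vcons x v)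
  | 0 => hx
  | n + 1 => hv n

theorem Dp.allM {P : ZFSet.{u} → (ℕ → ZFSet.{u}) → Prop}
    (hP : Dp M (fun v => P (v 0) (fun n => v (n + 1)))) :
    Dp M (fun v => ∀ x ∈ M, P x v) := by
  obtain ⟨φ, p, hp, h⟩ := hP
  obtain ⟨ψ, hψ⟩ := φ.rename
    (fun m => if m = 0 then 1 else if m % 2 = 0 then m - 2 else m + 2)
  refine ⟨.all 1 ψ, vcons (p 0) p, AM.cons (hp 0) hp, fun v hv => ?_⟩
  simp only [Sat]
  refine forall₂_congr fun x hx => ?_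
  rw [hψ]
  have := h (vcons x v) (AM.cons hx hv)
  simp only [vcons] at this
  rw [← this]
  have : (fun m => Function.update (mix v (vcons (p 0) p)) 1 x
      (if m = 0 then 1 else if m % 2 = 0 then m - 2 else m + 2)) = mix (vcons x v) p := by
    funext m
    rcases nat_even_odd m with ⟨k, rfl⟩ | ⟨k, rfl⟩
    · rcases k with _ | k
      · rw [mix_even]; simp [vcons]
      · have e1 : 2 * (k + 1) - 2 = 2 * k := by omega
        have e2 : 2 * k ≠ 1 := by omega
        rw [mix_even]
        simp [e1, e2, mix_even, vcons]
    · have h1 : (2 * k + 1) % 2 = 1 := by omega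
      have e1 : 2 * k + 1 + 2 = 2 * (k + 1) + 1 := by omega
      rw [mix_odd]
      simp only [h1, e1]
      simp [mix_odd, vcons]
  rw [this]

theorem Dp.exM {P : ZFSet.{u} → (ℕ → ZFSet.{u}) → Prop}
    (hP : Dp M (fun v => P (v 0) (fun n => v (n + 1)))) :
    Dp M (fun v => ∃ x ∈ M, P x v) :=
  (Dp.allM (P := fun x v => ¬ P x v) hP.not).not.congr fun v _ => by push Not; rfl

theorem Dp.vmem (i j : ℕ) (c : ZFSet.{u}) (hc : c ∈ M) : Dp M (fun v => v i ∈ v j) :=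
  ⟨.mem (2 * i) (2 * j), fun _ => c, fun _ => hc, fun v _ => by simp only [Sat, mix_even]⟩

theorem Dp.veq (i j : ℕ) (c : ZFSet.{u}) (hc : c ∈ M) : Dp M (fun v => v i = v j) :=
  ⟨.eq (2 * i) (2 * j), fun _ => c, fun _ => hc, fun v _ => by simp only [Sat, mix_even]⟩

/-- definable terms -/
def Tm (M : ZFSet.{u}) (t : (ℕ → ZFSet.{u}) → ZFSet.{u}) : Prop :=
  (∀ v, AM M v → t v ∈ M) ∧ Dp M (fun v => v 0 = t (fun n => v (n + 1)))

theorem Dp.nonempty {P : (ℕ → ZFSet.{u}) → Prop} (hP : Dp M P) : ∃ c, c ∈ M := by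
  obtain ⟨φ, p, hp, h⟩ := hP
  exact ⟨p 0, hp 0⟩

theorem Tm.const {c : ZFSet.{u}} (hc : c ∈ M) : Tm M (fun _ => c) := by
  refine ⟨fun _ _ => hc, .eq 0 1, fun _ => c, fun _ => hc, fun v hv => ?_⟩
  simp only [Sat]
  rw [show (0:ℕ) = 2 * 0 by rfl, show (1:ℕ) = 2 * 0 + 1 by rfl, mix_even, mix_odd]

theorem Tm.var {c : ZFSet.{u}} (hc : c ∈ M) (i : ℕ) : Tm M (fun v => v i) :=
  ⟨fun v hv => hv i, Dp.veq 0 (i + 1) c hc⟩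

theorem Tm.ren {t : (ℕ → ZFSet.{u}) → ZFSet.{u}} (ρ : ℕ → ℕ) (h : Tm M t) :
    Tm M (fun v => t (fun n => v (ρ n))) := by
  refine ⟨fun v hv => h.1 _ fun n => hv _, ?_⟩
  exact (h.2.ren (fun n => match n with | 0 => 0 | n + 1 => ρ n + 1)).congr fun v _ => Iff.rfl

theorem Dp.sub {P : ZFSet.{u} → (ℕ → ZFSet.{u}) → Prop} {t : (ℕ → ZFSet.{u}) → ZFSet.{u}}
    (ht : Tm M t) (hP : Dp M (fun v => P (v 0) (fun n => v (n + 1)))) :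
    Dp M (fun v => P (t v) v) := by
  refine (Dp.exM (P := fun x v => x = t v ∧ P x v) (ht.2.and hP)).congr fun v hv => ?_
  constructor
  · rintro ⟨x, _, rfl, h⟩; exact h
  · intro h; exact ⟨_, ht.1 v hv, rfl, h⟩

theorem Dp.sub1 {P : ZFSet.{u} → Prop} {t : (ℕ → ZFSet.{u}) → ZFSet.{u}}
    (hP : Dp M (fun v => P (v 0))) (ht : Tm M t) : Dp M (fun v => P (t v)) :=
  Dp.sub (P := fun x _ => P x) ht hP

theorem Dp.sub2 {P : ZFSet.{u} → ZFSet.{u} → Prop} {t s : (ℕ → ZFSet.{u}) → ZFSet.{u}}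
    (hP : Dp M (fun v => P (v 0) (v 1))) (ht : Tm M t) (hs : Tm M s) :
    Dp M (fun v => P (t v) (s v)) := by
  refine Dp.sub (P := fun x v => P x (s v)) ht ?_
  refine Dp.sub (P := fun y v => P (v 0) y) (hs.ren (fun n => n + 1)) ?_
  exact hP.ren (fun n => match n with | 0 => 1 | 1 => 0 | n => n)

theorem Dp.sub3 {P : ZFSet.{u} → ZFSet.{u} → ZFSet.{u} → Prop}
    {t s r : (ℕ → ZFSet.{u}) → ZFSet.{u}}
    (hP : Dp M (fun v => P (v 0) (v 1) (v 2))) (ht : Tm M t) (hs : Tm M s) (hr : Tm M r) :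
    Dp M (fun v => P (t v) (s v) (r v)) := by
  refine Dp.sub (P := fun x v => P x (s v) (r v)) ht ?_
  refine Dp.sub (P := fun y v => P (v 0) y (r fun n => v (n + 1))) (hs.ren (fun n => n + 1)) ?_
  refine Dp.sub (P := fun z v => P (v 1) (v 0) z) (hr.ren (fun n => n + 1 + 1)) ?_
  exact hP.ren (fun n => match n with | 0 => 2 | 1 => 1 | 2 => 0 | n => n)

theorem Dp.sub4 {P : ZFSet.{u} → ZFSet.{u} → ZFSet.{u} → ZFSet.{u} → Prop}
    {t s r q : (ℕ → ZFSet.{u}) → ZFSet.{u}}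
    (hP : Dp M (fun v => P (v 0) (v 1) (v 2) (v 3))) (ht : Tm M t) (hs : Tm M s) (hr : Tm M r)
    (hq : Tm M q) :
    Dp M (fun v => P (t v) (s v) (r v) (q v)) := by
  refine Dp.sub (P := fun x v => P x (s v) (r v) (q v)) ht ?_
  refine Dp.sub (P := fun y v => P (v 0) y (r fun n => v (n + 1)) (q fun n => v (n + 1)))
    (hs.ren (fun n => n + 1)) ?_
  refine Dp.sub (P := fun z v => P (v 1) (v 0) z (q fun n => v (n + 1 + 1)))
    (hr.ren (fun n => n + 1 + 1)) ?_
  refine Dp.sub (P := fun z v => P (v 2) (v 1) (v 0) z) (hq.ren (fun n => n + 1 + 1 + 1)) ?_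
  exact hP.ren (fun n => match n with | 0 => 3 | 1 => 2 | 2 => 1 | 3 => 0 | n => n)

theorem Tm.sub1 {f : ZFSet.{u} → ZFSet.{u}} {t : (ℕ → ZFSet.{u}) → ZFSet.{u}}
    (hf : Tm M (fun v => f (v 0))) (ht : Tm M t) : Tm M (fun v => f (t v)) := by
  refine ⟨fun v hv => hf.1 (vcons (t v) v) (AM.cons (ht.1 v hv) hv), ?_⟩
  obtain ⟨c, hc⟩ := ht.2.nonempty
  exact Dp.sub2 (P := fun x y => x = f y) hf.2 (Tm.var hc 0) (ht.ren fun n => n + 1)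

theorem Tm.sub2 {f : ZFSet.{u} → ZFSet.{u} → ZFSet.{u}} {t s : (ℕ → ZFSet.{u}) → ZFSet.{u}}
    (hf : Tm M (fun v => f (v 0) (v 1))) (ht : Tm M t) (hs : Tm M s) :
    Tm M (fun v => f (t v) (s v)) := by
  refine ⟨fun v hv => hf.1 (vcons (t v) (vcons (s v) v))
    (AM.cons (ht.1 v hv) (AM.cons (hs.1 v hv) hv)), ?_⟩
  obtain ⟨c, hc⟩ := ht.2.nonempty
  exact Dp.sub3 (P := fun x y z => x = f y z) hf.2 (Tm.var hc 0) (ht.ren fun n => n + 1)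
    (hs.ren fun n => n + 1)

theorem Tm.sub3 {f : ZFSet.{u} → ZFSet.{u} → ZFSet.{u} → ZFSet.{u}}
    {t s r : (ℕ → ZFSet.{u}) → ZFSet.{u}}
    (hf : Tm M (fun v => f (v 0) (v 1) (v 2))) (ht : Tm M t) (hs : Tm M s) (hr : Tm M r) :
    Tm M (fun v => f (t v) (s v) (r v)) := by
  refine ⟨fun v hv => hf.1 (vcons (t v) (vcons (s v) (vcons (r v) v)))
    (AM.cons (ht.1 v hv) (AM.cons (hs.1 v hv) (AM.cons (hr.1 v hv) hv))), ?_⟩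
  obtain ⟨c, hc⟩ := ht.2.nonempty
  exact Dp.sub4 (P := fun x y z w => x = f y z w) hf.2 (Tm.var hc 0) (ht.ren fun n => n + 1)
    (hs.ren fun n => n + 1) (hr.ren fun n => n + 1)

theorem Dp.mem {s t : (ℕ → ZFSet.{u}) → ZFSet.{u}} (hs : Tm M s) (ht : Tm M t) :
    Dp M (fun v => s v ∈ t v) := by
  obtain ⟨c, hc⟩ := ht.2.nonempty
  exact Dp.sub2 (P := fun x y => x ∈ y) (Dp.vmem 0 1 c hc) hs ht

theorem Dp.eq {s t : (ℕ → ZFSet.{u}) → ZFSet.{u}} (hs : Tm M s) (ht : Tm M t) :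
    Dp M (fun v => s v = t v) := by
  obtain ⟨c, hc⟩ := ht.2.nonempty
  exact Dp.sub2 (P := fun x y => x = y) (Dp.veq 0 1 c hc) hs ht

theorem Dp.triv {c : ZFSet.{u}} (hc : c ∈ M) (p : Prop) : Dp M (fun _ => p) := by
  by_cases h : p
  · exact (Dp.veq 0 0 c hc).congr fun v _ => by simp [h]
  · exact (Dp.veq 0 0 c hc).not.congr fun v _ => by simp [h]

/-- Satisfaction in a definable class is definable. -/
theorem Dp.sat {K : Set ZFSet.{u}} (hK : Dp M (fun v => v 0 ∈ K)) (hKM : ∀ x ∈ K, x ∈ M)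
    (φ : Fml) : ∀ t : ℕ → (ℕ → ZFSet.{u}) → ZFSet.{u}, (∀ i, Tm M (t i)) →
    Dp M (fun v => Sat K φ (fun i => t i v)) := by
  induction φ with
  | mem i j => exact fun t ht => (ht i |> Dp.mem) (ht j)
  | eq i j => exact fun t ht => (ht i |> Dp.eq) (ht j)
  | impl φ ψ h1 h2 => exact fun t ht => (h1 t ht).imp (h2 t ht)
  | neg φ h1 => exact fun t ht => (h1 t ht).not
  | all n φ h1 =>
    intro t ht
    obtain ⟨c, hc⟩ := hK.nonempty
    refine (Dp.allM (P := fun x v => x ∈ K → Sat K φ (Function.update (fun i => t i v) n x))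
      (hK.imp ?_)).congr fun v hv => ?_
    · have := h1 (fun i => if i = n then fun v => v 0 else fun v => t i (fun n => v (n + 1)))
        (fun i => by
          by_cases hi : i = n
          · simp only [hi, if_true]; exact Tm.var hc 0
          · simp only [hi, if_false]; exact (ht i).ren fun n => n + 1)
      refine this.congr fun v hv => ?_
      have e : (fun i => (if i = n then fun v => v 0 else
          fun v : ℕ → ZFSet => t i (fun n => v (n + 1)) : (ℕ → ZFSet) → ZFSet) v) =
          Function.update (fun i => t i fun n => v (n + 1)) n (v 0) := by
        funext i
        by_cases hi : i = n
        · subst hi; simp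
        · simp [hi]
      rw [e]
    · simp only [Sat]
      exact ⟨fun h x hx => h x (hKM x hx) hx, fun h x _ hx => h x hx⟩

/-- Transitive models of ZF⁻ (without choice). -/
structure TM0 (M : ZFSet.{u}) : Prop where
  trans : M.IsTransitive
  omega : ZFSet.omega ∈ M
  upair : ∀ x ∈ M, ∀ y ∈ M, ({x, y} : ZFSet) ∈ M
  union : ∀ x ∈ M, (⋃₀ x : ZFSet) ∈ M
  sep' : ∀ (φ : Fml) (v : ℕ → ZFSet), (∀ n, v n ∈ M) → ∀ a ∈ M,
    ∃ b ∈ M, ∀ x, x ∈ b ↔ x ∈ a ∧ Sat M.toSet φ (Function.update v 0 x)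
  coll' : ∀ (φ : Fml) (v : ℕ → ZFSet), (∀ n, v n ∈ M) → ∀ a ∈ M,
    (∀ x ∈ a, ∃ y ∈ M, Sat M.toSet φ (Function.update (Function.update v 0 x) 1 y)) →
    ∃ b ∈ M, ∀ x ∈ a, ∃ y ∈ b, Sat M.toSet φ (Function.update (Function.update v 0 x) 1 y)

theorem IsTransModel.tm0 (h : IsTransModel M) : TM0 M :=
  ⟨h.1, h.2.1, h.2.2.1, h.2.2.2.1, h.2.2.2.2.1, h.2.2.2.2.2.1⟩

theorem IsTransModel.wo (h : IsTransModel M) : ∀ x ∈ M, ∃ r ∈ M, IsWellOrderOn x r :=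
  h.2.2.2.2.2.2

theorem TM0.sep (h : TM0 M) {P : ZFSet.{u} → Prop} (hP : Dp M (fun v => P (v 0)))
    {a : ZFSet.{u}} (ha : a ∈ M) : ZFSet.sep P a ∈ M := by
  obtain ⟨φ, p, hp, hφ⟩ := hP
  obtain ⟨ψ, hψ⟩ := φ.rename (fun n => if n % 2 = 0 then 0 else n)
  obtain ⟨b, hb, hb'⟩ := h.sep' ψ (mix p p) (fun n => by unfold mix; split_ifs <;> exact hp _) a ha
  convert hb
  ext x
  rw [hb', ZFSet.mem_sep]
  refine and_congr_right fun hx => ?_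
  have hxM := h.trans a ha hx
  refine Iff.trans ?_ (hψ _ _).symm
  refine Iff.trans (hφ (fun _ => x) (fun _ => hxM)).symm ?_
  have : (fun n => Function.update (mix p p) 0 x (if n % 2 = 0 then 0 else n)) =
      mix (fun _ => x) p := by
    funext n
    rcases nat_even_odd n with ⟨k, rfl⟩ | ⟨k, rfl⟩
    · rw [mix_even]; simp
    · have h1 : (2 * k + 1) % 2 = 1 := by omega
      rw [mix_odd]; simp [h1, mix_odd]
  rw [this]

theorem TM0.coll (h : TM0 M) {P : ZFSet.{u} → ZFSet.{u} → Prop}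
    (hP : Dp M (fun v => P (v 0) (v 1)))
    {a : ZFSet.{u}} (ha : a ∈ M) (hex : ∀ x ∈ a, ∃ y ∈ M, P x y) :
    ∃ b ∈ M, ∀ x ∈ a, ∃ y ∈ b, P x y := by
  obtain ⟨φ, p, hp, hφ⟩ := hP
  obtain ⟨ψ, hψ⟩ := φ.rename
    (fun n => if n = 0 then 0 else if n = 2 then 1 else n + 2)
  have key : ∀ x ∈ M, ∀ y ∈ M, Sat M.toSet ψ
      (Function.update (Function.update (fun n => p ((n - 3) / 2)) 0 x) 1 y) ↔ P x y := by
    intro x hx y hy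
    refine (hψ _ _).trans (Iff.trans ?_ (hφ (fun n => if n = 0 then x else if n = 1 then y else
      p ((2 * n - 1) / 2)) (fun n => by dsimp only; split_ifs <;> first | assumption | exact hp _)))
    have : (fun n => Function.update (Function.update (fun n => p ((n - 3) / 2)) 0 x) 1 y
        (if n = 0 then 0 else if n = 2 then 1 else n + 2)) =
        mix (fun n => if n = 0 then x else if n = 1 then y else p ((2 * n - 1) / 2)) p := by
      funext n
      rcases nat_even_odd n with ⟨k, rfl⟩ | ⟨k, rfl⟩
      · rw [mix_even]
        rcases k with _ | _ | k
        · simp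
        · simp
        · have e1 : 2 * (k + 1 + 1) ≠ 2 := by omega
          have e2 : 2 * (k + 1 + 1) + 2 - 3 = 2 * (k + 1 + 1) - 1 := by omega
          simp [e1, e2]
      · rw [mix_odd]
        have e1 : 2 * k + 1 ≠ 2 := by omega
        have e2 : (2 * k + 1 + 2 - 3) / 2 = k := by omega
        simp [e1, e2]
    rw [this]
  obtain ⟨b, hb, hb'⟩ := h.coll' ψ (fun n => p ((n - 3) / 2)) (fun n => hp _) a ha
    (fun x hx => by
      obtain ⟨y, hy, hxy⟩ := hex x hx
      exact ⟨y, hy, (key x (h.trans a ha hx) y hy).2 hxy⟩)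
  refine ⟨b, hb, fun x hx => ?_⟩
  obtain ⟨y, hy, hxy⟩ := hb' x hx
  exact ⟨y, hy, (key x (h.trans a ha hx) y (h.trans b hb hy)).1 hxy⟩

/-! ### Closure properties of transitive models -/

theorem Dp.inst {P : (ℕ → ZFSet.{u}) → Prop} (h : Dp M P) {c : ℕ → ZFSet.{u}} (hc : AM M c)
    (σ : ℕ → ℕ ⊕ ℕ) : Dp M (fun w => P (fun n => Sum.elim w c (σ n))) := by
  obtain ⟨φ, p, hp, h⟩ := h
  obtain ⟨ψ, hψ⟩ := φ.rename (fun n => if n % 2 = 0 then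
    (Sum.elim (fun i => 2 * i) (fun j => 2 * (2 * j) + 1) (σ (n / 2))) else 2 * n + 1)
  refine ⟨ψ, mix c p, fun n => by unfold mix; split_ifs <;> [exact hc _; exact hp _],
    fun v hv => ?_⟩
  refine (hψ _ _).trans (Iff.trans ?_ (h _ fun n => ?_))
  · have : (fun n => mix v (mix c p) (if n % 2 = 0 then
        (Sum.elim (fun i => 2 * i) (fun j => 2 * (2 * j) + 1) (σ (n / 2))) else 2 * n + 1)) =
        mix (fun n => Sum.elim v c (σ n)) p := by
      funext n
      rcases nat_even_odd n with ⟨k, rfl⟩ | ⟨k, rfl⟩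
      · rw [mix_even]
        have h1 : (2 * k) % 2 = 0 := by omega
        have h2 : (2 * k) / 2 = k := by omega
        rw [if_pos h1, h2]
        rcases σ k with i | j
        · simp [mix_even]
        · simp only [Sum.elim_inr, mix_odd, mix_even]
      · have h1 : ¬ (2 * k + 1) % 2 = 0 := by omega
        rw [if_neg h1]; simp only [mix_odd]
    rw [this]
  · rcases σ n with i | j
    · exact hv i
    · exact hc j

/-- fix all but the first variable -/
theorem Dp.fix1 {P : ZFSet.{u} → (ℕ → ZFSet.{u}) → Prop}
    (h : Dp M (fun v => P (v 0) (fun n => v (n + 1)))) {c : ℕ → ZFSet.{u}} (hc : AM M c) :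
    Dp M (fun w => P (w 0) c) :=
  (h.inst hc (fun n => match n with | 0 => .inl 0 | n + 1 => .inr n)).congr fun _ _ => Iff.rfl

/-- fix all but the first two variables -/
theorem Dp.fix2 {P : ZFSet.{u} → ZFSet.{u} → (ℕ → ZFSet.{u}) → Prop}
    (h : Dp M (fun v => P (v 0) (v 1) (fun n => v (n + 2)))) {c : ℕ → ZFSet.{u}} (hc : AM M c) :
    Dp M (fun w => P (w 0) (w 1) c) :=
  (h.inst hc (fun n => match n with | 0 => .inl 0 | 1 => .inl 1 | n + 2 => .inr n)).congr
    fun _ _ => Iff.rfl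

theorem TM0.vr (hM : TM0 M) (i : ℕ) : Tm M (fun v => v i) := Tm.var hM.omega i

theorem Dp.ball (hM : TM0 M) {t : (ℕ → ZFSet.{u}) → ZFSet.{u}}
    {P : ZFSet.{u} → (ℕ → ZFSet.{u}) → Prop} (ht : Tm M t)
    (hP : Dp M (fun v => P (v 0) (fun n => v (n + 1)))) :
    Dp M (fun v => ∀ x ∈ t v, P x v) := by
  refine (Dp.allM (P := fun x v => x ∈ t v → P x v)
    ((Dp.mem (hM.vr 0) (ht.ren fun n => n + 1)).imp hP)).congr fun v hv => ?_
  exact ⟨fun h x hx => h x (hM.trans _ (ht.1 v hv) hx) hx, fun h x _ hx => h x hx⟩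

theorem Dp.bex (hM : TM0 M) {t : (ℕ → ZFSet.{u}) → ZFSet.{u}}
    {P : ZFSet.{u} → (ℕ → ZFSet.{u}) → Prop} (ht : Tm M t)
    (hP : Dp M (fun v => P (v 0) (fun n => v (n + 1)))) :
    Dp M (fun v => ∃ x ∈ t v, P x v) :=
  (Dp.ball hM (P := fun x v => ¬ P x v) ht hP.not).not.congr fun v _ => by push Not; rfl

theorem Dp.subset (hM : TM0 M) {s t : (ℕ → ZFSet.{u}) → ZFSet.{u}} (hs : Tm M s) (ht : Tm M t) :
    Dp M (fun v => s v ⊆ t v) :=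
  (Dp.ball hM (P := fun x v => x ∈ t v) hs (Dp.mem (hM.vr 0) (ht.ren fun n => n + 1))).congr
    fun v _ => ⟨fun h x hx => h x hx, fun h x hx => h hx⟩

theorem Tm.mk (hM : TM0 M) {t : (ℕ → ZFSet.{u}) → ZFSet.{u}}
    {Q : ZFSet.{u} → (ℕ → ZFSet.{u}) → Prop}
    (hQ : Dp M (fun v => Q (v 0) (fun n => v (n + 1))))
    (hcl : ∀ v, AM M v → t v ∈ M)
    (h : ∀ v, AM M v → ∀ x ∈ M, (x ∈ t v ↔ Q x v)) : Tm M t := by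
  refine ⟨hcl, ?_⟩
  refine (Dp.allM (P := fun x v => x ∈ v 0 ↔ Q x (fun n => v (n + 1)))
    ((Dp.mem (hM.vr 0) (hM.vr 1)).iff ?_)).congr fun v hv => ?_
  · exact hQ.ren (fun n => match n with | 0 => 0 | n + 1 => n + 2)
  · have hv' : AM M (fun n => v (n + 1)) := fun n => hv _
    constructor
    · intro h1
      ext x
      constructor
      · intro hx
        have hxM := hM.trans _ (hv 0) hx
        exact (h _ hv' x hxM).2 ((h1 x hxM).1 hx)
      · intro hx
        have hxM := hM.trans _ (hcl _ hv') hx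
        exact (h1 x hxM).2 ((h _ hv' x hxM).1 hx)
    · intro h1 x hx
      rw [h1]; exact h _ hv' x hx

theorem Tm.sep (hM : TM0 M) {t : (ℕ → ZFSet.{u}) → ZFSet.{u}}
    {P : ZFSet.{u} → (ℕ → ZFSet.{u}) → Prop} (ht : Tm M t)
    (hP : Dp M (fun v => P (v 0) (fun n => v (n + 1)))) :
    Tm M (fun v => ZFSet.sep (fun x => P x v) (t v)) := by
  refine Tm.mk hM (Q := fun x v => x ∈ t v ∧ P x v)
    ((Dp.mem (hM.vr 0) (ht.ren fun n => n + 1)).and hP) (fun v hv => ?_) (fun v hv x _ => ?_)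
  · exact hM.sep (hP.fix1 hv) (ht.1 v hv)
  · rw [ZFSet.mem_sep]

theorem Tm.upair (hM : TM0 M) {s t : (ℕ → ZFSet.{u}) → ZFSet.{u}} (hs : Tm M s) (ht : Tm M t) :
    Tm M (fun v => ({s v, t v} : ZFSet.{u})) := by
  refine Tm.mk hM (Q := fun x v => x = s v ∨ x = t v)
    ((Dp.eq (hM.vr 0) (hs.ren fun n => n + 1)).or (Dp.eq (hM.vr 0) (ht.ren fun n => n + 1)))
    (fun v hv => hM.upair _ (hs.1 v hv) _ (ht.1 v hv)) (fun v hv x _ => by simp)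

theorem Tm.singleton (hM : TM0 M) {t : (ℕ → ZFSet.{u}) → ZFSet.{u}} (ht : Tm M t) :
    Tm M (fun v => ({t v} : ZFSet.{u})) := by
  have := Tm.upair hM ht ht
  have e : ∀ x : ZFSet.{u}, ({x, x} : ZFSet.{u}) = {x} := fun x => by ext; simp
  simpa [e] using this

theorem Tm.sUnion (hM : TM0 M) {t : (ℕ → ZFSet.{u}) → ZFSet.{u}} (ht : Tm M t) :
    Tm M (fun v => (⋃₀ (t v) : ZFSet.{u})) := by
  refine Tm.mk hM (Q := fun x v => ∃ y ∈ t v, x ∈ y)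
    (Dp.bex hM (P := fun y v => v 0 ∈ y) (ht.ren fun n => n + 1) (Dp.mem (hM.vr 1) (hM.vr 0)))
    (fun v hv => hM.union _ (ht.1 v hv)) (fun v hv x _ => by simp)

theorem Tm.union (hM : TM0 M) {s t : (ℕ → ZFSet.{u}) → ZFSet.{u}} (hs : Tm M s) (ht : Tm M t) :
    Tm M (fun v => s v ∪ t v) := by
  have := Tm.sUnion hM (Tm.upair hM hs ht)
  have e : ∀ x y : ZFSet.{u}, (⋃₀ ({x, y} : ZFSet.{u}) : ZFSet.{u}) = x ∪ y := fun x y => by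
    ext; simp
  simpa [e] using this

theorem Tm.insert (hM : TM0 M) {s t : (ℕ → ZFSet.{u}) → ZFSet.{u}} (hs : Tm M s) (ht : Tm M t) :
    Tm M (fun v => insert (s v) (t v)) := by
  have := Tm.union hM (Tm.singleton hM hs) ht
  have e : ∀ x y : ZFSet.{u}, ({x} : ZFSet.{u}) ∪ y = Insert.insert x y := fun x y => by
    ext; simp
  simpa [e] using this

theorem Tm.inter (hM : TM0 M) {s t : (ℕ → ZFSet.{u}) → ZFSet.{u}} (hs : Tm M s) (ht : Tm M t) :
    Tm M (fun v => s v ∩ t v) := by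
  have := Tm.sep hM (P := fun x v => x ∈ t v) hs (Dp.mem (hM.vr 0) (ht.ren fun n => n + 1))
  have e : ∀ x y : ZFSet.{u}, ZFSet.sep (fun z => z ∈ y) x = x ∩ y := fun x y => by
    ext; simp
  simpa [e] using this

theorem Tm.diff (hM : TM0 M) {s t : (ℕ → ZFSet.{u}) → ZFSet.{u}} (hs : Tm M s) (ht : Tm M t) :
    Tm M (fun v => s v \ t v) := by
  have := Tm.sep hM (P := fun x v => x ∉ t v) hs (Dp.mem (hM.vr 0) (ht.ren fun n => n + 1)).not
  have e : ∀ x y : ZFSet.{u}, ZFSet.sep (fun z => z ∉ y) x = x \ y := fun x y => by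
    ext; simp
  simpa [e] using this

theorem Tm.pair (hM : TM0 M) {s t : (ℕ → ZFSet.{u}) → ZFSet.{u}} (hs : Tm M s) (ht : Tm M t) :
    Tm M (fun v => ZFSet.pair (s v) (t v)) :=
  Tm.upair hM (Tm.singleton hM hs) (Tm.upair hM hs ht)

theorem TM0.empty (hM : TM0 M) : (∅ : ZFSet.{u}) ∈ M := hM.trans _ hM.omega ZFSet.omega_zero

theorem TM0.pair (hM : TM0 M) {x y : ZFSet.{u}} (hx : x ∈ M) (hy : y ∈ M) :
    ZFSet.pair x y ∈ M :=
  (Tm.pair hM (Tm.const hx) (Tm.const hy)).1 (fun _ => x) (fun _ => hx)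

theorem TM0.pair_iff (hM : TM0 M) {x y : ZFSet.{u}} :
    ZFSet.pair x y ∈ M ↔ x ∈ M ∧ y ∈ M := by
  refine ⟨fun h => ?_, fun h => hM.pair h.1 h.2⟩
  have h1 : ({x, y} : ZFSet.{u}) ∈ M := hM.trans _ h (by simp [ZFSet.pair])
  exact ⟨hM.trans _ h1 (by simp), hM.trans _ h1 (by simp)⟩

/-- image of a set under a (class) function -/
def img (f : ZFSet.{u} → ZFSet.{u}) (a : ZFSet.{u}) : ZFSet.{u} :=
  ZFSet.range (fun x : a => f x)

theorem mem_img {f : ZFSet.{u} → ZFSet.{u}} {a y : ZFSet.{u}} :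
    y ∈ img f a ↔ ∃ x ∈ a, y = f x := by
  simp only [img, ZFSet.mem_range]
  constructor
  · rintro ⟨⟨x, hx⟩, rfl⟩; exact ⟨x, hx, rfl⟩
  · rintro ⟨x, hx, rfl⟩; exact ⟨⟨x, hx⟩, rfl⟩

theorem Tm.img (hM : TM0 M) {t : (ℕ → ZFSet.{u}) → ZFSet.{u}}
    {f : ZFSet.{u} → (ℕ → ZFSet.{u}) → ZFSet.{u}} (ht : Tm M t)
    (hf : Tm M (fun v => f (v 0) (fun n => v (n + 1)))) :
    Tm M (fun v => MPaper.img (fun x => f x v) (t v)) := by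
  have hD : Dp M (fun v => v 1 = f (v 0) (fun n => v (n + 2))) :=
    hf.2.ren (fun n => match n with | 0 => 1 | 1 => 0 | n + 2 => n + 2)
  refine Tm.mk hM (Q := fun x v => ∃ y ∈ t v, x = f y v)
    (Dp.bex hM (P := fun y v => v 0 = f y (fun n => v (n + 1))) (ht.ren fun n => n + 1) ?_)
    (fun v hv => ?_) (fun v hv x _ => mem_img)
  · exact hD
  · have h1 := Dp.fix2 (P := fun x y v => y = f x v) hD hv
    obtain ⟨b, hb, hb'⟩ := hM.coll (P := fun x y => y = f x v) h1 (ht.1 v hv) (fun x hx =>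
      ⟨f x v, hf.1 (vcons x v) (AM.cons (hM.trans _ (ht.1 v hv) hx) hv), rfl⟩)
    have h2 : MPaper.img (fun x => f x v) (t v) =
        ZFSet.sep (fun y => ∃ x ∈ t v, y = f x v) b := by
      ext y
      rw [mem_img, ZFSet.mem_sep]
      constructor
      · rintro ⟨x, hx, rfl⟩
        obtain ⟨y, hy, rfl⟩ := hb' x hx
        exact ⟨hy, x, hx, rfl⟩
      · exact fun h => h.2
    rw [h2]
    refine hM.sep ?_ hb
    refine Dp.bex hM (P := fun x w => w 0 = f x v) (Tm.const (ht.1 v hv)) ?_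
    exact h1

theorem Tm.prod (hM : TM0 M) {s t : (ℕ → ZFSet.{u}) → ZFSet.{u}} (hs : Tm M s) (ht : Tm M t) :
    Tm M (fun v => ZFSet.prod (s v) (t v)) := by
  have h := Tm.sUnion hM (Tm.img hM (f := fun x v => MPaper.img (fun y => ZFSet.pair x y) (t v)) hs
    (Tm.img hM (f := fun y v => ZFSet.pair (v 0) y) (ht.ren fun n => n + 1)
      (Tm.pair hM (hM.vr 1) (hM.vr 0))))
  have e : ∀ a b : ZFSet.{u}, (⋃₀ (MPaper.img (fun x => MPaper.img (fun y => ZFSet.pair x y) b) a)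
      : ZFSet.{u}) = ZFSet.prod a b := by
    intro a b
    ext z
    simp only [ZFSet.mem_sUnion, mem_img, ZFSet.mem_prod]
    constructor
    · rintro ⟨_, ⟨x, hx, rfl⟩, h⟩
      rw [mem_img] at h
      obtain ⟨y, hy, rfl⟩ := h
      exact ⟨x, hx, y, hy, rfl⟩
    · rintro ⟨x, hx, y, hy, rfl⟩
      exact ⟨_, ⟨x, hx, rfl⟩, mem_img.2 ⟨y, hy, rfl⟩⟩
  simpa [e] using h

theorem mem_UU_of_pair {f a b : ZFSet.{u}} (h : ZFSet.pair a b ∈ f) :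
    a ∈ (⋃₀ (⋃₀ f) : ZFSet.{u}) ∧ b ∈ (⋃₀ (⋃₀ f) : ZFSet.{u}) := by
  have : ({a, b} : ZFSet.{u}) ∈ (⋃₀ f : ZFSet.{u}) :=
    ZFSet.mem_sUnion.2 ⟨_, h, by simp [ZFSet.pair]⟩
  exact ⟨ZFSet.mem_sUnion.2 ⟨_, this, by simp⟩, ZFSet.mem_sUnion.2 ⟨_, this, by simp⟩⟩

theorem mem_fapp {f a x : ZFSet.{u}} : x ∈ fapp f a ↔ ∃ b, ZFSet.pair a b ∈ f ∧ x ∈ b := by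
  unfold fapp
  rw [ZFSet.mem_sUnion]
  constructor
  · rintro ⟨b, hb, hx⟩
    exact ⟨b, (ZFSet.mem_sep.1 hb).2, hx⟩
  · rintro ⟨b, hb, hx⟩
    exact ⟨b, ZFSet.mem_sep.2 ⟨(mem_UU_of_pair hb).2, hb⟩, hx⟩

theorem fapp_eq {f a b : ZFSet.{u}} (h : ZFSet.pair a b ∈ f)
    (hu : ∀ c, ZFSet.pair a c ∈ f → c = b) : fapp f a = b := by
  ext x
  rw [mem_fapp]
  constructor
  · rintro ⟨c, hc, hx⟩; rwa [hu c hc] at hx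
  · exact fun hx => ⟨b, h, hx⟩

theorem IsZFunc.fapp_eq {d f a b : ZFSet.{u}} (hf : IsZFunc d f) (h : ZFSet.pair a b ∈ f) :
    fapp f a = b := by
  obtain ⟨a', ha', b', e⟩ := hf.1 _ h
  obtain ⟨rfl, rfl⟩ := ZFSet.pair_inj.1 e
  exact MPaper.fapp_eq h fun c hc => (hf.2 a ha').unique hc h

theorem IsZFunc.pair_mem {d f a : ZFSet.{u}} (hf : IsZFunc d f) (ha : a ∈ d) :
    ZFSet.pair a (fapp f a) ∈ f := by
  obtain ⟨b, hb, -⟩ := hf.2 a ha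
  rwa [hf.fapp_eq hb]

theorem IsZFunc.mem_iff {d f a b : ZFSet.{u}} (hf : IsZFunc d f) :
    ZFSet.pair a b ∈ f ↔ a ∈ d ∧ b = fapp f a := by
  constructor
  · intro h
    obtain ⟨a', ha', b', e⟩ := hf.1 _ h
    obtain ⟨rfl, rfl⟩ := ZFSet.pair_inj.1 e
    exact ⟨ha', (hf.fapp_eq h).symm⟩
  · rintro ⟨ha, rfl⟩; exact hf.pair_mem ha

theorem Tm.fapp (hM : TM0 M) {s t : (ℕ → ZFSet.{u}) → ZFSet.{u}} (hs : Tm M s) (ht : Tm M t) :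
    Tm M (fun v => MPaper.fapp (s v) (t v)) := by
  unfold MPaper.fapp
  refine Tm.sUnion hM (Tm.sep hM (P := fun b v => ZFSet.pair (t v) b ∈ s v)
    (Tm.sUnion hM (Tm.sUnion hM hs)) ?_)
  exact Dp.mem (Tm.pair hM (ht.ren fun n => n + 1) (hM.vr 0)) (hs.ren fun n => n + 1)

/-- the graph of a class function on a set -/
def grf (f : ZFSet.{u} → ZFSet.{u}) (a : ZFSet.{u}) : ZFSet.{u} :=
  img (fun x => ZFSet.pair x (f x)) a

theorem mem_grf {f : ZFSet.{u} → ZFSet.{u}} {a y : ZFSet.{u}} :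
    y ∈ grf f a ↔ ∃ x ∈ a, y = ZFSet.pair x (f x) := mem_img

theorem pair_mem_grf {f : ZFSet.{u} → ZFSet.{u}} {a x y : ZFSet.{u}} :
    ZFSet.pair x y ∈ grf f a ↔ x ∈ a ∧ y = f x := by
  rw [mem_grf]
  constructor
  · rintro ⟨z, hz, e⟩
    obtain ⟨rfl, rfl⟩ := ZFSet.pair_inj.1 e
    exact ⟨hz, rfl⟩
  · rintro ⟨hx, rfl⟩; exact ⟨x, hx, rfl⟩

theorem isZFunc_grf (f : ZFSet.{u} → ZFSet.{u}) (a : ZFSet.{u}) : IsZFunc a (grf f a) := by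
  constructor
  · intro p hp
    obtain ⟨x, hx, rfl⟩ := mem_grf.1 hp
    exact ⟨x, hx, f x, rfl⟩
  · intro x hx
    exact ⟨f x, pair_mem_grf.2 ⟨hx, rfl⟩, fun y hy => (pair_mem_grf.1 hy).2⟩

theorem fapp_grf {f : ZFSet.{u} → ZFSet.{u}} {a x : ZFSet.{u}} (hx : x ∈ a) :
    fapp (grf f a) x = f x :=
  (isZFunc_grf f a).fapp_eq (pair_mem_grf.2 ⟨hx, rfl⟩)

theorem IsZFunc.eq_grf {d f : ZFSet.{u}} (hf : IsZFunc d f) : f = grf (fapp f) d := by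
  ext p
  rw [mem_grf]
  constructor
  · intro hp
    obtain ⟨a, ha, b, rfl⟩ := hf.1 p hp
    exact ⟨a, ha, by rw [hf.fapp_eq hp]⟩
  · rintro ⟨a, ha, rfl⟩; exact hf.pair_mem ha

theorem Tm.grf (hM : TM0 M) {t : (ℕ → ZFSet.{u}) → ZFSet.{u}}
    {f : ZFSet.{u} → (ℕ → ZFSet.{u}) → ZFSet.{u}} (ht : Tm M t)
    (hf : Tm M (fun v => f (v 0) (fun n => v (n + 1)))) :
    Tm M (fun v => MPaper.grf (fun x => f x v) (t v)) :=
  Tm.img hM (f := fun x v => ZFSet.pair x (f x v)) ht (Tm.pair hM (hM.vr 0) hf)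

/-- projections -/
def pfst (p : ZFSet.{u}) : ZFSet.{u} :=
  ⋃₀ (ZFSet.sep (fun a => ∃ b ∈ (⋃₀ p : ZFSet.{u}), p = ZFSet.pair a b) (⋃₀ p))

def psnd (p : ZFSet.{u}) : ZFSet.{u} :=
  ⋃₀ (ZFSet.sep (fun b => ∃ a ∈ (⋃₀ p : ZFSet.{u}), p = ZFSet.pair a b) (⋃₀ p))

theorem mem_U_pair (a b : ZFSet.{u}) : a ∈ (⋃₀ (ZFSet.pair a b) : ZFSet.{u}) ∧
    b ∈ (⋃₀ (ZFSet.pair a b) : ZFSet.{u}) := by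
  simp [ZFSet.pair]

theorem pfst_pair (a b : ZFSet.{u}) : pfst (ZFSet.pair a b) = a := by
  have : ZFSet.sep (fun a' => ∃ b' ∈ (⋃₀ (ZFSet.pair a b) : ZFSet.{u}),
      ZFSet.pair a b = ZFSet.pair a' b') (⋃₀ (ZFSet.pair a b)) = {a} := by
    ext x
    rw [ZFSet.mem_sep, ZFSet.mem_singleton]
    constructor
    · rintro ⟨-, b', -, e⟩; exact (ZFSet.pair_inj.1 e).1.symm
    · rintro rfl; exact ⟨(mem_U_pair _ _).1, b, (mem_U_pair _ _).2, rfl⟩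
  rw [pfst, this, ZFSet.sUnion_singleton]

theorem psnd_pair (a b : ZFSet.{u}) : psnd (ZFSet.pair a b) = b := by
  have : ZFSet.sep (fun b' => ∃ a' ∈ (⋃₀ (ZFSet.pair a b) : ZFSet.{u}),
      ZFSet.pair a b = ZFSet.pair a' b') (⋃₀ (ZFSet.pair a b)) = {b} := by
    ext x
    rw [ZFSet.mem_sep, ZFSet.mem_singleton]
    constructor
    · rintro ⟨-, b', -, e⟩; exact (ZFSet.pair_inj.1 e).2.symm
    · rintro rfl; exact ⟨(mem_U_pair _ _).2, a, (mem_U_pair _ _).1, rfl⟩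
  rw [psnd, this, ZFSet.sUnion_singleton]

theorem Tm.pfst (hM : TM0 M) {t : (ℕ → ZFSet.{u}) → ZFSet.{u}} (ht : Tm M t) :
    Tm M (fun v => MPaper.pfst (t v)) := by
  unfold MPaper.pfst
  refine Tm.sUnion hM (Tm.sep hM
    (P := fun a v => ∃ b ∈ (⋃₀ (t v) : ZFSet.{u}), t v = ZFSet.pair a b) (Tm.sUnion hM ht) ?_)
  refine Dp.bex hM (P := fun b v => t (fun n => v (n + 1)) = ZFSet.pair (v 0) b)
    (Tm.sUnion hM (ht.ren fun n => n + 1)) ?_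
  exact Dp.eq (ht.ren fun n => n + 1 + 1) (Tm.pair hM (hM.vr 1) (hM.vr 0))

theorem Tm.psnd (hM : TM0 M) {t : (ℕ → ZFSet.{u}) → ZFSet.{u}} (ht : Tm M t) :
    Tm M (fun v => MPaper.psnd (t v)) := by
  unfold MPaper.psnd
  refine Tm.sUnion hM (Tm.sep hM
    (P := fun b v => ∃ a ∈ (⋃₀ (t v) : ZFSet.{u}), t v = ZFSet.pair a b) (Tm.sUnion hM ht) ?_)
  refine Dp.bex hM (P := fun a v => t (fun n => v (n + 1)) = ZFSet.pair a (v 0))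
    (Tm.sUnion hM (ht.ren fun n => n + 1)) ?_
  exact Dp.eq (ht.ren fun n => n + 1 + 1) (Tm.pair hM (hM.vr 0) (hM.vr 1))

theorem Dp.ne {s t : (ℕ → ZFSet.{u}) → ZFSet.{u}} (hs : Tm M s) (ht : Tm M t) :
    Dp M (fun v => s v ≠ t v) := (Dp.eq hs ht).not

theorem Dp.trivM (hM : TM0 M) (p : Prop) : Dp M (fun _ => p) := Dp.triv hM.omega p

theorem Tm.ite (hM : TM0 M) {P : (ℕ → ZFSet.{u}) → Prop} {s t : (ℕ → ZFSet.{u}) → ZFSet.{u}}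
    (hP : Dp M P) (hs : Tm M s) (ht : Tm M t) :
    Tm M (fun v => if P v then s v else t v) := by
  refine ⟨fun v hv => ?_, ?_⟩
  · dsimp only; split_ifs
    · exact hs.1 v hv
    · exact ht.1 v hv
  · refine (((hP.ren fun n => n + 1).imp hs.2).and ((hP.ren fun n => n + 1).not.imp ht.2)).congr
      fun v hv => ?_
    dsimp only
    split_ifs with h <;> simp [h]

theorem TM0.vr' (hM : TM0 M) (i : ℕ) : Tm M (fun v => v i) := Tm.var hM.omega i

/-- automation for definability goals -/
theorem dpa {P : Prop} (h : P := by
  with_reducible repeat' first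
    | assumption | apply TM0.vr | (apply Tm.const; first | assumption | (apply TM0.omega; assumption) | (apply TM0.empty; assumption)) | apply Dp.subset | apply Dp.not | apply Dp.ne | apply Dp.iff | apply Dp.and | apply Dp.or
    | apply Dp.allM | apply Dp.exM | apply Dp.ball | apply Dp.bex | apply Dp.mem | apply Dp.eq | apply Dp.imp
    | apply Tm.pair | apply Tm.singleton | apply Tm.upair | apply Tm.union | apply Tm.inter | apply Tm.diff | apply Tm.insert | apply Tm.sUnion
    | apply Tm.prod | apply Tm.fapp | apply Tm.pfst | apply Tm.psnd | apply Tm.ite | apply Tm.sep | apply Tm.img | apply Tm.grf | apply TM0.omega | apply TM0.empty | apply Dp.trivM) : P := h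



/-! ### Recursion along set relations -/

def erel (e y x : ZFSet.{u}) : Prop := ZFSet.pair y x ∈ e

def preds (e x : ZFSet.{u}) : ZFSet.{u} :=
  ZFSet.sep (fun z => ZFSet.pair z x ∈ e) (⋃₀ (⋃₀ e))

theorem mem_preds {e x z : ZFSet.{u}} : z ∈ preds e x ↔ ZFSet.pair z x ∈ e := by
  rw [preds, ZFSet.mem_sep]
  exact ⟨fun h => h.2, fun h => ⟨(mem_UU_of_pair h).1, h⟩⟩

theorem wfe (e : ZFSet.{u}) : WellFounded (fun y x => ZFSet.pair y x ∈ e ∧ Acc (erel e) x) := by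
  refine ⟨fun x => ?_⟩
  by_cases h : Acc (erel e) x
  · induction h with
    | intro x h ih => exact ⟨_, fun y hy => ih y hy.1⟩
  · exact ⟨_, fun y hy => absurd hy.2 h⟩

def wfr (H : ZFSet.{u} → ZFSet.{u} → ZFSet.{u}) (e : ZFSet.{u}) : ZFSet.{u} → ZFSet.{u} :=
  (wfe e).fix (fun x ih => if Acc (erel e) x then
    H x (grf (fun z => if h : ZFSet.pair z x ∈ e ∧ Acc (erel e) x then ih z h else ∅) (preds e x))
    else ∅)

theorem img_congr {f g : ZFSet.{u} → ZFSet.{u}} {a : ZFSet.{u}} (h : ∀ x ∈ a, f x = g x) :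
    img f a = img g a := by
  ext y
  simp only [mem_img]
  exact ⟨fun ⟨x, hx, e⟩ => ⟨x, hx, by rw [e, h x hx]⟩, fun ⟨x, hx, e⟩ => ⟨x, hx, by rw [e, h x hx]⟩⟩

theorem grf_congr {f g : ZFSet.{u} → ZFSet.{u}} {a : ZFSet.{u}} (h : ∀ x ∈ a, f x = g x) :
    grf f a = grf g a := img_congr fun x hx => by rw [h x hx]

theorem wfr_eq {H : ZFSet.{u} → ZFSet.{u} → ZFSet.{u}} {e x : ZFSet.{u}} (hx : Acc (erel e) x) :
    wfr H e x = H x (grf (wfr H e) (preds e x)) := by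
  conv_lhs => rw [wfr, WellFounded.fix_eq]
  rw [if_pos hx]
  congr 1
  refine grf_congr fun z hz => ?_
  rw [dif_pos ⟨mem_preds.1 hz, hx⟩]
  rfl

theorem wfr_not {H : ZFSet.{u} → ZFSet.{u} → ZFSet.{u}} {e x : ZFSet.{u}}
    (hx : ¬ Acc (erel e) x) : wfr H e x = ∅ := by
  rw [wfr, WellFounded.fix_eq, if_neg hx]

theorem grf_fst_snd {f g : ZFSet.{u} → ZFSet.{u}} {a : ZFSet.{u}} :
    img (fun q => g (ZFSet.pair (pfst q) (psnd q))) (grf f a) =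
      img (fun x => g (ZFSet.pair x (f x))) a := by
  ext y
  simp only [mem_img]
  constructor
  · rintro ⟨q, hq, rfl⟩
    obtain ⟨x, hx, rfl⟩ := mem_grf.1 hq
    exact ⟨x, hx, by rw [pfst_pair, psnd_pair]⟩
  · rintro ⟨x, hx, rfl⟩
    exact ⟨ZFSet.pair x (f x), mem_grf.2 ⟨x, hx, rfl⟩, by rw [pfst_pair, psnd_pair]⟩

section rec
variable (G : ZFSet.{u} → ZFSet.{u} → ZFSet.{u} → ZFSet.{u})

def G2 (p x s : ZFSet.{u}) : ZFSet.{u} :=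
  ZFSet.pair (img (fun q => pfst (psnd q)) s)
    (G p x (img (fun q => ZFSet.pair (pfst q) (psnd (psnd q))) s))

def sub0 (s e x : ZFSet.{u}) : ZFSet.{u} := ZFSet.sep (fun q => ZFSet.pair (pfst q) x ∈ e) s

def Good (p e s : ZFSet.{u}) : Prop :=
  ∀ q ∈ s, (∀ z ∈ preds e (pfst q), ∃ q' ∈ s, pfst q' = z) ∧
    q = ZFSet.pair (pfst q) (G2 G p (pfst q) (sub0 s e (pfst q)))

def GoodE (p e s : ZFSet.{u}) : Prop :=
  ∀ q ∈ s, (∀ z ∈ preds e (pfst q), ∃ q' ∈ s, pfst q' = z) ∧ Acc (erel e) (pfst q) ∧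
    q = ZFSet.pair (pfst q) (wfr (G2 G p) e (pfst q))

variable {G}

theorem Good.acc {p e s : ZFSet.{u}} (h : Good G p e s) : ∀ q ∈ s, Acc (erel e) (pfst q) := by
  have : ∀ c q, q ∈ s → pfst (psnd q) = c → Acc (erel e) (pfst q) := by
    intro c
    induction c using ZFSet.inductionOn with
    | _ c ih =>
    intro q hq hc
    refine ⟨_, fun z hz => ?_⟩
    obtain ⟨h1, h2⟩ := h q hq
    obtain ⟨q', hq', rfl⟩ := h1 z (mem_preds.2 hz)
    refine ih (pfst (psnd q')) ?_ q' hq' rfl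
    rw [← hc, h2, psnd_pair, G2, pfst_pair, mem_img]
    exact ⟨q', ZFSet.mem_sep.2 ⟨hq', hz⟩, rfl⟩
  exact fun q hq => this _ q hq rfl

theorem GoodE.sub0 {p e s : ZFSet.{u}} (h : ∀ q ∈ s, q = ZFSet.pair (pfst q) (wfr (G2 G p) e (pfst q)))
    {x : ZFSet.{u}} (hx : ∀ z ∈ preds e x, ∃ q' ∈ s, pfst q' = z) :
    sub0 s e x = grf (wfr (G2 G p) e) (preds e x) := by
  ext q
  rw [MPaper.sub0, ZFSet.mem_sep, mem_grf]
  constructor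
  · rintro ⟨hq, hq'⟩
    exact ⟨_, mem_preds.2 hq', h q hq⟩
  · rintro ⟨z, hz, rfl⟩
    obtain ⟨q', hq', rfl⟩ := hx z hz
    rw [← h q' hq']
    exact ⟨hq', mem_preds.1 hz⟩

theorem good_iff {p e s : ZFSet.{u}} : Good G p e s ↔ GoodE G p e s := by
  constructor
  · intro h
    have key : ∀ x, Acc (erel e) x → ∀ q ∈ s, pfst q = x →
        q = ZFSet.pair (pfst q) (wfr (G2 G p) e (pfst q)) := by
      intro x hx
      induction hx with
      | intro x hx ih =>
      rintro q hq rfl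
      obtain ⟨h1, h2⟩ := h q hq
      rw [wfr_eq ⟨_, hx⟩]
      conv_lhs => rw [h2]
      congr 2
      ext r
      rw [MPaper.sub0, ZFSet.mem_sep, mem_grf]
      constructor
      · rintro ⟨hr, hr'⟩
        exact ⟨_, mem_preds.2 hr', ih _ hr' r hr rfl⟩
      · rintro ⟨z, hz, rfl⟩
        obtain ⟨q', hq', rfl⟩ := h1 z hz
        rw [← ih _ (mem_preds.1 hz) q' hq' rfl]
        exact ⟨hq', mem_preds.1 hz⟩
    exact fun q hq => ⟨(h q hq).1, h.acc q hq, key _ (h.acc q hq) q hq rfl⟩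
  · intro h q hq
    obtain ⟨h1, h2, h3⟩ := h q hq
    refine ⟨h1, ?_⟩
    rw [GoodE.sub0 (fun q hq => (h q hq).2.2) h1]
    rwa [wfr_eq h2] at h3

theorem wfr_G2 {p e : ZFSet.{u}} {x : ZFSet.{u}} (hx : Acc (erel e) x) :
    psnd (wfr (G2 G p) e x) = wfr (G p) e x := by
  induction hx with
  | intro x hx ih =>
  rw [wfr_eq ⟨_, hx⟩, wfr_eq ⟨_, hx⟩, G2, psnd_pair]
  congr 1
  ext y
  rw [mem_img, mem_grf]
  constructor
  · rintro ⟨q, hq, rfl⟩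
    obtain ⟨z, hz, rfl⟩ := mem_grf.1 hq
    exact ⟨z, hz, by rw [pfst_pair, psnd_pair, ih z (mem_preds.1 hz)]⟩
  · rintro ⟨z, hz, rfl⟩
    exact ⟨_, mem_grf.2 ⟨z, hz, rfl⟩, by rw [pfst_pair, psnd_pair, ih z (mem_preds.1 hz)]⟩

theorem tm_preds (hM : TM0 M) {s t : (ℕ → ZFSet.{u}) → ZFSet.{u}} (hs : Tm M s) (ht : Tm M t) :
    Tm M (fun v => MPaper.preds (s v) (t v)) := by
  have : Tm M (fun v => MPaper.preds (v 0) (v 1)) := by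
    unfold MPaper.preds; exact dpa
  exact this.sub2 (f := MPaper.preds) hs ht

theorem Tm.G2 (hM : TM0 M) (hG : Tm M (fun v => G (v 0) (v 1) (v 2))) :
    Tm M (fun v => MPaper.G2 G (v 0) (v 1) (v 2)) := by
  unfold MPaper.G2
  refine Tm.pair hM dpa ?_
  exact Tm.sub3 (f := G) hG dpa dpa dpa

theorem dp_good (hM : TM0 M) (hG : Tm M (fun v => G (v 0) (v 1) (v 2))) :
    Dp M (fun v => Good G (v 0) (v 1) (v 2)) := by
  unfold Good MPaper.sub0
  refine Dp.ball hM (hM.vr 2) (Dp.and ?_ (Dp.eq (hM.vr 0) (Tm.pair hM dpa ?_)))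
  · refine Dp.ball hM (tm_preds hM dpa dpa) dpa
  · exact Tm.sub3 (Tm.G2 hM hG) dpa dpa dpa

theorem good_exists (hM : TM0 M) (hG : Tm M (fun v => G (v 0) (v 1) (v 2)))
    {p e : ZFSet.{u}} (hp : p ∈ M) (he : e ∈ M) {x : ZFSet.{u}} (hx : Acc (erel e) x) :
    x ∈ M → ∃ s ∈ M, Good G p e s ∧ ∃ q ∈ s, pfst q = x := by
  induction hx with
  | intro x hx ih =>
  intro hxM
  have hpr : MPaper.preds e x ∈ M := (tm_preds hM (Tm.const he) (Tm.const hxM)).1 (fun _ => e) (fun _ => he)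
  have hD : Dp M (fun v => Good G p e (v 0)) := Dp.sub3 (dp_good hM hG) dpa dpa dpa
  have hD1 : Dp M (fun v => Good G p e (v 1)) := Dp.sub3 (dp_good hM hG) dpa dpa dpa
  obtain ⟨b, hb, hb'⟩ := hM.coll (P := fun z s => Good G p e s ∧ ∃ q ∈ s, pfst q = z)
    (hD1.and dpa) hpr (fun z hz => by
      obtain ⟨s, hs, h⟩ := ih z (mem_preds.1 hz) (hM.trans _ hpr hz)
      exact ⟨s, hs, h⟩)
  have hbM := hM.sep hD hb
  have hS := hM.union _ hbM
  set S : ZFSet := ⋃₀ (ZFSet.sep (fun s => Good G p e s) b) with hSdef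
  have memS : ∀ q, q ∈ S ↔ ∃ s ∈ b, Good G p e s ∧ q ∈ s := by
    intro q
    rw [hSdef, ZFSet.mem_sUnion]
    constructor
    · rintro ⟨s, hs, hq⟩
      exact ⟨s, (ZFSet.mem_sep.1 hs).1, (ZFSet.mem_sep.1 hs).2, hq⟩
    · rintro ⟨s, hs, h, hq⟩
      exact ⟨s, ZFSet.mem_sep.2 ⟨hs, h⟩, hq⟩
  have gS : GoodE G p e S := by
    intro q hq
    obtain ⟨s, hs, h, hq⟩ := (memS q).1 hq
    obtain ⟨h1, h2, h3⟩ := good_iff.1 h q hq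
    refine ⟨fun z hz => ?_, h2, h3⟩
    obtain ⟨q', hq', e⟩ := h1 z hz
    exact ⟨q', (memS q').2 ⟨s, hs, h, hq'⟩, e⟩
  have cS : ∀ z ∈ MPaper.preds e x, ∃ q' ∈ S, pfst q' = z := by
    intro z hz
    obtain ⟨s, hs, h, q, hq, e⟩ := hb' z hz
    exact ⟨q, (memS q).2 ⟨s, hs, h, hq⟩, e⟩
  have e0 := GoodE.sub0 (fun q hq => (gS q hq).2.2) cS
  have hF : wfr (MPaper.G2 G p) e x ∈ M := by
    rw [wfr_eq ⟨_, hx⟩, ← e0]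
    have hs0 : MPaper.sub0 S e x ∈ M := hM.sep dpa hS
    exact (Tm.sub3 (Tm.G2 hM hG) (Tm.const hp) (Tm.const hxM) (Tm.const hs0)).1 (fun _ => e)
      (fun _ => he)
  refine ⟨Insert.insert (ZFSet.pair x (wfr (MPaper.G2 G p) e x)) S, ?_, good_iff.2 ?_, _,
    ZFSet.mem_insert _ _, pfst_pair _ _⟩
  · exact (Tm.insert hM (Tm.const (hM.pair hxM hF)) (Tm.const hS)).1 (fun _ => e) (fun _ => he)
  · intro q hq
    rcases ZFSet.mem_insert_iff.1 hq with rfl | hq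
    · rw [pfst_pair]
      refine ⟨fun z hz => ?_, ⟨_, hx⟩, rfl⟩
      obtain ⟨q', hq', e⟩ := cS z hz
      exact ⟨q', ZFSet.mem_insert_of_mem _ hq', e⟩
    · obtain ⟨h1, h2, h3⟩ := gS q hq
      refine ⟨fun z hz => ?_, h2, h3⟩
      obtain ⟨q', hq', e⟩ := h1 z hz
      exact ⟨q', ZFSet.mem_insert_of_mem _ hq', e⟩

theorem acc_iff_good (hM : TM0 M) (hG : Tm M (fun v => G (v 0) (v 1) (v 2)))
    {p e : ZFSet.{u}} (hp : p ∈ M) (he : e ∈ M) {x : ZFSet.{u}} (hx : x ∈ M) :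
    (∃ s ∈ M, Good G p e s ∧ ∃ q ∈ s, pfst q = x) ↔ Acc (erel e) x := by
  refine ⟨?_, fun h => good_exists hM hG hp he h hx⟩
  rintro ⟨s, hs, h, q, hq, rfl⟩
  exact h.acc q hq

theorem tm_wfr (hM : TM0 M) (hG : Tm M (fun v => G (v 0) (v 1) (v 2))) :
    Tm M (fun v => MPaper.wfr (G (v 0)) (v 1) (v 2)) := by
  have h1 : Dp M (fun v => ∃ s ∈ M, Good G (v 1) (v 2) s ∧ ∃ q ∈ s, pfst q = v 3 ∧ v 0 = psnd (psnd q)) :=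
    Dp.exM ((Dp.sub3 (dp_good hM hG) dpa dpa dpa).and dpa)
  have h2 : Dp M (fun v => ∃ s ∈ M, Good G (v 1) (v 2) s ∧ ∃ q ∈ s, pfst q = v 3) :=
    Dp.exM ((Dp.sub3 (dp_good hM hG) dpa dpa dpa).and dpa)
  have key : ∀ p ∈ M, ∀ e ∈ M, ∀ x ∈ M, ∀ y,
      ((∃ s ∈ M, Good G p e s ∧ ∃ q ∈ s, pfst q = x ∧ y = psnd (psnd q)) ∨
        (¬ (∃ s ∈ M, Good G p e s ∧ ∃ q ∈ s, pfst q = x)) ∧ y = ∅) ↔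
        y = MPaper.wfr (G p) e x := by
    intro p hp e he x hx y
    rw [acc_iff_good hM hG hp he hx]
    constructor
    · rintro (⟨s, hs, h, q, hq, rfl, rfl⟩ | ⟨h, rfl⟩)
      · obtain ⟨h1, h2, h3⟩ := good_iff.1 h q hq
        conv_lhs => rw [h3, psnd_pair]
        exact wfr_G2 h2
      · rw [wfr_not h]
    · rintro rfl
      by_cases h : Acc (erel e) x
      · obtain ⟨s, hs, h', q, hq, rfl⟩ := good_exists hM hG hp he h hx
        refine Or.inl ⟨s, hs, h', q, hq, rfl, ?_⟩
        obtain ⟨h1, h2, h3⟩ := good_iff.1 h' q hq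
        conv_rhs => rw [h3, psnd_pair]
        exact (wfr_G2 h2).symm
      · exact Or.inr ⟨h, wfr_not h⟩
  refine ⟨fun v hv => ?_, ((h1.or (h2.not.and dpa)).congr fun v hv =>
    key (v 1) (hv 1) (v 2) (hv 2) (v 3) (hv 3) (v 0))⟩
  rcases (key (v 0) (hv 0) (v 1) (hv 1) (v 2) (hv 2) _).2 rfl with
    ⟨s, hs, h, q, hq, -, e⟩ | ⟨h, e⟩
  · dsimp only; rw [e]
    have hqM : q ∈ M := hM.trans _ hs hq
    exact (Tm.psnd hM (Tm.psnd hM (Tm.const hqM))).1 v hv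
  · dsimp only; rw [e]; exact hM.empty

end rec

theorem dp_acc (hM : TM0 M) {s t : (ℕ → ZFSet.{u}) → ZFSet.{u}} (hs : Tm M s) (ht : Tm M t) :
    Dp M (fun v => Acc (erel (s v)) (t v)) := by
  have hG : Tm M (fun v => (fun _ _ _ => ∅ : ZFSet.{u} → ZFSet.{u} → ZFSet.{u} → ZFSet.{u})
    (v 0) (v 1) (v 2)) := Tm.const hM.empty
  have h2 : Dp M (fun v => ∃ s ∈ M, Good (fun _ _ _ => ∅) ∅ (v 0) s ∧ ∃ q ∈ s, pfst q = v 1) :=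
    Dp.exM ((Dp.sub3 (dp_good hM hG) dpa dpa dpa).and dpa)
  exact Dp.sub2 (P := fun x y => Acc (erel x) y) (h2.congr fun v hv =>
    acc_iff_good hM hG hM.empty (hv 0) (hv 1)) hs ht

/-- Mostowski collapse -/
def coll (e : ZFSet.{u}) : ZFSet.{u} → ZFSet.{u} := wfr (fun _ s => img psnd s) e

theorem tm_coll (hM : TM0 M) {s t : (ℕ → ZFSet.{u}) → ZFSet.{u}} (hs : Tm M s) (ht : Tm M t) :
    Tm M (fun v => MPaper.coll (s v) (t v)) :=
  Tm.sub3 (f := fun p e x => MPaper.wfr (fun _ s => MPaper.img psnd s) e x)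
    (tm_wfr hM (G := fun _ _ s => MPaper.img psnd s) dpa) hs hs ht

theorem mem_coll {e x : ZFSet.{u}} (hx : Acc (erel e) x) {y : ZFSet.{u}} :
    y ∈ coll e x ↔ ∃ z, ZFSet.pair z x ∈ e ∧ y = coll e z := by
  rw [coll, wfr_eq hx, mem_img]
  constructor
  · rintro ⟨q, hq, rfl⟩
    obtain ⟨z, hz, rfl⟩ := mem_grf.1 hq
    exact ⟨z, mem_preds.1 hz, by rw [psnd_pair]⟩
  · rintro ⟨z, hz, rfl⟩
    exact ⟨_, mem_grf.2 ⟨z, mem_preds.2 hz, rfl⟩, by rw [psnd_pair]⟩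

theorem coll_not {e x : ZFSet.{u}} (hx : ¬ Acc (erel e) x) : coll e x = ∅ := wfr_not hx

theorem coll_mem_coll {e x y : ZFSet.{u}} (hx : Acc (erel e) x) (h : ZFSet.pair y x ∈ e) :
    coll e y ∈ coll e x := (mem_coll hx).2 ⟨y, h, rfl⟩

/-! ### Natural numbers, ordinals, choice -/

def nt : ℕ → ZFSet.{u}
  | 0 => ∅
  | n + 1 => Insert.insert (nt n) (nt n)

theorem nt_eq (n : ℕ) : nt.{u} n = ZFSet.mk (PSet.ofNat n) := by
  induction n with
  | zero => rfl
  | succ n ih => rw [nt, ih]; rfl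

theorem mem_omega {x : ZFSet.{u}} : x ∈ ZFSet.omega ↔ ∃ n, x = nt n := by
  constructor
  · induction x using Quotient.inductionOn with
    | _ x =>
    rintro ⟨⟨n⟩, hn⟩
    refine ⟨n, ?_⟩
    rw [nt_eq]
    exact Quotient.sound hn
  · rintro ⟨n, rfl⟩
    induction n with
    | zero => exact ZFSet.omega_zero
    | succ n ih => exact ZFSet.omega_succ ih

theorem nt_mem_omega (n : ℕ) : nt.{u} n ∈ ZFSet.omega.{u} := mem_omega.2 ⟨n, rfl⟩

theorem mem_nt {n : ℕ} {x : ZFSet.{u}} : x ∈ nt n ↔ ∃ m < n, x = nt m := by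
  induction n with
  | zero => simp [nt]
  | succ n ih =>
    rw [nt, ZFSet.mem_insert_iff, ih]
    constructor
    · rintro (rfl | ⟨m, hm, rfl⟩)
      · exact ⟨n, by omega, rfl⟩
      · exact ⟨m, by omega, rfl⟩
    · rintro ⟨m, hm, rfl⟩
      rcases Nat.lt_succ_iff_lt_or_eq.1 hm with h | rfl
      · exact Or.inr ⟨m, h, rfl⟩
      · exact Or.inl rfl

theorem nt_lt {m n : ℕ} (h : m < n) : nt.{u} m ∈ nt.{u} n := mem_nt.2 ⟨m, h, rfl⟩

theorem nt_inj {m n : ℕ} (h : nt.{u} m = nt.{u} n) : m = n := by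
  rcases lt_trichotomy m n with h1 | h1 | h1
  · exact absurd (h ▸ nt_lt h1) (ZFSet.mem_irrefl _)
  · exact h1
  · exact absurd (h ▸ nt_lt h1) (ZFSet.mem_irrefl _)

theorem nt_mem_iff {m n : ℕ} : nt.{u} m ∈ nt.{u} n ↔ m < n := by
  rw [mem_nt]
  exact ⟨fun ⟨k, hk, e⟩ => nt_inj e ▸ hk, fun h => ⟨m, h, rfl⟩⟩

theorem isOrdinal_nt (n : ℕ) : (nt.{u} n).IsOrdinal := by
  induction n with
  | zero => exact ZFSet.isOrdinal_empty
  | succ n ih => exact ZFSet.isOrdinal_succ ih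

theorem isOrdinal_omega : ZFSet.omega.{u}.IsOrdinal := by
  rw [ZFSet.isOrdinal_iff_forall_mem_isOrdinal]
  refine ⟨?_, ?_⟩
  · intro x hx y hy
    obtain ⟨n, rfl⟩ := mem_omega.1 hx
    obtain ⟨m, -, rfl⟩ := mem_nt.1 hy
    exact nt_mem_omega m
  · intro x hx
    obtain ⟨n, rfl⟩ := mem_omega.1 hx
    exact isOrdinal_nt n

theorem isOrd_iff {x : ZFSet.{u}} : IsOrd x ↔ x.IsOrdinal :=
  ZFSet.isOrdinal_iff_forall_mem_isTransitive.symm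

theorem TM0.mem_union (hM : TM0 M) {x y : ZFSet.{u}} (hx : x ∈ M) (hy : y ∈ M) : x ∪ y ∈ M :=
  (Tm.union hM (Tm.const hx) (Tm.const hy)).1 (fun _ => x) (fun _ => hx)

theorem TM0.mem_insert (hM : TM0 M) {x y : ZFSet.{u}} (hx : x ∈ M) (hy : y ∈ M) :
    Insert.insert x y ∈ M :=
  (Tm.insert hM (Tm.const hx) (Tm.const hy)).1 (fun _ => x) (fun _ => hx)

/-- a closed instance of a definable term -/
theorem Tm.cl {t : ZFSet.{u}} {x : ZFSet.{u}} (h : Tm M (fun _ => t)) : t ∈ M := by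
  obtain ⟨c, hc⟩ := h.2.nonempty
  exact h.1 (fun _ => c) (fun _ => hc)

theorem TM0.cl (hM : TM0 M) {t : ZFSet.{u}} (h : Tm M (fun _ => t)) : t ∈ M :=
  h.1 (fun _ => ∅) (fun _ => hM.empty)

theorem TM0.fapp_mem (hM : TM0 M) {f x : ZFSet.{u}} (hf : f ∈ M) (hx : x ∈ M) : fapp f x ∈ M :=
  hM.cl dpa

theorem dp_isZFunc (hM : TM0 M) {s t : (ℕ → ZFSet.{u}) → ZFSet.{u}} (hs : Tm M s) (ht : Tm M t) :
    Dp M (fun v => IsZFunc (s v) (t v)) := by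
  have h : Dp M (fun v => v 1 = grf (fun x => fapp (v 1) x) (v 0)) := dpa
  refine Dp.sub2 (P := IsZFunc) (h.congr fun v hv => ?_) hs ht
  constructor
  · intro e; rw [e]; exact isZFunc_grf _ _
  · exact fun e => e.eq_grf

theorem dp_trans (hM : TM0 M) {s : (ℕ → ZFSet.{u}) → ZFSet.{u}} (hs : Tm M s) :
    Dp M (fun v => (s v).IsTransitive) := by
  have h : Dp M (fun v => ∀ y ∈ v 0, y ⊆ v 0) := dpa
  exact Dp.sub1 (P := ZFSet.IsTransitive) h hs

theorem acc_of_wo {x r : ZFSet.{u}} :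
    (∀ S : Set ZFSet.{u}, S ⊆ x.toSet → S.Nonempty → ∃ a ∈ S, ∀ b ∈ S, ZFSet.pair b a ∉ r) ↔
      ∀ a ∈ x, Acc (fun b c => b ∈ x ∧ c ∈ x ∧ ZFSet.pair b c ∈ r) a := by
  constructor
  · intro h a ha
    by_contra hc
    obtain ⟨b, ⟨hb, hb'⟩, hmin⟩ := h {b | b ∈ x ∧ ¬ Acc (fun b c => b ∈ x ∧ c ∈ x ∧ ZFSet.pair b c ∈ r) b}
      (fun b hb => hb.1) ⟨a, ha, hc⟩
    refine hb' ⟨_, fun c hc => ?_⟩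
    by_contra hcc
    exact hmin c ⟨hc.1, hcc⟩ hc.2.2
  · rintro h S hS ⟨a, ha⟩
    have := h a (hS ha)
    induction this with
    | intro a _ ih =>
    by_cases hc : ∃ b ∈ S, ZFSet.pair b a ∈ r
    · obtain ⟨b, hb, hba⟩ := hc
      exact ih b ⟨hS hb, hS ha, hba⟩ hb
    · push Not at hc
      exact ⟨a, ha, hc⟩

theorem IsWellOrderOn.acc {x r a : ZFSet.{u}} (h : IsWellOrderOn x r) : Acc (erel r) a := by
  have key : ∀ a ∈ x, Acc (erel r) a := by
    intro a ha
    have := acc_of_wo.1 h.2.2.2.2 a ha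
    induction this with
    | intro a _ ih =>
    refine ⟨_, fun b hb => ?_⟩
    obtain ⟨b', hb', c', hc', e⟩ := h.1 _ hb
    obtain ⟨rfl, rfl⟩ := ZFSet.pair_inj.1 e
    exact ih b ⟨hb', hc', hb⟩ hb'
  refine ⟨_, fun b hb => ?_⟩
  obtain ⟨b', hb', c', hc', e⟩ := h.1 _ hb
  obtain ⟨rfl, rfl⟩ := ZFSet.pair_inj.1 e
  exact key b hb'

theorem dp_wo (hM : TM0 M) {s t : (ℕ → ZFSet.{u}) → ZFSet.{u}} (hs : Tm M s) (ht : Tm M t) :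
    Dp M (fun v => IsWellOrderOn (s v) (t v)) := by
  refine Dp.sub2 (P := IsWellOrderOn) ?_ hs ht
  unfold IsWellOrderOn
  have h1 : Dp M (fun v => ∀ p ∈ v 1, ∃ a ∈ v 0, ∃ b ∈ v 0, p = ZFSet.pair a b) := dpa
  have h2 : Dp M (fun v => ∀ a ∈ v 0, ∀ b ∈ v 0, a = b ∨ ZFSet.pair a b ∈ v 1 ∨ ZFSet.pair b a ∈ v 1) := dpa
  have h3 : Dp M (fun v => ∀ a ∈ v 0, ∀ b ∈ v 0, ∀ c ∈ v 0,
    ZFSet.pair a b ∈ v 1 → ZFSet.pair b c ∈ v 1 → ZFSet.pair a c ∈ v 1) := dpa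
  have h4 : Dp M (fun v => ∀ a ∈ v 0, ZFSet.pair a a ∉ v 1) := dpa
  have h5 : Dp M (fun v => ∀ a ∈ v 0, Acc (erel (v 1)) a) :=
    Dp.ball hM (hM.vr 0) (dp_acc hM (hM.vr 2) (hM.vr 0))
  refine (h1.and (h2.and (h3.and (h4.and h5)))).congr fun v hv => ?_
  refine and_congr_right fun c1 => and_congr_right fun c2 => and_congr_right fun c3 =>
    and_congr_right fun c4 => ?_
  rw [acc_of_wo]
  refine forall₂_congr fun a ha => ?_
  constructor
  · exact fun h => Subrelation.accessible (fun h => h.2.2) h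
  · intro h
    induction h with
    | intro a _ ih =>
    refine ⟨_, fun b hb => ?_⟩
    obtain ⟨b', hb', c', hc', e⟩ := c1 _ hb
    obtain ⟨rfl, rfl⟩ := ZFSet.pair_inj.1 e
    exact ih b ⟨hb', hc', hb⟩ hb'

/-- the `r`-least element of `c` -/
def lst (r c : ZFSet.{u}) : ZFSet.{u} :=
  ⋃₀ (ZFSet.sep (fun y => ∀ z ∈ c, ZFSet.pair z y ∉ r) c)

theorem lst_spec {x r c : ZFSet.{u}} (h : IsWellOrderOn x r) (hc : c ⊆ x) (hne : ∃ y, y ∈ c) :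
    lst r c ∈ c ∧ ∀ z ∈ c, ZFSet.pair z (lst r c) ∉ r := by
  obtain ⟨a, ha, hmin⟩ := h.2.2.2.2 c.toSet (fun y hy => hc hy) hne
  have : ZFSet.sep (fun y => ∀ z ∈ c, ZFSet.pair z y ∉ r) c = {a} := by
    ext y
    rw [ZFSet.mem_sep, ZFSet.mem_singleton]
    constructor
    · rintro ⟨hy, hy'⟩
      rcases h.2.1 y (hc hy) a (hc ha) with e | e | e
      · exact e
      · exact absurd e (hmin y hy)
      · exact absurd e (hy' a ha)
    · rintro rfl; exact ⟨ha, hmin⟩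
  rw [lst, this, ZFSet.sUnion_singleton]
  exact ⟨ha, hmin⟩

theorem tm_lst (hM : TM0 M) {s t : (ℕ → ZFSet.{u}) → ZFSet.{u}} (hs : Tm M s) (ht : Tm M t) :
    Tm M (fun v => lst (s v) (t v)) := by
  have h : Tm M (fun v => lst (v 0) (v 1)) := by unfold lst; exact dpa
  exact h.sub2 (f := lst) hs ht

theorem choice_fn (hM : IsTransModel M) {P : ZFSet.{u} → ZFSet.{u} → Prop}
    (hP : Dp M (fun v => P (v 0) (v 1))) {a : ZFSet.{u}} (ha : a ∈ M)
    (hex : ∀ x ∈ a, ∃ y ∈ M, P x y) :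
    ∃ f ∈ M, IsZFunc a f ∧ ∀ x ∈ a, fapp f x ∈ M ∧ P x (fapp f x) := by
  have h0 := hM.tm0
  obtain ⟨b, hb, hb'⟩ := h0.coll hP ha hex
  obtain ⟨r, hr, hwo⟩ := hM.wo b hb
  have hT : Tm M (fun v => ZFSet.sep (fun y => P (v 0) y) b) := by
    refine Tm.sep h0 (P := fun y v => P (v 0) y) (Tm.const hb) ?_
    exact Dp.sub2 hP (h0.vr 1) (h0.vr 0)
  have hf : grf (fun x => lst r (ZFSet.sep (fun y => P x y) b)) a ∈ M := by
    refine h0.cl (Tm.grf h0 (f := fun x _ => lst r (ZFSet.sep (fun y => P x y) b)) (Tm.const ha) ?_)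
    exact tm_lst h0 (Tm.const hr) hT
  refine ⟨_, hf, isZFunc_grf _ _, fun x hx => ?_⟩
  rw [fapp_grf hx]
  obtain ⟨y, hy, hxy⟩ := hb' x hx
  have := (lst_spec hwo (c := ZFSet.sep (fun y => P x y) b) (fun z hz => (ZFSet.mem_sep.1 hz).1)
    ⟨y, ZFSet.mem_sep.2 ⟨hy, hxy⟩⟩).1
  exact ⟨h0.trans _ hb (ZFSet.mem_sep.1 this).1, (ZFSet.mem_sep.1 this).2⟩

/-- automation for definability goals -/
theorem dpa2 {P : Prop} (h : P := by
  with_reducible repeat' first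
    | assumption | apply TM0.vr | (apply Tm.const; first | assumption | (apply TM0.omega; assumption) | (apply TM0.empty; assumption))
    | apply dp_isZFunc | apply dp_trans | apply dp_wo | apply dp_acc | apply tm_lst | apply tm_coll | apply tm_preds
    | apply Dp.subset | apply Dp.not | apply Dp.ne | apply Dp.iff | apply Dp.and | apply Dp.or
    | apply Dp.allM | apply Dp.exM | apply Dp.ball | apply Dp.bex | apply Dp.mem | apply Dp.eq | apply Dp.imp
    | apply Tm.pair | apply Tm.singleton | apply Tm.upair | apply Tm.union | apply Tm.inter | apply Tm.diff | apply Tm.insert | apply Tm.sUnion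
    | apply Tm.prod | apply Tm.fapp | apply Tm.pfst | apply Tm.psnd | apply Tm.ite | apply Tm.sep | apply Tm.img | apply Tm.grf | apply TM0.omega | apply TM0.empty | apply Dp.trivM) : P := h

/-! ### Recursion along omega, definability of being a model -/

def eps (a : ZFSet.{u}) : ZFSet.{u} := ZFSet.sep (fun q => pfst q ∈ psnd q) (ZFSet.prod a a)

theorem pair_mem_eps {a x y : ZFSet.{u}} : ZFSet.pair x y ∈ eps a ↔ x ∈ a ∧ y ∈ a ∧ x ∈ y := by
  rw [eps, ZFSet.mem_sep, ZFSet.pair_mem_prod, pfst_pair, psnd_pair, and_assoc]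

theorem acc_eps (a x : ZFSet.{u}) : Acc (erel (eps a)) x := by
  induction x using ZFSet.inductionOn with
  | _ x ih => exact ⟨_, fun y hy => ih y (pair_mem_eps.1 hy).2.2⟩

theorem preds_eps {a x : ZFSet.{u}} (ha : a.IsTransitive) (hx : x ∈ a) : preds (eps a) x = x := by
  ext y
  rw [mem_preds, pair_mem_eps]
  exact ⟨fun h => h.2.2, fun h => ⟨ha _ hx h, hx, h⟩⟩

theorem tm_eps (hM : TM0 M) {s : (ℕ → ZFSet.{u}) → ZFSet.{u}} (hs : Tm M s) :
    Tm M (fun v => eps (s v)) := by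
  have h : Tm M (fun v => eps (v 0)) := by unfold eps; exact dpa
  exact h.sub1 (f := eps) hs

theorem nt_succ_U (n : ℕ) : (⋃₀ (nt.{u} (n + 1)) : ZFSet.{u}) = nt n := by
  ext x
  rw [ZFSet.mem_sUnion]
  constructor
  · rintro ⟨y, hy, hx⟩
    obtain ⟨m, hm, rfl⟩ := mem_nt.1 hy
    obtain ⟨k, hk, rfl⟩ := mem_nt.1 hx
    exact nt_lt (by omega)
  · exact fun h => ⟨nt n, nt_lt (by omega), h⟩

theorem nt_succ_ne (n : ℕ) : nt.{u} (n + 1) ≠ ∅ := fun h => by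
  have := nt_lt.{u} (Nat.succ_pos n)
  rw [h] at this
  exact ZFSet.notMem_empty _ this

def orec (b : ZFSet.{u} → ZFSet.{u}) (st : ZFSet.{u} → ZFSet.{u} → ZFSet.{u}) (p n : ZFSet.{u}) : ZFSet.{u} :=
  wfr (fun n g => if n = ∅ then b p else st p (fapp g (⋃₀ n))) (eps ZFSet.omega) n

section
variable {b : ZFSet.{u} → ZFSet.{u}} {st : ZFSet.{u} → ZFSet.{u} → ZFSet.{u}}

theorem orec_zero (p : ZFSet.{u}) : orec b st p (nt 0) = b p := by
  rw [orec, wfr_eq (acc_eps _ _), if_pos (show nt 0 = ∅ from rfl)]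

theorem orec_succ (p : ZFSet.{u}) (n : ℕ) : orec b st p (nt (n + 1)) = st p (orec b st p (nt n)) := by
  rw [orec, wfr_eq (acc_eps _ _), if_neg (nt_succ_ne n), nt_succ_U,
    preds_eps isOrdinal_omega.isTransitive (nt_mem_omega _), fapp_grf (nt_lt (by omega))]
  rfl

theorem tm_orec (hM : TM0 M) (hb : Tm M (fun v => b (v 0))) (hs : Tm M (fun v => st (v 0) (v 1)))
    {s t : (ℕ → ZFSet.{u}) → ZFSet.{u}} (h1 : Tm M s) (h2 : Tm M t) :
    Tm M (fun v => orec b st (s v) (t v)) := by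
  have hG : Tm M (fun v => (fun p n g => if n = ∅ then b p else st p (fapp g (⋃₀ n))) (v 0) (v 1) (v 2)) := by
    refine Tm.ite hM dpa hb (hs.sub2 (f := st) dpa dpa)
  have h := tm_wfr (G := fun p n g => if n = ∅ then b p else st p (fapp g (⋃₀ n))) hM hG
  exact (h.sub3 (f := fun p e x => wfr ((fun p n g => if n = ∅ then b p else st p (fapp g (⋃₀ n))) p) e x)
    h1 (tm_eps hM (Tm.const hM.omega)) h2)
end

def upd (s n x : ZFSet.{u}) : ZFSet.{u} :=
  ZFSet.sep (fun p => pfst p ≠ n) s ∪ {ZFSet.pair n x}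

theorem tm_upd (hM : TM0 M) {r s t : (ℕ → ZFSet.{u}) → ZFSet.{u}} (hr : Tm M r) (hs : Tm M s) (ht : Tm M t) :
    Tm M (fun v => upd (r v) (s v) (t v)) := by
  have h : Tm M (fun v => upd (v 0) (v 1) (v 2)) := by unfold upd; exact dpa
  exact h.sub3 (f := upd) hr hs ht

theorem fapp_upd_eq (s n x : ZFSet.{u}) : fapp (upd s n x) n = x := by
  apply fapp_eq
  · simp [upd]
  · intro c hc
    rw [upd, ZFSet.mem_union, ZFSet.mem_sep, ZFSet.mem_singleton, pfst_pair] at hc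
    rcases hc with hc | hc
    · exact absurd rfl hc.2
    · exact (ZFSet.pair_inj.1 hc).2

theorem fapp_upd_ne {s n x m : ZFSet.{u}} (h : m ≠ n) : fapp (upd s n x) m = fapp s m := by
  ext y
  rw [mem_fapp, mem_fapp]
  refine exists_congr fun b => and_congr_left fun _ => ?_
  rw [upd, ZFSet.mem_union, ZFSet.mem_sep, ZFSet.mem_singleton, pfst_pair]
  constructor
  · rintro (hc | hc)
    · exact hc.1
    · exact absurd (ZFSet.pair_inj.1 hc).1 h
  · exact fun hc => Or.inl ⟨hc, h⟩

/-- the valuation coded by a set -/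
def vl (s : ZFSet.{u}) (i : ℕ) : ZFSet.{u} := fapp s (nt i)

theorem vl_upd (s x : ZFSet.{u}) (n : ℕ) : vl (upd s (nt n) x) = Function.update (vl s) n x := by
  funext i
  by_cases h : i = n
  · subst h; rw [Function.update_self]; exact fapp_upd_eq _ _ _
  · rw [Function.update_of_ne h]; exact fapp_upd_ne fun e => h (nt_inj e)

def Xf (K : ZFSet.{u}) (φ : Fml) : ZFSet.{u} := ZFSet.sep (fun s => Sat K.toSet φ (vl s)) K

def dZ (K : ZFSet.{u}) : ZFSet.{u} :=
  img (fun q => ZFSet.sep (fun s => fapp s (pfst q) ∈ fapp s (psnd q)) K) (ZFSet.prod ZFSet.omega ZFSet.omega) ∪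
  img (fun q => ZFSet.sep (fun s => fapp s (pfst q) = fapp s (psnd q)) K) (ZFSet.prod ZFSet.omega ZFSet.omega)

def dS (K D : ZFSet.{u}) : ZFSet.{u} :=
  D ∪ (img (fun X => ZFSet.sep (fun s => s ∉ X) K) D ∪
  (img (fun q => ZFSet.sep (fun s => s ∈ pfst q → s ∈ psnd q) K) (ZFSet.prod D D) ∪
   img (fun q => ZFSet.sep (fun s => ∀ x ∈ K, upd s (pfst q) x ∈ psnd q) K) (ZFSet.prod ZFSet.omega D)))

def dAll (K : ZFSet.{u}) : ZFSet.{u} := ⋃₀ (img (fun n => orec dZ dS K n) ZFSet.omega)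

theorem tm_dAll (hM : TM0 M) {s : (ℕ → ZFSet.{u}) → ZFSet.{u}} (hs : Tm M s) :
    Tm M (fun v => dAll (s v)) := by
  have h1 : Tm M (fun v => dZ (v 0)) := by unfold dZ; exact dpa
  have h2 : Tm M (fun v => dS (v 0) (v 1)) := by
    have h3 : Tm M (fun v => ZFSet.sep (fun s => ∀ x ∈ v 1, upd s (pfst (v 0)) x ∈ psnd (v 0)) (v 1)) := by
      unfold upd; exact dpa
    have h4 := Tm.img hM (f := fun q v => ZFSet.sep (fun s => ∀ x ∈ v 0, upd s (pfst q) x ∈ psnd q) (v 0))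
      (Tm.prod hM (Tm.const hM.omega) (hM.vr 1)) h3
    unfold dS
    exact Tm.union hM dpa (Tm.union hM dpa (Tm.union hM dpa h4))
  have h : Tm M (fun v => dAll (v 0)) := by
    unfold dAll
    exact Tm.sUnion hM (Tm.img hM (f := fun n v => orec dZ dS (v 0) n) (Tm.const hM.omega)
      (tm_orec hM h1 h2 (hM.vr 1) (hM.vr 0)))
  exact h.sub1 (f := dAll) hs

section
variable {K : ZFSet.{u}}

theorem mem_dAll_sub {X : ZFSet.{u}} : X ∈ dAll K ↔ ∃ n : ℕ, X ∈ orec dZ dS K (nt n) := by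
  rw [dAll, ZFSet.mem_sUnion]
  constructor
  · rintro ⟨z, hz, hX⟩
    obtain ⟨n, hn, rfl⟩ := mem_img.1 hz
    obtain ⟨n, rfl⟩ := mem_omega.1 hn
    exact ⟨n, hX⟩
  · rintro ⟨n, h⟩
    exact ⟨_, mem_img.2 ⟨nt n, nt_mem_omega n, rfl⟩, h⟩

theorem orec_mono {m n : ℕ} (h : m ≤ n) : orec dZ dS K (nt m) ⊆ orec dZ dS K (nt n) := by
  induction h with
  | refl => exact fun _ h => h
  | step _ ih =>
    intro x hx
    rw [orec_succ, dS, ZFSet.mem_union]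
    exact Or.inl (ih hx)

theorem mem_dAll (hu : ∀ s ∈ K, ∀ n ∈ ZFSet.omega, ∀ x ∈ K, upd s n x ∈ K) {X : ZFSet.{u}} :
    X ∈ dAll K ↔ ∃ φ, X = Xf K φ := by
  have eneg : ∀ φ, ZFSet.sep (fun s => s ∉ Xf K φ) K = Xf K (.neg φ) := by
    intro φ; ext s
    simp only [Xf, ZFSet.mem_sep, Sat]
    tauto
  have eimp : ∀ φ ψ, ZFSet.sep (fun s => s ∈ Xf K φ → s ∈ Xf K ψ) K = Xf K (.impl φ ψ) := by
    intro φ ψ; ext s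
    simp only [Xf, ZFSet.mem_sep, Sat]
    tauto
  have eall : ∀ n φ, ZFSet.sep (fun s => ∀ x ∈ K, upd s (nt n) x ∈ Xf K φ) K = Xf K (.all n φ) := by
    intro n φ; ext s
    simp only [Xf, ZFSet.mem_sep, Sat, vl_upd]
    refine and_congr_right fun hs => forall₂_congr fun x hx => ?_
    exact ⟨fun h => h.2, fun h => ⟨hu s hs _ (nt_mem_omega n) x hx, h⟩⟩
  rw [mem_dAll_sub]
  constructor
  · rintro ⟨n, hn⟩
    induction n generalizing X with
    | zero =>
      rw [orec_zero, dZ, ZFSet.mem_union, mem_img, mem_img] at hn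
      rcases hn with ⟨q, hq, rfl⟩ | ⟨q, hq, rfl⟩ <;>
      · obtain ⟨a, ha, b, hb, rfl⟩ := ZFSet.mem_prod.1 hq
        obtain ⟨i, rfl⟩ := mem_omega.1 ha
        obtain ⟨j, rfl⟩ := mem_omega.1 hb
        simp only [pfst_pair, psnd_pair]
        first | exact ⟨.mem i j, rfl⟩ | exact ⟨.eq i j, rfl⟩
    | succ n ih =>
      rw [orec_succ, dS, ZFSet.mem_union, ZFSet.mem_union, ZFSet.mem_union, mem_img, mem_img, mem_img] at hn
      rcases hn with h | ⟨Y, hY, rfl⟩ | ⟨q, hq, rfl⟩ | ⟨q, hq, rfl⟩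
      · exact ih h
      · obtain ⟨φ, rfl⟩ := ih hY
        exact ⟨_, eneg φ⟩
      · obtain ⟨a, ha, b, hb, rfl⟩ := ZFSet.mem_prod.1 hq
        obtain ⟨φ, rfl⟩ := ih ha
        obtain ⟨ψ, rfl⟩ := ih hb
        simp only [pfst_pair, psnd_pair]
        exact ⟨_, eimp φ ψ⟩
      · obtain ⟨a, ha, b, hb, rfl⟩ := ZFSet.mem_prod.1 hq
        obtain ⟨i, rfl⟩ := mem_omega.1 ha
        obtain ⟨ψ, rfl⟩ := ih hb
        simp only [pfst_pair, psnd_pair]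
        exact ⟨_, eall i ψ⟩
  · rintro ⟨φ, rfl⟩
    induction φ with
    | mem i j =>
      refine ⟨0, ?_⟩
      rw [orec_zero, dZ, ZFSet.mem_union, mem_img, mem_img]
      refine Or.inl ⟨ZFSet.pair (nt i) (nt j), ZFSet.pair_mem_prod.2 ⟨nt_mem_omega _, nt_mem_omega _⟩, ?_⟩
      simp only [pfst_pair, psnd_pair]; rfl
    | eq i j =>
      refine ⟨0, ?_⟩
      rw [orec_zero, dZ, ZFSet.mem_union, mem_img, mem_img]
      refine Or.inr ⟨ZFSet.pair (nt i) (nt j), ZFSet.pair_mem_prod.2 ⟨nt_mem_omega _, nt_mem_omega _⟩, ?_⟩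
      simp only [pfst_pair, psnd_pair]; rfl
    | neg φ ih =>
      obtain ⟨n, hn⟩ := ih
      refine ⟨n + 1, ?_⟩
      rw [orec_succ, dS, ZFSet.mem_union, ZFSet.mem_union, ZFSet.mem_union, mem_img, mem_img, mem_img]
      exact Or.inr (Or.inl ⟨_, hn, (eneg φ).symm⟩)
    | impl φ ψ ih1 ih2 =>
      obtain ⟨n, hn⟩ := ih1
      obtain ⟨m, hm⟩ := ih2
      refine ⟨max n m + 1, ?_⟩
      rw [orec_succ, dS, ZFSet.mem_union, ZFSet.mem_union, ZFSet.mem_union, mem_img, mem_img, mem_img]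
      refine Or.inr (Or.inr (Or.inl ⟨ZFSet.pair (Xf K φ) (Xf K ψ), ZFSet.pair_mem_prod.2
        ⟨orec_mono (le_max_left n m) hn, orec_mono (le_max_right n m) hm⟩, ?_⟩))
      simp only [pfst_pair, psnd_pair]
      exact (eimp φ ψ).symm
    | all i φ ih =>
      obtain ⟨n, hn⟩ := ih
      refine ⟨n + 1, ?_⟩
      rw [orec_succ, dS, ZFSet.mem_union, ZFSet.mem_union, ZFSet.mem_union, mem_img, mem_img, mem_img]
      refine Or.inr (Or.inr (Or.inr ⟨ZFSet.pair (nt i) (Xf K φ), ZFSet.pair_mem_prod.2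
        ⟨nt_mem_omega _, hn⟩, ?_⟩))
      simp only [pfst_pair, psnd_pair]
      exact (eall i φ).symm

theorem vl_exists (hu : ∀ s ∈ K, ∀ n ∈ ZFSet.omega, ∀ x ∈ K, upd s n x ∈ K) (h0 : ∅ ∈ K)
    {v : ℕ → ZFSet.{u}} (hv : ∀ n, v n ∈ K) (N : ℕ) : ∃ s ∈ K, ∀ i < N, vl s i = v i := by
  induction N with
  | zero => exact ⟨∅, h0, fun i hi => absurd hi (Nat.not_lt_zero _)⟩
  | succ N ih =>
    obtain ⟨s, hs, hs'⟩ := ih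
    refine ⟨upd s (nt N) (v N), hu s hs _ (nt_mem_omega N) _ (hv N), fun i hi => ?_⟩
    rw [vl_upd]
    by_cases h : i = N
    · subst h; rw [Function.update_self]
    · rw [Function.update_of_ne h]; exact hs' i (by omega)

/-- first-order internal reformulation of `IsTransModel` -/
def TMi (K : ZFSet.{u}) : Prop :=
  K.IsTransitive ∧ ZFSet.omega ∈ K ∧ (∀ x ∈ K, ∀ y ∈ K, ({x, y} : ZFSet) ∈ K) ∧
  (∀ x ∈ K, (⋃₀ x : ZFSet) ∈ K) ∧
  (∀ s ∈ K, ∀ n ∈ ZFSet.omega, fapp s n ∈ K) ∧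
  (∀ s ∈ K, ∀ n ∈ ZFSet.omega, ∀ x ∈ K, upd s n x ∈ K) ∧
  (∀ X ∈ dAll K, ∀ s ∈ K, ∀ a ∈ K, ZFSet.sep (fun x => upd s ∅ x ∈ X) a ∈ K) ∧
  (∀ X ∈ dAll K, ∀ s ∈ K, ∀ a ∈ K,
    (∀ x ∈ a, ∃ y ∈ K, upd (upd s ∅ x) {∅} y ∈ X) → ∃ b ∈ K, ∀ x ∈ a, ∃ y ∈ b, upd (upd s ∅ x) {∅} y ∈ X) ∧
  (∀ x ∈ K, ∃ r ∈ K, IsWellOrderOn x r)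

theorem nt_one : nt.{u} 1 = {∅} := by
  ext x; rw [mem_nt, ZFSet.mem_singleton]
  constructor
  · rintro ⟨m, hm, rfl⟩
    obtain rfl : m = 0 := by omega
    rfl
  · rintro rfl; exact ⟨0, by omega, rfl⟩

theorem tmi_iff : TMi K ↔ IsTransModel K := by
  have key : (∀ s ∈ K, ∀ n ∈ ZFSet.omega, ∀ x ∈ K, upd s n x ∈ K) → ∀ {φ s x}, s ∈ K → x ∈ K →
      (upd s ∅ x ∈ Xf K φ ↔ Sat K.toSet φ (Function.update (vl s) 0 x)) := by
    intro hu φ s x hs hx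
    rw [show (∅ : ZFSet.{u}) = nt 0 from rfl, Xf, ZFSet.mem_sep, vl_upd]
    exact ⟨fun h => h.2, fun h => ⟨hu s hs _ (nt_mem_omega 0) x hx, h⟩⟩
  have key2 : (∀ s ∈ K, ∀ n ∈ ZFSet.omega, ∀ x ∈ K, upd s n x ∈ K) → ∀ {φ s x y}, s ∈ K → x ∈ K → y ∈ K →
      (upd (upd s ∅ x) {∅} y ∈ Xf K φ ↔ Sat K.toSet φ (Function.update (Function.update (vl s) 0 x) 1 y)) := by
    intro hu φ s x y hs hx hy
    rw [← nt_one, show (∅ : ZFSet.{u}) = nt 0 from rfl, Xf, ZFSet.mem_sep, vl_upd, vl_upd]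
    exact ⟨fun h => h.2, fun h => ⟨hu _ (hu s hs _ (nt_mem_omega 0) x hx) _ (nt_mem_omega 1) y hy, h⟩⟩
  constructor
  · rintro ⟨ht, ho, hp, hU, hf, hu, hs, hc, hw⟩
    have h0 : ∅ ∈ K := ht _ ho ZFSet.omega_zero
    refine ⟨ht, ho, hp, hU, fun φ v hv a ha => ?_, fun φ v hv a ha hex => ?_, hw⟩
    · obtain ⟨N, hN⟩ := Fml.bound.{u} φ
      obtain ⟨s, hsK, hsv⟩ := vl_exists hu h0 hv N
      refine ⟨_, hs _ ((mem_dAll hu).2 ⟨φ, rfl⟩) s hsK a ha, fun x => ?_⟩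
      rw [ZFSet.mem_sep]
      refine and_congr_right fun hx => ?_
      rw [key hu hsK (ht _ ha hx)]
      apply hN
      intro i hi
      by_cases h : i = 0
      · subst h; simp
      · rw [Function.update_of_ne h, Function.update_of_ne h, hsv i hi]
    · obtain ⟨N, hN⟩ := Fml.bound.{u} φ
      obtain ⟨s, hsK, hsv⟩ := vl_exists hu h0 hv N
      have e : ∀ x y, Sat K.toSet φ (Function.update (Function.update (vl s) 0 x) 1 y) ↔
          Sat K.toSet φ (Function.update (Function.update v 0 x) 1 y) := by
        intro x y
        apply hN
        intro i hi
        by_cases h : i = 1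
        · subst h; simp
        · rw [Function.update_of_ne h, Function.update_of_ne h]
          by_cases h : i = 0
          · subst h; simp
          · rw [Function.update_of_ne h, Function.update_of_ne h, hsv i hi]
      obtain ⟨b, hb, hb'⟩ := hc _ ((mem_dAll hu).2 ⟨φ, rfl⟩) s hsK a ha (fun x hx => by
        obtain ⟨y, hy, h⟩ := hex x hx
        exact ⟨y, hy, (key2 hu hsK (ht _ ha hx) hy).2 ((e x y).2 h)⟩)
      refine ⟨b, hb, fun x hx => ?_⟩
      obtain ⟨y, hy, h⟩ := hb' x hx
      exact ⟨y, hy, (e x y).1 ((key2 hu hsK (ht _ ha hx) (ht _ hb hy)).1 h)⟩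
  · intro h
    have h0 := h.tm0
    have hu : ∀ s ∈ K, ∀ n ∈ ZFSet.omega, ∀ x ∈ K, upd s n x ∈ K := fun s hs n hn x hx =>
      h0.cl (tm_upd h0 (Tm.const hs) (Tm.const (h0.trans _ h0.omega hn)) (Tm.const hx))
    have hf : ∀ s ∈ K, ∀ n ∈ ZFSet.omega, fapp s n ∈ K := fun s hs n hn =>
      h0.fapp_mem hs (h0.trans _ h0.omega hn)
    refine ⟨h0.trans, h0.omega, h0.upair, h0.union, hf, hu, ?_, ?_, h.wo⟩
    · intro X hX s hs a ha
      obtain ⟨φ, rfl⟩ := (mem_dAll hu).1 hX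
      obtain ⟨b, hb, hb'⟩ := h0.sep' φ (vl s) (fun i => hf s hs _ (nt_mem_omega i)) a ha
      convert hb using 1
      ext x
      rw [hb', ZFSet.mem_sep]
      exact and_congr_right fun hx => key hu hs (h0.trans _ ha hx)
    · intro X hX s hs a ha hex
      obtain ⟨φ, rfl⟩ := (mem_dAll hu).1 hX
      obtain ⟨b, hb, hb'⟩ := h0.coll' φ (vl s) (fun i => hf s hs _ (nt_mem_omega i)) a ha (fun x hx => by
        obtain ⟨y, hy, h⟩ := hex x hx
        exact ⟨y, hy, (key2 hu hs (h0.trans _ ha hx) hy).1 h⟩)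
      refine ⟨b, hb, fun x hx => ?_⟩
      obtain ⟨y, hy, h⟩ := hb' x hx
      exact ⟨y, hy, (key2 hu hs (h0.trans _ ha hx) (h0.trans _ hb hy)).2 h⟩
end

theorem dp_tm (hM : TM0 M) {s : (ℕ → ZFSet.{u}) → ZFSet.{u}} (hs : Tm M s) :
    Dp M (fun v => IsTransModel (s v)) := by
  refine Dp.sub1 (P := IsTransModel) ?_ hs
  refine Dp.congr (P := fun v => TMi (v 0)) ?_ fun v hv => tmi_iff
  have hd0 : Tm M (fun v => dAll (v 0)) := tm_dAll hM (hM.vr 0)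
  have c6 : Dp M (fun v => ∀ s ∈ v 0, ∀ n ∈ ZFSet.omega, ∀ x ∈ v 0, upd s n x ∈ v 0) := by
    unfold upd; exact dpa
  have c7 : Dp M (fun v => ∀ X ∈ dAll (v 0), ∀ s ∈ v 0, ∀ a ∈ v 0, ZFSet.sep (fun x => upd s ∅ x ∈ X) a ∈ v 0) := by
    refine Dp.ball hM (P := fun X v => ∀ s ∈ v 0, ∀ a ∈ v 0, ZFSet.sep (fun x => upd s ∅ x ∈ X) a ∈ v 0) hd0 ?_
    unfold upd; exact dpa
  have c8 : Dp M (fun v => ∀ X ∈ dAll (v 0), ∀ s ∈ v 0, ∀ a ∈ v 0, (∀ x ∈ a, ∃ y ∈ v 0, upd (upd s ∅ x) {∅} y ∈ X) →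
      ∃ b ∈ v 0, ∀ x ∈ a, ∃ y ∈ b, upd (upd s ∅ x) {∅} y ∈ X) := by
    refine Dp.ball hM (P := fun X v => ∀ s ∈ v 0, ∀ a ∈ v 0, (∀ x ∈ a, ∃ y ∈ v 0, upd (upd s ∅ x) {∅} y ∈ X) →
      ∃ b ∈ v 0, ∀ x ∈ a, ∃ y ∈ b, upd (upd s ∅ x) {∅} y ∈ X) hd0 ?_
    unfold upd; exact dpa
  have c1 : Dp M (fun v => (v 0).IsTransitive) := dpa2
  have c9 : Dp M (fun v => ∀ x ∈ v 0, ∃ r ∈ v 0, IsWellOrderOn x r) := dpa2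
  unfold TMi
  exact c1.and (Dp.and dpa (Dp.and dpa (Dp.and dpa (Dp.and dpa (c6.and (c7.and (c8.and c9)))))))

/-! ### Goedel pairing on an infinite cardinal -/

def glt (p q : ZFSet.{u}) : Prop :=
  (pfst p ∪ psnd p) ∈ (pfst q ∪ psnd q) ∨
    ((pfst p ∪ psnd p) = (pfst q ∪ psnd q) ∧ (pfst p ∈ pfst q ∨ (pfst p = pfst q ∧ psnd p ∈ psnd q)))

def gor (κ : ZFSet.{u}) : ZFSet.{u} :=
  ZFSet.sep (fun z => glt (pfst z) (psnd z)) (ZFSet.prod (ZFSet.prod κ κ) (ZFSet.prod κ κ))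

def gp (κ ξ η : ZFSet.{u}) : ZFSet.{u} := coll (gor κ) (ZFSet.pair ξ η)

theorem tm_gor (hM : TM0 M) {r : (ℕ → ZFSet.{u}) → ZFSet.{u}} (hr : Tm M r) :
    Tm M (fun v => gor (r v)) := by
  have h : Tm M (fun v => gor (v 0)) := by unfold gor glt; exact dpa
  exact h.sub1 (f := gor) hr

theorem tm_gp (hM : TM0 M) {r s t : (ℕ → ZFSet.{u}) → ZFSet.{u}} (hr : Tm M r) (hs : Tm M s) (ht : Tm M t) :
    Tm M (fun v => gp (r v) (s v) (t v)) := tm_coll hM (tm_gor hM hr) (Tm.pair hM hs ht)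

section
variable {κ : ZFSet.{u}}

theorem pair_mem_gor {p q : ZFSet.{u}} :
    ZFSet.pair p q ∈ gor κ ↔ p ∈ ZFSet.prod κ κ ∧ q ∈ ZFSet.prod κ κ ∧ glt p q := by
  rw [gor, ZFSet.mem_sep, ZFSet.pair_mem_prod, pfst_pair, psnd_pair, and_assoc]

theorem acc_gor (q : ZFSet.{u}) : Acc (erel (gor κ)) q := by
  have wf : WellFounded (Prod.Lex (α := Ordinal.{u}) (β := Ordinal.{u} × Ordinal.{u}) (· < ·) (Prod.Lex (· < ·) (· < ·))) :=
    WellFounded.prod_lex wellFounded_lt (WellFounded.prod_lex wellFounded_lt wellFounded_lt)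
  have := (InvImage.wf (fun q : ZFSet.{u} => (ZFSet.rank (pfst q ∪ psnd q), ZFSet.rank (pfst q), ZFSet.rank (psnd q))) wf).apply q
  refine Subrelation.accessible (fun {a b} h => ?_) this
  rcases (pair_mem_gor.1 h).2.2 with h | ⟨e, h⟩
  · exact Prod.Lex.left _ _ (ZFSet.rank_lt_of_mem h)
  · show Prod.Lex _ _ _ _
    dsimp only
    rw [e]
    refine Prod.Lex.right _ ?_
    rcases h with h | ⟨e, h⟩
    · exact Prod.Lex.left _ _ (ZFSet.rank_lt_of_mem h)
    · rw [e]
      exact Prod.Lex.right _ (ZFSet.rank_lt_of_mem h)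

theorem union_mem_ord (hκ : κ.IsOrdinal) {a b : ZFSet.{u}} (ha : a ∈ κ) (hb : b ∈ κ) : a ∪ b ∈ κ := by
  have : a ∪ b = a ∨ a ∪ b = b := by
    rcases (hκ.mem ha).mem_or_subset (hκ.mem hb) with h | h
    · right
      ext x; rw [ZFSet.mem_union]
      exact ⟨fun h' => h'.elim (fun h'' => (hκ.mem hb).mem_trans h'' h) id, Or.inr⟩
    · left
      ext x; rw [ZFSet.mem_union]
      exact ⟨fun h' => h'.elim id (fun h'' => h h''), Or.inl⟩
  rcases this with h | h <;> rw [h] <;> assumption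

theorem glt_total (hκ : κ.IsOrdinal) {p q : ZFSet.{u}} (hp : p ∈ ZFSet.prod κ κ) (hq : q ∈ ZFSet.prod κ κ) :
    p = q ∨ glt p q ∨ glt q p := by
  obtain ⟨a, ha, b, hb, rfl⟩ := ZFSet.mem_prod.1 hp
  obtain ⟨c, hc, d, hd, rfl⟩ := ZFSet.mem_prod.1 hq
  simp only [glt, pfst_pair, psnd_pair, ZFSet.pair_inj]
  have h1 := (hκ.mem (union_mem_ord hκ ha hb)).mem_trichotomous (hκ.mem (union_mem_ord hκ hc hd))
  have h2 := (hκ.mem ha).mem_trichotomous (hκ.mem hc)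
  have h3 := (hκ.mem hb).mem_trichotomous (hκ.mem hd)
  rcases h1 with h1 | h1 | h1
  · tauto
  · rcases h2 with h2 | h2 | h2
    · tauto
    · rcases h3 with h3 | h3 | h3
      · tauto
      · tauto
      · exact Or.inr (Or.inr (Or.inr ⟨h1.symm, Or.inr ⟨h2.symm, h3⟩⟩))
    · exact Or.inr (Or.inr (Or.inr ⟨h1.symm, Or.inl h2⟩))
  · tauto

theorem glt_trans (hκ : κ.IsOrdinal) {p q r : ZFSet.{u}} (hr : r ∈ ZFSet.prod κ κ)
    (h1 : glt p q) (h2 : glt q r) : glt p r := by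
  obtain ⟨c, hc, d, hd, rfl⟩ := ZFSet.mem_prod.1 hr
  simp only [glt, pfst_pair, psnd_pair] at *
  have t1 : ∀ {x y}, x ∈ y → y ∈ c ∪ d → x ∈ c ∪ d := fun h h' => (hκ.mem (union_mem_ord hκ hc hd)).mem_trans h h'
  have t2 : ∀ {x y}, x ∈ y → y ∈ c → x ∈ c := fun h h' => (hκ.mem hc).mem_trans h h'
  have t3 : ∀ {x y}, x ∈ y → y ∈ d → x ∈ d := fun h h' => (hκ.mem hd).mem_trans h h'
  rcases h2 with h2 | ⟨e2, h2⟩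
  · rcases h1 with h1 | ⟨e1, h1⟩
    · exact Or.inl (t1 h1 h2)
    · rw [e1]; exact Or.inl h2
  · rw [← e2]
    rcases h1 with h1 | ⟨e1, h1⟩
    · exact Or.inl h1
    · refine Or.inr ⟨e1, ?_⟩
      rcases h2 with h2 | ⟨e2, h2⟩
      · rcases h1 with h1 | ⟨e1, h1⟩
        · exact Or.inl (t2 h1 h2)
        · rw [e1]; exact Or.inl h2
      · rw [← e2]
        rcases h1 with h1 | ⟨e1, h1⟩
        · exact Or.inl h1
        · exact Or.inr ⟨e1, t3 h1 h2⟩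

theorem isOrdinal_cgor (hκ : κ.IsOrdinal) (q : ZFSet.{u}) : (coll (gor κ) q).IsOrdinal := by
  have tr : ∀ q, (coll (gor κ) q).IsTransitive := by
    intro q y hy z hz
    obtain ⟨p, hp, rfl⟩ := (mem_coll (acc_gor q)).1 hy
    obtain ⟨r, hr, rfl⟩ := (mem_coll (acc_gor p)).1 hz
    rw [pair_mem_gor] at hp hr
    exact coll_mem_coll (acc_gor q) (pair_mem_gor.2 ⟨hr.1, hp.2.1, glt_trans hκ hp.2.1 hr.2.2 hp.2.2⟩)
  rw [ZFSet.isOrdinal_iff_forall_mem_isTransitive]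
  refine ⟨tr q, fun y hy => ?_⟩
  obtain ⟨p, hp, rfl⟩ := (mem_coll (acc_gor q)).1 hy
  exact tr p

theorem gp_inj (hκ : κ.IsOrdinal) {a b c d : ZFSet.{u}} (ha : a ∈ κ) (hb : b ∈ κ) (hc : c ∈ κ) (hd : d ∈ κ)
    (h : gp κ a b = gp κ c d) : a = c ∧ b = d := by
  rw [← ZFSet.pair_inj]
  have hp := ZFSet.pair_mem_prod.2 ⟨ha, hb⟩
  have hq := ZFSet.pair_mem_prod.2 ⟨hc, hd⟩
  rcases glt_total hκ hp hq with e | e | e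
  · exact e
  · have := coll_mem_coll (acc_gor _) (pair_mem_gor.2 ⟨hp, hq, e⟩)
    rw [← gp, ← gp, h] at this
    exact absurd this (ZFSet.mem_irrefl _)
  · have := coll_mem_coll (acc_gor _) (pair_mem_gor.2 ⟨hq, hp, e⟩)
    rw [← gp, ← gp, h] at this
    exact absurd this (ZFSet.mem_irrefl _)

theorem zcard_le_of_surj {x y : ZFSet.{u}} (f : ZFSet.{u} → ZFSet.{u}) (h : ∀ b ∈ y, ∃ a ∈ x, f a = b) :
    zcard y ≤ zcard x := by
  choose! g hg hg' using h
  refine Cardinal.mk_le_of_injective (f := fun b : y.toSet => (⟨g b.1, hg b.1 b.2⟩ : x.toSet)) ?_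
  intro b c hbc
  have : g b.1 = g c.1 := congrArg Subtype.val hbc
  apply Subtype.ext
  rw [← hg' b.1 b.2, ← hg' c.1 c.2, this]

theorem zcard_le_of_inj {x y : ZFSet.{u}} (f : ZFSet.{u} → ZFSet.{u}) (h : ∀ a ∈ x, f a ∈ y)
    (hi : ∀ a ∈ x, ∀ b ∈ x, f a = f b → a = b) : zcard x ≤ zcard y := by
  refine Cardinal.mk_le_of_injective (f := fun b : x.toSet => (⟨f b.1, h b.1 b.2⟩ : y.toSet)) ?_
  intro b c hbc
  exact Subtype.ext (hi _ b.2 _ c.2 (congrArg Subtype.val hbc))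

theorem zcard_mono {x y : ZFSet.{u}} (h : x ⊆ y) : zcard x ≤ zcard y :=
  zcard_le_of_inj id (fun a ha => h ha) (fun a _ b _ e => e)

theorem zcard_prod (x y : ZFSet.{u}) : zcard (ZFSet.prod x y) ≤ zcard x * zcard y := by
  rw [zcard, zcard, zcard, Cardinal.mul_def]
  refine Cardinal.mk_le_of_injective (f := fun p : (ZFSet.prod x y).toSet =>
    ((⟨pfst p.1, ?_⟩ : x.toSet), (⟨psnd p.1, ?_⟩ : y.toSet))) ?_
  · obtain ⟨a, ha, b, hb, e⟩ := ZFSet.mem_prod.1 p.2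
    rw [e, pfst_pair]; exact ha
  · obtain ⟨a, ha, b, hb, e⟩ := ZFSet.mem_prod.1 p.2
    rw [e, psnd_pair]; exact hb
  · rintro ⟨p, hp⟩ ⟨q, hq⟩ h
    obtain ⟨a, ha, b, hb, rfl⟩ := ZFSet.mem_prod.1 hp
    obtain ⟨c, hc, d, hd, rfl⟩ := ZFSet.mem_prod.1 hq
    simp only [pfst_pair, psnd_pair, Prod.mk.injEq, Subtype.mk.injEq] at h
    exact Subtype.ext (ZFSet.pair_inj.2 h)

theorem zcard_insert (x y : ZFSet.{u}) : zcard (Insert.insert x y) ≤ zcard y + 1 := by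
  have : (Insert.insert x y : ZFSet.{u}).toSet = Insert.insert x y.toSet := by
    ext z; exact ZFSet.mem_insert_iff
  rw [zcard, this]
  exact Cardinal.mk_insert_le

/-- an infinite cardinal -/
structure ICard (κ : ZFSet.{u}) : Prop where
  card : IsCard κ
  inf : Cardinal.aleph0 ≤ zcard κ

theorem ICard.ord (h : ICard κ) : κ.IsOrdinal := isOrd_iff.1 h.card.1

theorem ICard.gp_mem (h : ICard κ) {a b : ZFSet.{u}} (ha : a ∈ κ) (hb : b ∈ κ) : gp κ a b ∈ κ := by
  have hm := union_mem_ord h.ord ha hb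
  have hs : zcard (Insert.insert (a ∪ b) (a ∪ b)) < zcard κ :=
    (zcard_insert _ _).trans_lt (Cardinal.add_lt_of_lt h.inf (h.card.2 _ hm)
      (Cardinal.one_lt_aleph0.trans_le h.inf))
  have hlt : zcard (gp κ a b) < zcard κ := by
    refine lt_of_le_of_lt ?_ (Cardinal.mul_lt_of_lt h.inf hs hs)
    refine le_trans ?_ (zcard_prod _ _)
    refine zcard_le_of_surj (coll (gor κ)) fun y hy => ?_
    obtain ⟨p, hp, rfl⟩ := (mem_coll (acc_gor _)).1 hy
    refine ⟨p, ?_, rfl⟩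
    obtain ⟨hp1, -, hp2⟩ := pair_mem_gor.1 hp
    obtain ⟨c, hc, d, hd, rfl⟩ := ZFSet.mem_prod.1 hp1
    simp only [glt, pfst_pair, psnd_pair] at hp2
    have hcd : c ∪ d ∈ (Insert.insert (a ∪ b) (a ∪ b) : ZFSet.{u}) := by
      rw [ZFSet.mem_insert_iff]; tauto
    have hmo : (Insert.insert (a ∪ b) (a ∪ b) : ZFSet.{u}).IsOrdinal := ZFSet.isOrdinal_succ (h.ord.mem hm)
    have : ∀ x ∈ κ, x ⊆ c ∪ d → x ∈ (Insert.insert (a ∪ b) (a ∪ b) : ZFSet.{u}) := by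
      intro x hx hsub
      rcases ((h.ord.mem hx).subset_iff_eq_or_mem (hmo.mem hcd)).1 hsub with e | e
      · rw [e]; exact hcd
      · exact hmo.mem_trans e hcd
    rw [ZFSet.pair_mem_prod]
    exact ⟨this c hc fun x hx => ZFSet.mem_union.2 (Or.inl hx), this d hd fun x hx => ZFSet.mem_union.2 (Or.inr hx)⟩
  rcases (isOrdinal_cgor h.ord (ZFSet.pair a b)).mem_or_subset h.ord with e | e
  · exact e
  · exact absurd (zcard_mono e) (not_le.2 hlt)

theorem ICard.omega_sub (h : ICard κ) : ZFSet.omega ⊆ κ := by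
  rcases h.ord.mem_or_subset isOrdinal_omega with e | e
  · obtain ⟨n, rfl⟩ := mem_omega.1 e
    refine absurd h.inf (not_le.2 ?_)
    rw [zcard, Cardinal.lt_aleph0_iff_set_finite]
    have : (nt.{u} n).toSet ⊆ Set.image nt (Set.Iio n) := by
      intro x hx
      obtain ⟨m, hm, rfl⟩ := mem_nt.1 hx
      exact ⟨m, hm, rfl⟩
    exact ((Set.finite_Iio n).image _).subset this
  · exact e

theorem ICard.of_model (hκ : IsCard κ) (hM : TM0 M) (hc : zcard M = zcard κ) : ICard κ := by
  refine ⟨hκ, ?_⟩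
  rw [← hc]
  have h1 : zcard ZFSet.omega.{u} ≤ zcard M := zcard_mono fun x hx => hM.trans _ hM.omega hx
  refine le_trans ?_ h1
  rw [zcard, Cardinal.aleph0_le_mk_iff]
  exact Infinite.of_injective (fun n : ℕ => (⟨nt n, nt_mem_omega n⟩ : ZFSet.omega.{u}.toSet))
    fun m n h => nt_inj (congrArg Subtype.val h)
end

/-! ### Codes and the minimal model -/

/-- automation for definability goals -/
theorem dpa3 {P : Prop} (h : P := by
  with_reducible repeat' first
    | assumption | apply TM0.vr
    | (apply Tm.const; first | assumption | (apply TM0.omega; assumption) | (apply TM0.empty; assumption))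
    | apply dp_isZFunc | apply dp_trans | apply dp_wo | apply dp_acc | apply tm_lst | apply tm_coll | apply tm_preds
    | apply tm_gp | apply tm_eps
    | apply Dp.subset | apply Dp.not | apply Dp.ne | apply Dp.iff | apply Dp.and | apply Dp.or
    | apply Dp.allM | apply Dp.exM | apply Dp.ball | apply Dp.bex | apply Dp.mem | apply Dp.eq | apply Dp.imp
    | apply Tm.pair | apply Tm.singleton | apply Tm.upair | apply Tm.union | apply Tm.inter | apply Tm.diff | apply Tm.insert | apply Tm.sUnion
    | apply Tm.prod | apply Tm.fapp | apply Tm.pfst | apply Tm.psnd | apply Tm.ite | apply Tm.sep | apply Tm.img | apply Tm.grf | apply TM0.omega | apply TM0.empty | apply Dp.trivM) : P := h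

def ER (κ B : ZFSet.{u}) : ZFSet.{u} := ZFSet.sep (fun q => gp κ (pfst q) (psnd q) ∈ B) (ZFSet.prod κ κ)

theorem pair_mem_ER {κ B x y : ZFSet.{u}} : ZFSet.pair x y ∈ ER κ B ↔ x ∈ κ ∧ y ∈ κ ∧ gp κ x y ∈ B := by
  rw [ER, ZFSet.mem_sep, ZFSet.pair_mem_prod, pfst_pair, psnd_pair, and_assoc]

def codes (κ U : ZFSet.{u}) : ZFSet.{u} := U ∪ img (fun A => ZFSet.sep (fun ξ => ξ ∉ A) κ) U

def colSet (κ U : ZFSet.{u}) : ZFSet.{u} :=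
  img (fun q => coll (ER κ (pfst q)) (psnd q)) (ZFSet.prod (codes κ U) κ)

theorem mem_colSet {κ U x : ZFSet.{u}} : x ∈ colSet κ U ↔ ∃ B ∈ codes κ U, ∃ ξ ∈ κ, x = coll (ER κ B) ξ := by
  rw [colSet, mem_img]
  constructor
  · rintro ⟨q, hq, rfl⟩
    obtain ⟨B, hB, ξ, hξ, rfl⟩ := ZFSet.mem_prod.1 hq
    exact ⟨B, hB, ξ, hξ, by rw [pfst_pair, psnd_pair]⟩
  · rintro ⟨B, hB, ξ, hξ, rfl⟩
    exact ⟨ZFSet.pair B ξ, ZFSet.pair_mem_prod.2 ⟨hB, hξ⟩, by rw [pfst_pair, psnd_pair]⟩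

theorem tm_ER (hM : TM0 M) {s t : (ℕ → ZFSet.{u}) → ZFSet.{u}} (hs : Tm M s) (ht : Tm M t) :
    Tm M (fun v => ER (s v) (t v)) := by
  have h : Tm M (fun v => ER (v 0) (v 1)) := by unfold ER; exact dpa3
  exact h.sub2 (f := ER) hs ht

theorem tm_codes (hM : TM0 M) {s t : (ℕ → ZFSet.{u}) → ZFSet.{u}} (hs : Tm M s) (ht : Tm M t) :
    Tm M (fun v => codes (s v) (t v)) := by
  have h : Tm M (fun v => codes (v 0) (v 1)) := by unfold codes; exact dpa3
  exact h.sub2 (f := codes) hs ht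

theorem tm_colSet (hM : TM0 M) {s t : (ℕ → ZFSet.{u}) → ZFSet.{u}} (hs : Tm M s) (ht : Tm M t) :
    Tm M (fun v => colSet (s v) (t v)) := by
  have h : Tm M (fun v => colSet (v 0) (v 1)) := by
    unfold colSet
    refine Tm.img hM (f := fun q v => coll (ER (v 0) (pfst q)) (psnd q))
      (Tm.prod hM (tm_codes hM (hM.vr 0) (hM.vr 1)) (hM.vr 0)) ?_
    exact tm_coll hM (tm_ER hM (hM.vr 1) dpa) dpa
  exact h.sub2 (f := colSet) hs ht

section
variable {κ U : ZFSet.{u}}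

theorem mem_codes (hM : TM0 M) (hk : κ ∈ M) (hU : IsMUltrafilter κ M U) {B : ZFSet.{u}} :
    B ∈ codes κ U ↔ B ∈ M ∧ B ⊆ κ := by
  rw [codes, ZFSet.mem_union, mem_img]
  constructor
  · rintro (h | ⟨A, hA, rfl⟩)
    · exact hU.1 B h
    · have := (hU.1 A hA).1
      exact ⟨hM.cl dpa, fun x hx => (ZFSet.mem_sep.1 hx).1⟩
  · rintro ⟨h1, h2⟩
    rcases hU.2.2.2.2.2.1 B h1 h2 with h | h
    · exact Or.inl h
    · refine Or.inr ⟨_, h, ?_⟩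
      ext x
      rw [ZFSet.mem_sep, compl, ZFSet.mem_sep]
      constructor
      · exact fun hx => ⟨h2 hx, fun h => h.2 hx⟩
      · rintro ⟨a, b⟩
        by_contra hc
        exact b ⟨a, hc⟩

theorem colSet_sub (hM : TM0 M) (hk : κ ∈ M) (hU : IsMUltrafilter κ M U) : colSet κ U ⊆ M := by
  intro x hx
  obtain ⟨B, hB, ξ, hξ, rfl⟩ := mem_colSet.1 hx
  have hB' := ((mem_codes hM hk hU).1 hB).1
  have hξ' := hM.trans _ hk hξ
  exact hM.cl (tm_coll hM (tm_ER hM (Tm.const hk) (Tm.const hB')) (Tm.const hξ'))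

def Cov (κ M c : ZFSet.{u}) : Prop := ∃ h ∈ M, ∀ y ∈ c, ∃ ξ ∈ κ, fapp h ξ = y

theorem Cov.mono {c d : ZFSet.{u}} (h : Cov κ M d) (hs : c ⊆ d) : Cov κ M c := by
  obtain ⟨k, hk, hk'⟩ := h
  exact ⟨k, hk, fun y hy => hk' y (hs hy)⟩

theorem Cov.one (hM : TM0 M) (hk : κ ∈ M) {c : ZFSet.{u}} {F : ZFSet.{u} → ZFSet.{u}} (hF : Tm M (fun v => F (v 0)))
    (h : ∀ y ∈ c, ∃ α ∈ κ, y = F α) : Cov κ M c := by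
  refine ⟨grf F κ, hM.cl (Tm.grf hM (f := fun x _ => F x) (Tm.const hk) hF), fun y hy => ?_⟩
  obtain ⟨α, hα, rfl⟩ := h y hy
  exact ⟨α, hα, fapp_grf hα⟩

theorem Cov.two (hM : TM0 M) (hk : κ ∈ M) (hc : ICard κ) {c : ZFSet.{u}} {F : ZFSet.{u} → ZFSet.{u} → ZFSet.{u}}
    (hF : Tm M (fun v => F (v 0) (v 1)))
    (h : ∀ y ∈ c, ∃ α ∈ κ, ∃ β ∈ κ, y = F α β) : Cov κ M c := by
  have t1 : Tm M (fun v => ⋃₀ (ZFSet.sep (fun α => ∃ β ∈ κ, gp κ α β = v 0) κ)) := dpa3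
  have t2 : Tm M (fun v => ⋃₀ (ZFSet.sep (fun β => ∃ α ∈ κ, gp κ α β = v 0) κ)) := dpa3
  refine Cov.one hM hk (F := fun ξ => F (⋃₀ (ZFSet.sep (fun α => ∃ β ∈ κ, gp κ α β = ξ) κ))
    (⋃₀ (ZFSet.sep (fun β => ∃ α ∈ κ, gp κ α β = ξ) κ))) (hF.sub2 (f := F) t1 t2) fun y hy => ?_
  obtain ⟨α, hα, β, hβ, rfl⟩ := h y hy
  refine ⟨gp κ α β, hc.gp_mem hα hβ, ?_⟩
  have e1 : ZFSet.sep (fun a => ∃ b ∈ κ, gp κ a b = gp κ α β) κ = {α} := by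
    ext x
    rw [ZFSet.mem_sep, ZFSet.mem_singleton]
    constructor
    · rintro ⟨hx, b, hb, e⟩
      exact (gp_inj hc.ord hx hb hα hβ e).1
    · rintro rfl; exact ⟨hα, β, hβ, rfl⟩
  have e2 : ZFSet.sep (fun b => ∃ a ∈ κ, gp κ a b = gp κ α β) κ = {β} := by
    ext x
    rw [ZFSet.mem_sep, ZFSet.mem_singleton]
    constructor
    · rintro ⟨hx, b, hb, e⟩
      exact (gp_inj hc.ord hb hx hα hβ e).2
    · rintro rfl; exact ⟨hβ, α, hα, rfl⟩
  rw [e1, e2, ZFSet.sUnion_singleton, ZFSet.sUnion_singleton]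

theorem Cov.insert (hM : TM0 M) (hk : κ ∈ M) (hc : ICard κ) {c x : ZFSet.{u}} (hx : x ∈ M) (h : Cov κ M c) :
    Cov κ M (Insert.insert x c) := by
  obtain ⟨k, hkM, hk'⟩ := h
  refine Cov.one hM hk (F := fun ξ => if ξ = ∅ then x else if ξ ∈ ZFSet.omega then fapp k (⋃₀ ξ) else fapp k ξ)
    dpa fun y hy => ?_
  rcases ZFSet.mem_insert_iff.1 hy with rfl | hy
  · exact ⟨∅, hc.omega_sub ZFSet.omega_zero, by rw [if_pos rfl]⟩
  · obtain ⟨ξ, hξ, rfl⟩ := hk' y hy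
    by_cases ho : ξ ∈ ZFSet.omega
    · obtain ⟨n, rfl⟩ := mem_omega.1 ho
      refine ⟨nt (n + 1), hc.omega_sub (nt_mem_omega _), ?_⟩
      rw [if_neg (nt_succ_ne n), if_pos (nt_mem_omega _), nt_succ_U]
    · refine ⟨ξ, hξ, ?_⟩
      rw [if_neg (fun e => ho (by rw [e]; exact ZFSet.omega_zero)), if_neg ho]

theorem Cov.empty (hM : TM0 M) : Cov κ M ∅ := ⟨∅, hM.empty, fun y hy => absurd hy (ZFSet.notMem_empty _)⟩

def HC (κ M : ZFSet.{u}) : ZFSet.{u} :=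
  ZFSet.sep (fun x => ∃ t ∈ M, ∃ h ∈ M, t.IsTransitive ∧ x ∈ t ∧ ∀ y ∈ t, ∃ ξ ∈ κ, fapp h ξ = y) M

theorem mem_HC (hM : TM0 M) {x : ZFSet.{u}} : x ∈ HC κ M ↔ ∃ t ∈ M, t.IsTransitive ∧ x ∈ t ∧ Cov κ M t := by
  rw [HC, ZFSet.mem_sep]
  constructor
  · rintro ⟨-, t, ht, h, hh, a, b, c⟩
    exact ⟨t, ht, a, b, h, hh, c⟩
  · rintro ⟨t, ht, a, b, h, hh, c⟩
    exact ⟨hM.trans _ ht b, t, ht, h, hh, a, b, c⟩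

theorem HC_trans (hM : TM0 M) {x y : ZFSet.{u}} (hx : x ∈ HC κ M) (hy : y ∈ x) : y ∈ HC κ M := by
  obtain ⟨t, ht, a, b, c⟩ := (mem_HC hM).1 hx
  exact (mem_HC hM).2 ⟨t, ht, a, a _ b hy, c⟩

theorem HC_sub {x : ZFSet.{u}} (hx : x ∈ HC κ M) : x ∈ M := (ZFSet.mem_sep.1 hx).1

theorem HC_cov (hM : TM0 M) {x : ZFSet.{u}} (hx : x ∈ HC κ M) : Cov κ M x := by
  obtain ⟨t, ht, a, b, c⟩ := (mem_HC hM).1 hx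
  exact c.mono (a _ b)

theorem HC_intro (h : IsTransModel M) (hk : κ ∈ M) (hc : ICard κ) {c : ZFSet.{u}} (hcM : c ∈ M) (hcov : Cov κ M c)
    (hsub : ∀ x ∈ c, x ∈ HC κ M) : c ∈ HC κ M := by
  have hM := h.tm0
  obtain ⟨k, hkM, hk'⟩ := hcov
  obtain ⟨f, hf, hfz, hf'⟩ := choice_fn h (P := fun y p => (pfst p).IsTransitive ∧ y ∈ pfst p ∧
    ∀ z ∈ pfst p, ∃ ξ ∈ κ, fapp (psnd p) ξ = z) dpa2 hcM (fun x hx => by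
      obtain ⟨t, ht, a, b, h, hh, c⟩ := (mem_HC hM).1 (hsub x hx)
      refine ⟨ZFSet.pair t h, hM.pair ht hh, ?_⟩
      rw [pfst_pair, psnd_pair]
      exact ⟨a, b, c⟩)
  have hT : (⋃₀ (img (fun y => pfst (fapp f y)) c) : ZFSet.{u}) ∈ M := hM.cl dpa
  have mT : ∀ {z}, z ∈ (⋃₀ (img (fun y => pfst (fapp f y)) c) : ZFSet.{u}) ↔ ∃ y ∈ c, z ∈ pfst (fapp f y) := by
    intro z
    rw [ZFSet.mem_sUnion]
    constructor
    · rintro ⟨w, hw, hz⟩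
      obtain ⟨y, hy, rfl⟩ := mem_img.1 hw
      exact ⟨y, hy, hz⟩
    · rintro ⟨y, hy, hz⟩
      exact ⟨_, mem_img.2 ⟨y, hy, rfl⟩, hz⟩
  refine (mem_HC hM).2 ⟨Insert.insert c (⋃₀ (img (fun y => pfst (fapp f y)) c)), hM.mem_insert hcM hT, ?_,
    ZFSet.mem_insert_iff.2 (Or.inl rfl), Cov.insert hM hk hc hcM ?_⟩
  · intro y hy z hz
    refine ZFSet.mem_insert_iff.2 (Or.inr (mT.2 ?_))
    rcases ZFSet.mem_insert_iff.1 hy with rfl | hy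
    · exact ⟨z, hz, (hf' z hz).2.2.1⟩
    · obtain ⟨w, hw, hyw⟩ := mT.1 hy
      exact ⟨w, hw, (hf' w hw).2.1 _ hyw hz⟩
  · refine Cov.two hM hk hc (F := fun α β => fapp (psnd (fapp f (fapp k α))) β) dpa fun y hy => ?_
    obtain ⟨w, hw, hyw⟩ := mT.1 hy
    obtain ⟨α, hα, rfl⟩ := hk' w hw
    obtain ⟨β, hβ, rfl⟩ := (hf' _ hw).2.2.2 y hyw
    exact ⟨α, hα, β, hβ, rfl⟩

theorem HC_subset (h : IsTransModel M) (hk : κ ∈ M) (hc : ICard κ) {c x : ZFSet.{u}} (hcM : c ∈ M)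
    (hx : x ∈ HC κ M) (hs : c ⊆ x) : c ∈ HC κ M :=
  HC_intro h hk hc hcM ((HC_cov h.tm0 hx).mono hs) fun y hy => HC_trans h.tm0 hx (hs hy)

theorem HC_kappa (h : IsTransModel M) (hk : κ ∈ M) (hc : ICard κ) : κ ∈ HC κ M := by
  have hM := h.tm0
  refine (mem_HC hM).2 ⟨Insert.insert κ κ, hM.mem_insert hk hk, (ZFSet.isOrdinal_succ hc.ord).isTransitive,
    ZFSet.mem_insert_iff.2 (Or.inl rfl), Cov.insert hM hk hc hk ?_⟩
  exact Cov.one hM hk (F := fun ξ => ξ) dpa fun y hy => ⟨y, hy, rfl⟩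

theorem HC_upair (h : IsTransModel M) (hk : κ ∈ M) (hc : ICard κ) {x y : ZFSet.{u}} (hx : x ∈ HC κ M)
    (hy : y ∈ HC κ M) : ({x, y} : ZFSet.{u}) ∈ HC κ M := by
  have hM := h.tm0
  refine HC_intro h hk hc (hM.upair _ (HC_sub hx) _ (HC_sub hy)) ?_ ?_
  · refine (Cov.insert hM hk hc (HC_sub hx) (Cov.insert hM hk hc (HC_sub hy) (Cov.empty hM))).mono ?_
    intro z hz
    simpa using hz
  · intro z hz
    rcases ZFSet.mem_pair.1 hz with rfl | rfl <;> assumption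

theorem HC_pair (h : IsTransModel M) (hk : κ ∈ M) (hc : ICard κ) {x y : ZFSet.{u}} (hx : x ∈ HC κ M)
    (hy : y ∈ HC κ M) : ZFSet.pair x y ∈ HC κ M := by
  have h1 := HC_upair h hk hc hx hx
  have h2 := HC_upair h hk hc h1 (HC_upair h hk hc hx hy)
  have : ({x, x} : ZFSet.{u}) = {x} := by ext; simp
  rw [this] at h2
  exact h2

theorem HC_model (h : IsTransModel M) (hk : κ ∈ M) (hc : ICard κ) : IsTransModel (HC κ M) := by
  have hM := h.tm0
  have hK : Dp M (fun v => v 0 ∈ (HC κ M).toSet) := by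
    have : Dp M (fun v => v 0 ∈ M ∧ ∃ t ∈ M, ∃ h ∈ M, t.IsTransitive ∧ v 0 ∈ t ∧ ∀ y ∈ t, ∃ ξ ∈ κ, fapp h ξ = y) := by
      refine Dp.and ⟨.eq 0 0, fun _ => ∅, fun _ => hM.empty, fun v hv => ?_⟩ dpa2
      simp only [Sat]
      constructor <;> intro _ <;> first | exact hv 0 | trivial
    exact this.congr fun v hv => by
      show _ ↔ v 0 ∈ HC κ M
      rw [HC, ZFSet.mem_sep]
  have hKM : ∀ x ∈ (HC κ M).toSet, x ∈ M := fun x hx => HC_sub hx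
  refine ⟨fun x hx y hy => HC_trans hM hx hy, HC_subset h hk hc hM.omega (HC_kappa h hk hc) hc.omega_sub,
    fun x hx y hy => HC_upair h hk hc hx hy, fun x hx => ?_, fun φ v hv a ha => ?_, fun φ v hv a ha hex => ?_,
    fun x hx => ?_⟩
  · obtain ⟨t, ht, a, b, c⟩ := (mem_HC hM).1 hx
    refine HC_intro h hk hc (hM.union x (HC_sub hx)) (c.mono ?_) ?_
    · intro z hz
      obtain ⟨y, hy, hzy⟩ := ZFSet.mem_sUnion.1 hz
      exact a _ (a _ b hy) hzy
    · intro z hz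
      obtain ⟨y, hy, hzy⟩ := ZFSet.mem_sUnion.1 hz
      exact HC_trans hM (HC_trans hM hx hy) hzy
  · have hs : Dp M (fun w => Sat (HC κ M).toSet φ (Function.update v 0 (w 0))) := by
      have := Dp.sat hK hKM φ (fun i w => Function.update v 0 (w 0) i) (fun i => by
        by_cases hi : i = 0
        · subst hi; simpa using hM.vr 0
        · simp only [Function.update_of_ne hi]; exact Tm.const (HC_sub (hv i)))
      exact this
    have := hM.sep (P := fun x => Sat (HC κ M).toSet φ (Function.update v 0 x)) hs (HC_sub ha)
    exact ⟨_, HC_subset h hk hc this ha fun x hx => (ZFSet.mem_sep.1 hx).1, fun x => ZFSet.mem_sep⟩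
  · have hs : Dp M (fun w => w 1 ∈ (HC κ M).toSet ∧
        Sat (HC κ M).toSet φ (Function.update (Function.update v 0 (w 0)) 1 (w 1))) := by
      have := Dp.sat hK hKM φ (fun i w => Function.update (Function.update v 0 (w 0)) 1 (w 1) i) (fun i => by
        by_cases hi : i = 1
        · subst hi; simpa using hM.vr 1
        · simp only [Function.update_of_ne hi]
          by_cases hi : i = 0
          · subst hi; simpa using hM.vr 0
          · simp only [Function.update_of_ne hi]; exact Tm.const (HC_sub (hv i)))
      exact (Dp.sub1 (P := fun x => x ∈ (HC κ M).toSet) hK (hM.vr 1)).and this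
    obtain ⟨f, hf, hfz, hf'⟩ := choice_fn h (P := fun x y => y ∈ (HC κ M).toSet ∧
      Sat (HC κ M).toSet φ (Function.update (Function.update v 0 x) 1 y)) hs (HC_sub ha) (fun x hx => by
        obtain ⟨y, hy, h'⟩ := hex x hx
        exact ⟨y, HC_sub hy, hy, h'⟩)
    have haM := HC_sub ha
    refine ⟨img (fun x => fapp f x) a, HC_intro h hk hc (hM.cl dpa) ?_ ?_, ?_⟩
    · obtain ⟨k, hkM, hk'⟩ := HC_cov hM ha
      refine Cov.one hM hk (F := fun α => fapp f (fapp k α)) dpa fun y hy => ?_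
      obtain ⟨x, hx, rfl⟩ := mem_img.1 hy
      obtain ⟨ξ, hξ, rfl⟩ := hk' x hx
      exact ⟨ξ, hξ, rfl⟩
    · intro y hy
      obtain ⟨x, hx, rfl⟩ := mem_img.1 hy
      exact (hf' x hx).2.1
    · intro x hx
      exact ⟨_, mem_img.2 ⟨x, hx, rfl⟩, (hf' x hx).2.2⟩
  · obtain ⟨r, hr, hwo⟩ := h.wo x (HC_sub hx)
    refine ⟨r, HC_intro h hk hc hr ?_ ?_, hwo⟩
    · obtain ⟨k, hkM, hk'⟩ := HC_cov hM hx
      refine Cov.two hM hk hc (F := fun α β => ZFSet.pair (fapp k α) (fapp k β)) dpa fun y hy => ?_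
      obtain ⟨a, ha, b, hb, rfl⟩ := hwo.1 y hy
      obtain ⟨α, hα, rfl⟩ := hk' a ha
      obtain ⟨β, hβ, rfl⟩ := hk' b hb
      exact ⟨α, hα, β, hβ, rfl⟩
    · intro y hy
      obtain ⟨a, ha, b, hb, rfl⟩ := hwo.1 y hy
      exact HC_pair h hk hc (HC_trans hM hx ha) (HC_trans hM hx hb)

theorem HC_uf (h : IsTransModel M) (hk : κ ∈ M) (hc : ICard κ) (hU : IsMUltrafilter κ M U) :
    IsMUltrafilter κ (HC κ M) U := by
  obtain ⟨h1, h2, h3, h4, h5, h6, h7⟩ := hU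
  refine ⟨fun A hA => ⟨HC_subset h hk hc (h1 A hA).1 (HC_kappa h hk hc) (h1 A hA).2, (h1 A hA).2⟩, h2, h3, h4,
    fun A hA B hB => h5 A hA B (HC_sub hB), fun B hB => h6 B (HC_sub hB), fun f hf => h7 f (HC_sub hf)⟩

theorem mem_colSet_of_cov (hM : TM0 M) (hk : κ ∈ M) (hc : ICard κ) (hU : IsMUltrafilter κ M U) {t x : ZFSet.{u}}
    (ht : t ∈ M) (htt : t.IsTransitive) (hx : x ∈ t) (hcov : Cov κ M t) : x ∈ colSet κ U := by
  obtain ⟨k, hkM, hk'⟩ := hcov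
  have hB : ZFSet.sep (fun ζ => ∃ ξ ∈ κ, ∃ η ∈ κ, ζ = gp κ ξ η ∧ fapp k ξ ∈ fapp k η ∧ fapp k η ∈ t) κ ∈ M :=
    hM.cl dpa3
  set B := ZFSet.sep (fun ζ => ∃ ξ ∈ κ, ∃ η ∈ κ, ζ = gp κ ξ η ∧ fapp k ξ ∈ fapp k η ∧ fapp k η ∈ t) κ with hBd
  have hE : ∀ ξ η, ZFSet.pair ξ η ∈ ER κ B ↔ ξ ∈ κ ∧ η ∈ κ ∧ fapp k ξ ∈ fapp k η ∧ fapp k η ∈ t := by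
    intro ξ η
    rw [pair_mem_ER]
    refine and_congr_right fun hξ => and_congr_right fun hη => ?_
    rw [hBd, ZFSet.mem_sep]
    constructor
    · rintro ⟨-, a, ha, b, hb, e, h⟩
      obtain ⟨rfl, rfl⟩ := gp_inj hc.ord hξ hη ha hb e
      exact h
    · exact fun h => ⟨hc.gp_mem hξ hη, ξ, hξ, η, hη, rfl, h⟩
  have key : ∀ y, y ∈ t → ∀ η ∈ κ, fapp k η = y → Acc (erel (ER κ B)) η ∧ coll (ER κ B) η = y := by
    intro y
    induction y using ZFSet.inductionOn with
    | _ y ih =>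
    intro hy η hη e
    subst e
    have hacc : Acc (erel (ER κ B)) η := by
      refine ⟨_, fun ξ hξ => ?_⟩
      have := (hE ξ η).1 hξ
      exact (ih _ this.2.2.1 (htt _ hy this.2.2.1) ξ this.1 rfl).1
    refine ⟨hacc, ?_⟩
    ext z
    rw [mem_coll hacc]
    constructor
    · rintro ⟨ξ, hξ, rfl⟩
      have := (hE ξ η).1 hξ
      rw [(ih _ this.2.2.1 (htt _ hy this.2.2.1) ξ this.1 rfl).2]
      exact this.2.2.1
    · intro hz
      obtain ⟨ξ, hξ, rfl⟩ := hk' z (htt _ hy hz)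
      exact ⟨ξ, (hE ξ η).2 ⟨hξ, hη, hz, hy⟩, (ih _ hz (htt _ hy hz) ξ hξ rfl).2.symm⟩
  obtain ⟨η, hη, e⟩ := hk' x hx
  exact mem_colSet.2 ⟨B, (mem_codes hM hk hU).2 ⟨hB, fun z hz => (ZFSet.mem_sep.1 hz).1⟩, η, hη,
    (key x hx η hη e).2.symm⟩

theorem isMUModel_iff (hκ : IsCard κ) : IsMUModel κ U M ↔
    IsWeakModel κ M ∧ HasVkappa κ M ∧ IsMUltrafilter κ M U ∧ M = colSet κ U := by
  constructor
  · rintro ⟨h1, h2, h3, h4⟩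
    refine ⟨h1, h2, h3, ?_⟩
    have hM := h1.1.tm0
    have hc := ICard.of_model hκ hM h1.2.2
    ext x
    constructor
    · intro hx
      have := h4 _ (HC_model h1.1 h1.2.1 hc) (HC_kappa h1.1 h1.2.1 hc) (HC_uf h1.1 h1.2.1 hc h3) hx
      obtain ⟨t, ht, a, b, c⟩ := (mem_HC hM).1 this
      exact mem_colSet_of_cov hM h1.2.1 hc h3 ht a b c
    · exact fun hx => colSet_sub hM h1.2.1 h3 hx
  · rintro ⟨h1, h2, h3, h4⟩
    refine ⟨h1, h2, h3, fun M' hM' hk hU => ?_⟩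
    rw [h4]
    exact colSet_sub hM'.tm0 hk hU
end

/-! ### The ultrapower -/

theorem ICard.succ_mem {κ : ZFSet.{u}} (h : ICard κ) {a : ZFSet.{u}} (ha : a ∈ κ) : Insert.insert a a ∈ κ := by
  have hs : zcard (Insert.insert a a) < zcard κ :=
    (zcard_insert _ _).trans_lt (Cardinal.add_lt_of_lt h.inf (h.card.2 _ ha)
      (Cardinal.one_lt_aleph0.trans_le h.inf))
  rcases (ZFSet.isOrdinal_succ (h.ord.mem ha)).mem_or_subset h.ord with e | e
  · exact e
  · exact absurd (zcard_mono e) (not_le.2 hs)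

structure UF (κ M U : ZFSet.{u}) : Prop where
  tm : IsTransModel M
  k : κ ∈ M
  uf : IsMUltrafilter κ M U
  ic : ICard κ

section
variable {κ U : ZFSet.{u}}

def Big (κ U : ZFSet.{u}) (P : ZFSet.{u} → Prop) : Prop := ZFSet.sep P κ ∈ U

theorem Big.mono (h : UF κ M U) {P Q : ZFSet.{u} → Prop} (hQ : Dp M (fun v => Q (v 0)))
    (hP : Big κ U P) (hPQ : ∀ ξ ∈ κ, P ξ → Q ξ) : Big κ U Q := by
  refine h.uf.2.2.2.2.1 _ hP _ (h.tm.tm0.sep hQ h.k) (fun x hx => (ZFSet.mem_sep.1 hx).1) ?_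
  intro x hx
  rw [ZFSet.mem_sep] at hx ⊢
  exact ⟨hx.1, hPQ x hx.1 hx.2⟩

theorem Big.congr {P Q : ZFSet.{u} → Prop} (hPQ : ∀ ξ ∈ κ, (P ξ ↔ Q ξ)) : Big κ U P ↔ Big κ U Q := by
  have : ZFSet.sep P κ = ZFSet.sep Q κ := by
    ext x; rw [ZFSet.mem_sep, ZFSet.mem_sep]
    exact and_congr_right fun hx => hPQ x hx
  rw [Big, this, Big]

theorem Big.inter (h : UF κ M U) {P Q : ZFSet.{u} → Prop}
    (hP : Big κ U P) (hQ : Big κ U Q) : Big κ U (fun ξ => P ξ ∧ Q ξ) := by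
  have := h.uf.2.2.2.1 _ hP _ hQ
  unfold Big
  convert this using 1
  ext x
  simp only [ZFSet.mem_sep, ZFSet.mem_inter]
  tauto

theorem Big.ex (h : UF κ M U) {P : ZFSet.{u} → Prop} (hP : Big κ U P) : ∃ ξ ∈ κ, P ξ := by
  by_contra hc
  push Not at hc
  have : ZFSet.sep P κ = ∅ := by
    ext x; rw [ZFSet.mem_sep]
    exact ⟨fun hx => absurd hx.2 (hc x hx.1), fun hx => absurd hx (ZFSet.notMem_empty _)⟩
  rw [Big, this] at hP
  exact h.uf.2.2.1 hP

theorem Big.not (h : UF κ M U) {P : ZFSet.{u} → Prop} (hP : Dp M (fun v => P (v 0))) :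
    Big κ U (fun ξ => ¬ P ξ) ↔ ¬ Big κ U P := by
  constructor
  · intro h1 h2
    obtain ⟨ξ, -, h3, h4⟩ := (Big.inter h h1 h2).ex h
    exact h3 h4
  · intro h1
    rcases h.uf.2.2.2.2.2.1 _ (h.tm.tm0.sep hP h.k) (fun x hx => (ZFSet.mem_sep.1 hx).1) with h2 | h2
    · exact absurd h2 h1
    · unfold Big
      convert h2 using 1
      rw [compl]
      ext x
      simp only [ZFSet.mem_sep]
      tauto

theorem Big.all (h : UF κ M U) {P : ZFSet.{u} → Prop} (hP : ∀ ξ ∈ κ, P ξ) : Big κ U P := by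
  have : ZFSet.sep P κ = κ := by
    ext x; rw [ZFSet.mem_sep]; exact ⟨fun hx => hx.1, fun hx => ⟨hx, hP x hx⟩⟩
  have h0 := h.uf.2.1 ∅ (h.ic.omega_sub ZFSet.omega_zero)
  have h1 : tailSet κ ∅ = κ := by
    ext x; rw [tailSet, ZFSet.mem_sep]; exact ⟨fun hx => hx.1, fun hx => ⟨hx, ZFSet.notMem_empty _⟩⟩
  rw [Big, this, ← h1]; exact h0

theorem Big.const (h : UF κ M U) {p : Prop} : Big κ U (fun _ => p) ↔ p := by
  constructor
  · intro h1; obtain ⟨_, _, h2⟩ := h1.ex h; exact h2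
  · exact fun hp => Big.all h fun _ _ => hp

theorem Big.imp (h : UF κ M U) {P Q : ZFSet.{u} → Prop} (hP : Dp M (fun v => P (v 0)))
    (hQ : Dp M (fun v => Q (v 0))) : Big κ U (fun ξ => P ξ → Q ξ) ↔ (Big κ U P → Big κ U Q) := by
  constructor
  · intro h1 h2
    exact (Big.inter h h1 h2).mono h hQ fun ξ _ hξ => hξ.1 hξ.2
  · intro h1
    by_cases h2 : Big κ U P
    · exact (h1 h2).mono h (hP.imp hQ) fun ξ _ hξ _ => hξ
    · exact ((Big.not h hP).2 h2).mono h (hP.imp hQ) fun ξ _ hξ hξ' => absurd hξ' hξ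

theorem Big.and (h : UF κ M U) {P Q : ZFSet.{u} → Prop} (hP : Dp M (fun v => P (v 0)))
    (hQ : Dp M (fun v => Q (v 0))) : Big κ U (fun ξ => P ξ ∧ Q ξ) ↔ (Big κ U P ∧ Big κ U Q) :=
  ⟨fun h1 => ⟨h1.mono h hP fun _ _ h => h.1, h1.mono h hQ fun _ _ h => h.2⟩, fun h1 => h1.1.inter h h1.2⟩

theorem Big.tail (h : UF κ M U) {γ : ZFSet.{u}} (hγ : γ ∈ κ) : Big κ U (fun ξ => γ ∈ ξ) := by
  have hM := h.tm.tm0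
  have hγM := hM.trans _ h.k hγ
  have h1 : Big κ U (fun ξ => ξ ∉ Insert.insert γ γ) := h.uf.2.1 _ (h.ic.succ_mem hγ)
  refine h1.mono h dpa fun ξ hξ h2 => ?_
  rw [ZFSet.mem_insert_iff] at h2
  push Not at h2
  rcases (h.ic.ord.mem hγ).mem_trichotomous (h.ic.ord.mem hξ) with e | e | e
  · exact e
  · exact absurd e.symm h2.1
  · exact absurd e h2.2

def FS (κ M : ZFSet.{u}) : ZFSet.{u} := ZFSet.sep (fun f => IsZFunc κ f) M

theorem mem_FS {f : ZFSet.{u}} : f ∈ FS κ M ↔ f ∈ M ∧ IsZFunc κ f := ZFSet.mem_sep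

theorem Big.exF (h : UF κ M U) {Q : ZFSet.{u} → ZFSet.{u} → Prop} (hQ : Dp M (fun v => Q (v 0) (v 1))) :
    Big κ U (fun ξ => ∃ x ∈ M, Q x ξ) ↔ ∃ z ∈ FS κ M, Big κ U (fun ξ => Q (fapp z ξ) ξ) := by
  have hM := h.tm.tm0
  have hE : Dp M (fun v => ∃ x ∈ M, Q x (v 0)) := Dp.exM (P := fun x v => Q x (v 0)) hQ
  have hE' : Dp M (fun v => ∀ x ∈ M, Q x (v 0) → v 1 ∈ ({∅} : ZFSet.{u})) :=
    Dp.allM (P := fun x v => Q x (v 0) → v 1 ∈ ({∅} : ZFSet.{u})) (hQ.imp dpa)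
  have hB : ∀ z ∈ M, Dp M (fun v => Q (fapp z (v 0)) (v 0)) := fun z hz => Dp.sub2 (P := Q) hQ dpa dpa
  constructor
  · intro h1
    obtain ⟨z, hz, hzf, hz'⟩ := choice_fn h.tm (P := fun ξ x => Q x ξ ∨ ((¬ ∃ y ∈ M, Q y ξ) ∧ x = ∅))
      ((Dp.sub2 (P := Q) hQ (hM.vr 1) (hM.vr 0)).or (hE.not.and dpa)) h.k (fun ξ hξ => by
        by_cases hc : ∃ y ∈ M, Q y ξ
        · obtain ⟨y, hy, hQy⟩ := hc
          exact ⟨y, hy, Or.inl hQy⟩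
        · exact ⟨∅, hM.empty, Or.inr ⟨hc, rfl⟩⟩)
    refine ⟨z, mem_FS.2 ⟨hz, hzf⟩, h1.mono h (hB z hz) fun ξ hξ hex => ?_⟩
    rcases (hz' ξ hξ).2 with h2 | h2
    · exact h2
    · exact absurd hex h2.1
  · rintro ⟨z, hz, h1⟩
    have hzM := (mem_FS.1 hz).1
    exact h1.mono h hE fun ξ hξ h2 => ⟨_, hM.fapp_mem hzM (hM.trans _ h.k hξ), h2⟩

theorem Big.allF (h : UF κ M U) {Q : ZFSet.{u} → ZFSet.{u} → Prop} (hQ : Dp M (fun v => Q (v 0) (v 1))) :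
    Big κ U (fun ξ => ∀ x ∈ M, Q x ξ) ↔ ∀ z ∈ FS κ M, Big κ U (fun ξ => Q (fapp z ξ) ξ) := by
  have hM := h.tm.tm0
  have h1 := Big.exF h (Q := fun x y => ¬ Q x y) hQ.not
  have hE : Dp M (fun v => ∃ x ∈ M, ¬ Q x (v 0)) := Dp.exM (P := fun x v => ¬ Q x (v 0)) hQ.not
  have h2 := Big.not h (P := fun ξ => ∃ x ∈ M, ¬ Q x ξ) hE
  have h3 : Big κ U (fun ξ => ∀ x ∈ M, Q x ξ) ↔ Big κ U (fun ξ => ¬ ∃ x ∈ M, ¬ Q x ξ) :=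
    Big.congr fun ξ _ => by push Not; rfl
  rw [h3, h2, h1]
  push Not
  refine forall_congr' fun z => imp_congr_right fun hz => ?_
  have hzM := (mem_FS.1 hz).1
  rw [Big.not h (Dp.sub2 (P := Q) hQ (s := fun v => v 0) (t := fun v => fapp z (v 0)) dpa dpa), not_not]

theorem Big.normal (h : UF κ M U) {z : ZFSet.{u}} (hz : z ∈ FS κ M) (hb : Big κ U (fun ξ => fapp z ξ ∈ ξ)) :
    ∃ γ ∈ κ, Big κ U (fun ξ => fapp z ξ = γ) :=
  h.uf.2.2.2.2.2.2 z (mem_FS.1 hz).1 (mem_FS.1 hz).2 hb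

def eU (κ M U : ZFSet.{u}) : ZFSet.{u} :=
  ZFSet.sep (fun q => ZFSet.sep (fun ξ => fapp (pfst q) ξ ∈ fapp (psnd q) ξ) κ ∈ U) (ZFSet.prod (FS κ M) (FS κ M))

theorem pair_mem_eU {f g : ZFSet.{u}} : ZFSet.pair f g ∈ eU κ M U ↔ f ∈ FS κ M ∧ g ∈ FS κ M ∧
    Big κ U (fun ξ => fapp f ξ ∈ fapp g ξ) := by
  rw [eU, ZFSet.mem_sep, ZFSet.pair_mem_prod, pfst_pair, psnd_pair, and_assoc]; rfl

/-- the collapse map -/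
def piU (κ M U : ZFSet.{u}) : ZFSet.{u} → ZFSet.{u} := coll (eU κ M U)

def upSet (κ M U : ZFSet.{u}) : ZFSet.{u} := img (piU κ M U) (FS κ M)

def UWF (κ M U : ZFSet.{u}) : Prop := ∀ f ∈ FS κ M, Acc (erel (eU κ M U)) f

theorem mem_upSet {x : ZFSet.{u}} : x ∈ upSet κ M U ↔ ∃ f ∈ FS κ M, x = piU κ M U f := mem_img

theorem piU_mem {f : ZFSet.{u}} (hf : f ∈ FS κ M) : piU κ M U f ∈ upSet κ M U := mem_upSet.2 ⟨f, hf, rfl⟩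

theorem mem_piU (hw : UWF κ M U) {f y : ZFSet.{u}} (hf : f ∈ FS κ M) : y ∈ piU κ M U f ↔
    ∃ z ∈ FS κ M, Big κ U (fun ξ => fapp z ξ ∈ fapp f ξ) ∧ y = piU κ M U z := by
  rw [piU, mem_coll (hw f hf)]
  constructor
  · rintro ⟨z, hz, rfl⟩
    obtain ⟨a, b, c⟩ := pair_mem_eU.1 hz
    exact ⟨z, a, c, rfl⟩
  · rintro ⟨z, a, c, rfl⟩
    exact ⟨z, pair_mem_eU.2 ⟨a, hf, c⟩, rfl⟩

theorem grf_FS (h : UF κ M U) {F : ZFSet.{u} → ZFSet.{u}} (hF : Tm M (fun v => F (v 0))) : grf F κ ∈ FS κ M :=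
  mem_FS.2 ⟨h.tm.tm0.cl (Tm.grf h.tm.tm0 (f := fun x _ => F x) (Tm.const h.k) hF), isZFunc_grf _ _⟩

theorem piU_eq (h : UF κ M U) (hw : UWF κ M U) {f g : ZFSet.{u}} (hf : f ∈ FS κ M) (hg : g ∈ FS κ M) :
    piU κ M U f = piU κ M U g ↔ Big κ U (fun ξ => fapp f ξ = fapp g ξ) := by
  have hM := h.tm.tm0
  constructor
  · have key : ∀ x, ∀ f ∈ FS κ M, ∀ g ∈ FS κ M, piU κ M U f = x → piU κ M U g = x →
        Big κ U (fun ξ => fapp f ξ = fapp g ξ) := by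
      intro x
      induction x using ZFSet.inductionOn with
      | _ x ih =>
      intro f hf g hg ef eg
      have hfM := (mem_FS.1 hf).1
      have hgM := (mem_FS.1 hg).1
      have half : ∀ f ∈ FS κ M, ∀ g ∈ FS κ M, piU κ M U f = x → piU κ M U g = x →
          Big κ U (fun ξ => ∀ y ∈ fapp f ξ, y ∈ fapp g ξ) := by
        intro f hf g hg ef eg
        have hfM := (mem_FS.1 hf).1
        have hgM := (mem_FS.1 hg).1
        have := (Big.allF h (Q := fun y ξ => y ∈ fapp f ξ → y ∈ fapp g ξ) dpa).2 (fun z hz => by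
          have hzM := (mem_FS.1 hz).1
          rw [Big.imp h dpa dpa]
          intro hb
          have hzx : piU κ M U z ∈ x := by rw [← ef]; exact (mem_piU hw hf).2 ⟨z, hz, hb, rfl⟩
          have hzx' := hzx
          rw [← eg] at hzx'
          obtain ⟨w, hwF, hwb, e⟩ := (mem_piU hw hg).1 hzx'
          have hwM := (mem_FS.1 hwF).1
          have := ih _ hzx z hz w hwF rfl e.symm
          exact (this.inter h hwb).mono h dpa fun ξ _ h2 => by rw [h2.1]; exact h2.2)
        refine this.mono h dpa fun ξ hξ h2 y hy => h2 y ?_ hy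
        exact hM.trans _ (hM.fapp_mem hfM (hM.trans _ h.k hξ)) hy
      have h1 := half f hf g hg ef eg
      have h2 := half g hg f hf eg ef
      refine (h1.inter h h2).mono h dpa fun ξ _ h3 => ?_
      ext y; exact ⟨h3.1 y, h3.2 y⟩
    exact fun e => key _ f hf g hg e rfl
  · intro hb
    have hfM := (mem_FS.1 hf).1
    have hgM := (mem_FS.1 hg).1
    ext y
    rw [mem_piU hw hf, mem_piU hw hg]
    refine exists_congr fun z => and_congr_right fun hz => and_congr_left fun _ => ?_
    have hzM := (mem_FS.1 hz).1
    constructor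
    · exact fun h1 => (hb.inter h h1).mono h dpa fun ξ _ h2 => h2.1 ▸ h2.2
    · exact fun h1 => (hb.inter h h1).mono h dpa fun ξ _ h2 => h2.1.symm ▸ h2.2

theorem piU_mem_piU (h : UF κ M U) (hw : UWF κ M U) {f g : ZFSet.{u}} (hf : f ∈ FS κ M) (hg : g ∈ FS κ M) :
    piU κ M U f ∈ piU κ M U g ↔ Big κ U (fun ξ => fapp f ξ ∈ fapp g ξ) := by
  have hM := h.tm.tm0
  have hfM := (mem_FS.1 hf).1
  have hgM := (mem_FS.1 hg).1
  rw [mem_piU hw hg]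
  constructor
  · rintro ⟨z, hz, hb, e⟩
    exact (((piU_eq h hw hf hz).1 e).inter h hb).mono h dpa fun ξ _ h2 => by rw [h2.1]; exact h2.2
  · exact fun hb => ⟨f, hf, hb, rfl⟩

theorem dp_satM (hM : TM0 M) (φ : Fml) (t : ℕ → (ℕ → ZFSet.{u}) → ZFSet.{u}) (ht : ∀ i, Tm M (t i)) :
    Dp M (fun v => Sat M.toSet φ (fun i => t i v)) := by
  refine Dp.sat ?_ (fun x hx => hx) φ t ht
  exact (Dp.trivM hM True).congr fun v hv => ⟨fun _ => hv 0, fun _ => trivial⟩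

theorem los (h : UF κ M U) (hw : UWF κ M U) (φ : Fml) : ∀ f : ℕ → ZFSet.{u}, (∀ i, f i ∈ FS κ M) →
    (Sat (upSet κ M U).toSet φ (fun i => piU κ M U (f i)) ↔
      Big κ U (fun ξ => Sat M.toSet φ (fun i => fapp (f i) ξ))) := by
  have hM := h.tm.tm0
  have hD : ∀ (φ : Fml) (f : ℕ → ZFSet.{u}), (∀ i, f i ∈ FS κ M) →
      Dp M (fun v => Sat M.toSet φ (fun i => fapp (f i) (v 0))) := fun φ f hf =>
    dp_satM hM φ (fun i v => fapp (f i) (v 0)) fun i => by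
      have := (mem_FS.1 (hf i)).1
      exact dpa
  induction φ with
  | mem i j => exact fun f hf => piU_mem_piU h hw (hf i) (hf j)
  | eq i j => exact fun f hf => piU_eq h hw (hf i) (hf j)
  | impl φ ψ h1 h2 =>
    intro f hf
    simp only [Sat]
    rw [Big.imp h (hD φ f hf) (hD ψ f hf), h1 f hf, h2 f hf]
  | neg φ h1 =>
    intro f hf
    simp only [Sat]
    rw [Big.not h (hD φ f hf), h1 f hf]
  | all n φ ih =>
    intro f hf
    simp only [Sat]
    have hQ : Dp M (fun v => Sat M.toSet φ (Function.update (fun i => fapp (f i) (v 1)) n (v 0))) := by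
      refine (dp_satM hM φ (fun i v => if i = n then v 0 else fapp (f i) (v 1)) fun i => ?_).congr fun v hv => ?_
      · have := (mem_FS.1 (hf i)).1
        by_cases hi : i = n
        · simp only [hi, if_true]; exact hM.vr 0
        · simp only [hi, if_false]; exact dpa
      · have : (fun i => if i = n then v 0 else fapp (f i) (v 1)) =
          Function.update (fun i => fapp (f i) (v 1)) n (v 0) := by
          funext i
          by_cases hi : i = n
          · subst hi; simp
          · simp [hi]
        simp only [this]
    have := Big.allF h (Q := fun x ξ => Sat M.toSet φ (Function.update (fun i => fapp (f i) ξ) n x)) hQ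
    refine Iff.trans ?_ this.symm
    have e1 : ∀ z, (fun i => piU κ M U (Function.update f n z i)) =
        Function.update (fun i => piU κ M U (f i)) n (piU κ M U z) := by
      intro z; funext i
      by_cases hi : i = n
      · subst hi; simp
      · simp [hi]
    have e2 : ∀ z ξ, (fun i => fapp (Function.update f n z i) ξ) =
        Function.update (fun i => fapp (f i) ξ) n (fapp z ξ) := by
      intro z ξ; funext i
      by_cases hi : i = n
      · subst hi; simp
      · simp [hi]
    have key : ∀ z ∈ FS κ M, (Sat (upSet κ M U).toSet φ (Function.update (fun i => piU κ M U (f i)) n (piU κ M U z)) ↔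
        Big κ U (fun ξ => Sat M.toSet φ (Function.update (fun i => fapp (f i) ξ) n (fapp z ξ)))) := by
      intro z hz
      have := ih (Function.update f n z) (fun i => by
        by_cases hi : i = n
        · subst hi; simpa using hz
        · simpa [hi] using hf i)
      simp only [e1, e2] at this
      exact this
    constructor
    · intro h1 z hz
      exact (key z hz).1 (h1 _ (piU_mem hz))
    · intro h1 x hx
      obtain ⟨z, hz, rfl⟩ := mem_upSet.1 hx
      exact (key z hz).2 (h1 z hz)
end

section
variable {κ U : ZFSet.{u}}

theorem upSet_trans (hw : UWF κ M U) : (upSet κ M U).IsTransitive := by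
  intro x hx y hy
  obtain ⟨f, hf, rfl⟩ := mem_upSet.1 hx
  obtain ⟨z, hz, -, rfl⟩ := (mem_piU hw hf).1 hy
  exact piU_mem hz

def cst (κ x : ZFSet.{u}) : ZFSet.{u} := grf (fun _ => x) κ

theorem cst_FS (h : UF κ M U) {x : ZFSet.{u}} (hx : x ∈ M) : cst κ x ∈ FS κ M :=
  grf_FS h (Tm.const hx)

theorem fapp_cst {x ξ : ZFSet.{u}} (hξ : ξ ∈ κ) : fapp (cst κ x) ξ = x := fapp_grf hξ

theorem piU_cst_of_norm (h : UF κ M U) (hw : UWF κ M U) {z γ : ZFSet.{u}} (hz : z ∈ FS κ M) (hγ : γ ∈ M)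
    (hb : Big κ U (fun ξ => fapp z ξ = γ)) : piU κ M U z = piU κ M U (cst κ γ) := by
  have hM := h.tm.tm0
  have hzM := (mem_FS.1 hz).1
  have hcM := (mem_FS.1 (cst_FS h hγ)).1
  exact (piU_eq h hw hz (cst_FS h hγ)).2 (hb.mono h dpa fun ξ hξ e => by rw [fapp_cst hξ]; exact e)

theorem piU_cst (h : UF κ M U) (hw : UWF κ M U) {γ : ZFSet.{u}} (hγ : γ ∈ κ) : piU κ M U (cst κ γ) = γ := by
  have hM := h.tm.tm0
  induction γ using ZFSet.inductionOn with
  | _ γ ih =>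
  have hγM := hM.trans _ h.k hγ
  ext y
  rw [mem_piU hw (cst_FS h hγM)]
  constructor
  · rintro ⟨z, hz, hb, rfl⟩
    have hzM := (mem_FS.1 hz).1
    have hb' : Big κ U (fun ξ => fapp z ξ ∈ γ) := hb.mono h dpa fun ξ hξ e => by rwa [fapp_cst hξ] at e
    obtain ⟨δ, hδ, hd⟩ := Big.normal h hz ((hb'.inter h (Big.tail h hγ)).mono h dpa fun ξ hξ e =>
      (h.ic.ord.mem hξ).isTransitive _ e.2 e.1)
    obtain ⟨ξ, -, e1, e2⟩ := (hb'.inter h hd).ex h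
    rw [e2] at e1
    rw [piU_cst_of_norm h hw hz (hM.trans _ h.k hδ) hd, ih δ e1 hδ]
    exact e1
  · intro hy
    have hyκ := h.ic.ord.isTransitive _ hγ hy
    refine ⟨cst κ y, cst_FS h (hM.trans _ h.k hyκ), Big.all h fun ξ hξ => ?_, (ih y hy hyκ).symm⟩
    rw [fapp_cst hξ, fapp_cst hξ]; exact hy

def idf (κ : ZFSet.{u}) : ZFSet.{u} := grf (fun x => x) κ

theorem idf_FS (h : UF κ M U) : idf κ ∈ FS κ M := grf_FS h (h.tm.tm0.vr 0)

theorem fapp_idf {ξ : ZFSet.{u}} (hξ : ξ ∈ κ) : fapp (idf κ) ξ = ξ := fapp_grf hξ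

theorem piU_sub (h : UF κ M U) (hw : UWF κ M U) {A : ZFSet.{u}} (hA : A ∈ M) (hAκ : A ⊆ κ) :
    piU κ M U (grf (fun ξ => A ∩ ξ) κ) = A := by
  have hM := h.tm.tm0
  have hF : grf (fun ξ => A ∩ ξ) κ ∈ FS κ M := grf_FS h dpa
  have hFM := (mem_FS.1 hF).1
  ext y
  rw [mem_piU hw hF]
  constructor
  · rintro ⟨z, hz, hb, rfl⟩
    have hzM := (mem_FS.1 hz).1
    have hb' : Big κ U (fun ξ => fapp z ξ ∈ A ∧ fapp z ξ ∈ ξ) := hb.mono h dpa fun ξ hξ e => by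
      rwa [fapp_grf hξ, ZFSet.mem_inter] at e
    obtain ⟨δ, hδ, hd⟩ := Big.normal h hz (hb'.mono h dpa fun ξ hξ e => e.2)
    obtain ⟨ξ, -, e1, e2⟩ := (hb'.inter h hd).ex h
    rw [e2] at e1
    rw [piU_cst_of_norm h hw hz (hM.trans _ h.k hδ) hd, piU_cst h hw hδ]
    exact e1.1
  · intro hy
    have hyκ := hAκ hy
    have hyM := hM.trans _ h.k hyκ
    have hc := (mem_FS.1 (cst_FS h hyM)).1
    refine ⟨cst κ y, cst_FS h hyM, (Big.tail h hyκ).mono h dpa fun ξ hξ e => ?_, (piU_cst h hw hyκ).symm⟩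
    rw [fapp_cst hξ, fapp_grf hξ, ZFSet.mem_inter]; exact ⟨hy, e⟩

theorem sub_upSet (h : UF κ M U) (hw : UWF κ M U) {A : ZFSet.{u}} (hA : A ∈ M) (hAκ : A ⊆ κ) :
    A ∈ upSet κ M U := by
  have hM := h.tm.tm0
  rw [← piU_sub h hw hA hAκ]
  exact piU_mem (grf_FS h dpa)

theorem piU_idf (h : UF κ M U) (hw : UWF κ M U) : piU κ M U (idf κ) = κ := by
  have hM := h.tm.tm0
  have hk := h.k
  have hF : grf (fun ξ => κ ∩ ξ) κ ∈ FS κ M := grf_FS h dpa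
  have e : grf (fun ξ => κ ∩ ξ) κ = idf κ := grf_congr fun x hx => by
    ext y; rw [ZFSet.mem_inter]; exact ⟨fun h => h.2, fun hy => ⟨h.ic.ord.isTransitive _ hx hy, hy⟩⟩
  have := piU_sub h hw h.k (fun _ h => h)
  rwa [e] at this

theorem upSet_tm0 (h : UF κ M U) (hw : UWF κ M U) : TM0 (upSet κ M U) := by
  have hM := h.tm.tm0
  have hk := h.k
  have hT := upSet_trans hw
  have hkN : κ ∈ upSet κ M U := sub_upSet h hw h.k (fun _ h => h)
  refine ⟨hT, sub_upSet h hw hM.omega h.ic.omega_sub, ?_, ?_, ?_, ?_⟩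
  · intro x hx y hy
    obtain ⟨f, hf, rfl⟩ := mem_upSet.1 hx
    obtain ⟨g, hg, rfl⟩ := mem_upSet.1 hy
    have hfM := (mem_FS.1 hf).1
    have hgM := (mem_FS.1 hg).1
    have hF : grf (fun ξ => {fapp f ξ, fapp g ξ}) κ ∈ FS κ M := grf_FS h dpa
    have hFM := (mem_FS.1 hF).1
    have : piU κ M U (grf (fun ξ => {fapp f ξ, fapp g ξ}) κ) = {piU κ M U f, piU κ M U g} := by
      ext w
      rw [ZFSet.mem_pair, mem_piU hw hF]
      constructor
      · rintro ⟨z, hz, hb, rfl⟩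
        have hzM := (mem_FS.1 hz).1
        rw [piU_eq h hw hz hf, piU_eq h hw hz hg]
        by_contra hc
        push Not at hc
        have h1 := (Big.not h (P := fun ξ => fapp z ξ = fapp f ξ) dpa).2 hc.1
        have h2 := (Big.not h (P := fun ξ => fapp z ξ = fapp g ξ) dpa).2 hc.2
        obtain ⟨ξ, hξ, ⟨a, b⟩, c⟩ := ((h1.inter h h2).inter h hb).ex h
        rw [fapp_grf hξ, ZFSet.mem_pair] at c
        tauto
      · rintro (rfl | rfl)
        · exact ⟨f, hf, Big.all h fun ξ hξ => by rw [fapp_grf hξ]; simp, rfl⟩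
        · exact ⟨g, hg, Big.all h fun ξ hξ => by rw [fapp_grf hξ]; simp, rfl⟩
    rw [← this]; exact piU_mem hF
  · intro x hx
    obtain ⟨f, hf, rfl⟩ := mem_upSet.1 hx
    have hfM := (mem_FS.1 hf).1
    have hF : grf (fun ξ => ⋃₀ (fapp f ξ)) κ ∈ FS κ M := grf_FS h dpa
    have hFM := (mem_FS.1 hF).1
    have : piU κ M U (grf (fun ξ => ⋃₀ (fapp f ξ)) κ) = ⋃₀ (piU κ M U f) := by
      ext w
      rw [ZFSet.mem_sUnion]
      constructor
      · intro hw'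
        obtain ⟨z, hz, hb, rfl⟩ := (mem_piU hw hF).1 hw'
        have hzM := (mem_FS.1 hz).1
        obtain ⟨g, hg, hgb⟩ := (Big.exF h (Q := fun x ξ => x ∈ fapp f ξ ∧ fapp z ξ ∈ x) dpa).1
          (hb.mono h dpa fun ξ hξ e => by
            rw [fapp_grf hξ, ZFSet.mem_sUnion] at e
            obtain ⟨x, hx, hzx⟩ := e
            exact ⟨x, hM.trans _ (hM.fapp_mem hfM (hM.trans _ h.k hξ)) hx, hx, hzx⟩)
        have hgM := (mem_FS.1 hg).1
        rw [Big.and h dpa dpa] at hgb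
        exact ⟨_, (piU_mem_piU h hw hg hf).2 hgb.1, (piU_mem_piU h hw hz hg).2 hgb.2⟩
      · rintro ⟨y, hy, hwy⟩
        obtain ⟨g, hg, hgb, rfl⟩ := (mem_piU hw hf).1 hy
        obtain ⟨z, hz, hzb, rfl⟩ := (mem_piU hw hg).1 hwy
        have hzM := (mem_FS.1 hz).1
        refine (piU_mem_piU h hw hz hF).2 ((hgb.inter h hzb).mono h dpa fun ξ hξ e => ?_)
        rw [fapp_grf hξ, ZFSet.mem_sUnion]; exact ⟨_, e.1, e.2⟩
    rw [← this]; exact piU_mem hF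
  · intro φ v hv a ha
    obtain ⟨f, hf, rfl⟩ := mem_upSet.1 ha
    choose g hg hgv using fun n => mem_upSet.1 (hv n)
    obtain rfl : v = fun n => piU κ M U (g n) := funext hgv
    have hfM := (mem_FS.1 hf).1
    have hgM := fun i => (mem_FS.1 (hg i)).1
    have hS : Dp M (fun v => Sat M.toSet φ (Function.update (fun i => fapp (g i) (v 1)) 0 (v 0))) := by
      refine (dp_satM hM φ (fun i v => Function.update (fun i => fapp (g i) (v 1)) 0 (v 0) i) fun i => ?_)
      have := hgM i
      by_cases hi : i = 0
      · subst hi; simp only [Function.update_self]; exact hM.vr 0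
      · simp only [Function.update_of_ne hi]; exact dpa
    have hF : grf (fun ξ => ZFSet.sep (fun x => Sat M.toSet φ (Function.update (fun i => fapp (g i) ξ) 0 x)) (fapp f ξ)) κ
        ∈ FS κ M := by
      refine grf_FS h ?_
      exact Tm.sep hM (P := fun x v => Sat M.toSet φ (Function.update (fun i => fapp (g i) (v 0)) 0 x)) dpa hS
    refine ⟨_, piU_mem hF, fun x => ?_⟩
    have key : ∀ z ∈ FS κ M, (piU κ M U z ∈ piU κ M U (grf (fun ξ => ZFSet.sep (fun x => Sat M.toSet φ
        (Function.update (fun i => fapp (g i) ξ) 0 x)) (fapp f ξ)) κ) ↔ piU κ M U z ∈ piU κ M U f ∧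
        Sat (upSet κ M U).toSet φ (Function.update (fun n => piU κ M U (g n)) 0 (piU κ M U z))) := by
      intro z hz
      have hzM := (mem_FS.1 hz).1
      have := los h hw φ (Function.update g 0 z) (fun i => by
        by_cases hi : i = 0
        · subst hi; simpa using hz
        · simpa [hi] using hg i)
      have e1 : (fun i => piU κ M U (Function.update g 0 z i)) =
          Function.update (fun i => piU κ M U (g i)) 0 (piU κ M U z) := by
        funext i
        by_cases hi : i = 0
        · subst hi; simp
        · simp [hi]
      have e2 : ∀ ξ, (fun i => fapp (Function.update g 0 z i) ξ) =
          Function.update (fun i => fapp (g i) ξ) 0 (fapp z ξ) := by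
        intro ξ; funext i
        by_cases hi : i = 0
        · subst hi; simp
        · simp [hi]
      simp only [e1, e2] at this
      rw [this, piU_mem_piU h hw hz hF, piU_mem_piU h hw hz hf, ← Big.and h dpa
        (Dp.sub2 (P := fun x ξ => Sat M.toSet φ (Function.update (fun i => fapp (g i) ξ) 0 x)) hS
          (s := fun v => v 0) (t := fun v => fapp z (v 0)) dpa dpa)]
      exact Big.congr fun ξ hξ => by rw [fapp_grf hξ, ZFSet.mem_sep]
    constructor
    · intro hx
      obtain ⟨z, hz, -, rfl⟩ := (mem_piU hw hF).1 hx
      exact (key z hz).1 hx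
    · intro hx
      obtain ⟨z, hz, -, rfl⟩ := (mem_piU hw hf).1 hx.1
      exact (key z hz).2 hx
  · intro φ v hv a ha hex
    obtain ⟨f, hf, rfl⟩ := mem_upSet.1 ha
    choose g hg hgv using fun n => mem_upSet.1 (hv n)
    obtain rfl : v = fun n => piU κ M U (g n) := funext hgv
    have hfM := (mem_FS.1 hf).1
    have hgM := fun i => (mem_FS.1 (hg i)).1
    set R : ZFSet.{u} → ZFSet.{u} → ZFSet.{u} → Prop := fun x y ξ =>
      Sat M.toSet φ (Function.update (Function.update (fun i => fapp (g i) ξ) 0 x) 1 y) with hR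
    have hS : Dp M (fun v => R (v 0) (v 1) (v 2)) := by
      refine (dp_satM hM φ (fun i v => Function.update (Function.update (fun i => fapp (g i) (v 2)) 0 (v 0)) 1 (v 1) i)
        fun i => ?_)
      have := hgM i
      by_cases hi : i = 1
      · subst hi; simp only [Function.update_self]; exact hM.vr 1
      · simp only [Function.update_of_ne hi]
        by_cases hi : i = 0
        · subst hi; simp only [Function.update_self]; exact hM.vr 0
        · simp only [Function.update_of_ne hi]; exact dpa
    have hSs : ∀ {s t r : (ℕ → ZFSet.{u}) → ZFSet.{u}}, Tm M s → Tm M t → Tm M r →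
      Dp M (fun v => R (s v) (t v) (r v)) := fun a b c => Dp.sub3 (P := R) hS a b c
    have key : ∀ z ∈ FS κ M, ∀ w ∈ FS κ M, (Sat (upSet κ M U).toSet φ (Function.update (Function.update
        (fun n => piU κ M U (g n)) 0 (piU κ M U z)) 1 (piU κ M U w)) ↔ Big κ U (fun ξ => R (fapp z ξ) (fapp w ξ) ξ)) := by
      intro z hz w hwF
      have := los h hw φ (Function.update (Function.update g 0 z) 1 w) (fun i => by
        by_cases hi : i = 1
        · subst hi; simpa using hwF
        · by_cases hi' : i = 0
          · subst hi'; simpa using hz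
          · simpa [hi, hi'] using hg i)
      have e1 : (fun i => piU κ M U (Function.update (Function.update g 0 z) 1 w i)) =
          Function.update (Function.update (fun i => piU κ M U (g i)) 0 (piU κ M U z)) 1 (piU κ M U w) := by
        funext i
        by_cases hi : i = 1
        · subst hi; simp
        · by_cases hi' : i = 0
          · subst hi'; simp
          · simp [hi, hi']
      have e2 : ∀ ξ, (fun i => fapp (Function.update (Function.update g 0 z) 1 w i) ξ) =
          Function.update (Function.update (fun i => fapp (g i) ξ) 0 (fapp z ξ)) 1 (fapp w ξ) := by
        intro ξ; funext i
        by_cases hi : i = 1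
        · subst hi; simp
        · by_cases hi' : i = 0
          · subst hi'; simp
          · simp [hi, hi']
      simp only [e1, e2] at this
      exact this
    have hq : Dp M (fun v => ∃ y ∈ M, R (v 0) y (v 1)) :=
      Dp.exM (P := fun y v => R (v 0) y (v 1)) (hSs dpa dpa dpa)
    have h1 : Big κ U (fun ξ => ∀ x ∈ M, x ∈ fapp f ξ → ∃ y ∈ M, R x y ξ) := by
      refine (Big.allF h (Q := fun x ξ => x ∈ fapp f ξ → ∃ y ∈ M, R x y ξ) (Dp.imp dpa hq)).2 fun z hz => ?_
      have hzM := (mem_FS.1 hz).1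
      rw [Big.imp h dpa (Dp.sub2 (P := fun x ξ => ∃ y ∈ M, R x y ξ) hq (s := fun v => v 0) (t := fun v => fapp z (v 0)) dpa dpa)]
      intro hb
      obtain ⟨y, hy, hS'⟩ := hex _ ((piU_mem_piU h hw hz hf).2 hb)
      obtain ⟨w, hwF, rfl⟩ := mem_upSet.1 hy
      rw [key z hz w hwF] at hS'
      have hwM := (mem_FS.1 hwF).1
      exact (Big.exF h (Q := fun y ξ => R (fapp z ξ) y ξ) (hSs dpa dpa dpa)).2 ⟨w, hwF, hS'⟩
    have hq2 : Dp M (fun v => ∀ x ∈ fapp f (v 1), ∃ y ∈ v 0, R x y (v 1)) := by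
      refine Dp.ball hM (P := fun x v => ∃ y ∈ v 0, R x y (v 1)) dpa ?_
      refine Dp.bex hM (P := fun y v => R (v 0) y (v 2)) dpa ?_
      exact hSs dpa dpa dpa
    obtain ⟨b, hb, hbb⟩ := (Big.exF h (Q := fun b ξ => ∀ x ∈ fapp f ξ, ∃ y ∈ b, R x y ξ) hq2).1
      (h1.mono h (Dp.exM (P := fun b v => ∀ x ∈ fapp f (v 0), ∃ y ∈ b, R x y (v 0)) hq2) fun ξ hξ e => by
        have hξM := hM.trans _ h.k hξ
        exact hM.coll (P := fun x y => R x y ξ) (hSs dpa dpa dpa) (hM.fapp_mem hfM hξM)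
          fun x hx => e x (hM.trans _ (hM.fapp_mem hfM hξM) hx) hx)
    have hbM := (mem_FS.1 hb).1
    refine ⟨_, piU_mem hb, fun x hx => ?_⟩
    obtain ⟨z, hz, hzb, rfl⟩ := (mem_piU hw hf).1 hx
    have hzM := (mem_FS.1 hz).1
    have hq3 : Dp M (fun v => v 0 ∈ fapp b (v 1) ∧ R (fapp z (v 1)) (v 0) (v 1)) := Dp.and dpa (hSs dpa dpa dpa)
    obtain ⟨w, hwF, hwb⟩ := (Big.exF h (Q := fun y ξ => y ∈ fapp b ξ ∧ R (fapp z ξ) y ξ) hq3).1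
      ((hbb.inter h hzb).mono h (Dp.exM (P := fun y v => y ∈ fapp b (v 0) ∧ R (fapp z (v 0)) y (v 0)) hq3)
        fun ξ hξ e => by
          obtain ⟨y, hy, hr⟩ := e.1 _ e.2
          exact ⟨y, hM.trans _ (hM.fapp_mem hbM (hM.trans _ h.k hξ)) hy, hy, hr⟩)
    have hwM := (mem_FS.1 hwF).1
    have hwb' := (Big.and h (P := fun ξ => fapp w ξ ∈ fapp b ξ) (Q := fun ξ => R (fapp z ξ) (fapp w ξ) ξ)
      dpa (hSs dpa dpa dpa)).1 hwb
    exact ⟨_, (piU_mem_piU h hw hwF hb).2 hwb'.1, (key z hz w hwF).2 hwb'.2⟩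
end

/-! ### Explicit formulas and uniqueness of the ultrapower -/

def Fml.ex (n : ℕ) (φ : Fml) : Fml := .neg (.all n (.neg φ))
def Fml.conj (φ ψ : Fml) : Fml := .neg (.impl φ (.neg ψ))
def Fml.disj (φ ψ : Fml) : Fml := .impl (.neg φ) ψ
def Fml.equ (φ ψ : Fml) : Fml := Fml.conj (.impl φ ψ) (.impl ψ φ)

section
variable {D : Set ZFSet.{u}} {φ ψ : Fml} {v : ℕ → ZFSet.{u}}

theorem sat_mem {i j : ℕ} : Sat D (.mem i j) v ↔ v i ∈ v j := by simp only [Sat]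
theorem sat_eq {i j : ℕ} : Sat D (.eq i j) v ↔ v i = v j := by simp only [Sat]
theorem sat_impl : Sat D (.impl φ ψ) v ↔ (Sat D φ v → Sat D ψ v) := by simp only [Sat]
theorem sat_neg : Sat D (.neg φ) v ↔ ¬ Sat D φ v := by simp only [Sat]
theorem sat_all {n : ℕ} : Sat D (.all n φ) v ↔ ∀ x ∈ D, Sat D φ (Function.update v n x) := by simp only [Sat]
theorem sat_ex {n : ℕ} : Sat D (Fml.ex n φ) v ↔ ∃ x ∈ D, Sat D φ (Function.update v n x) := by
  simp only [Fml.ex, Sat]; push Not; rfl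
theorem sat_conj : Sat D (Fml.conj φ ψ) v ↔ (Sat D φ v ∧ Sat D ψ v) := by
  simp only [Fml.conj, Sat]; tauto
theorem sat_disj : Sat D (Fml.disj φ ψ) v ↔ (Sat D φ v ∨ Sat D ψ v) := by
  simp only [Fml.disj, Sat]; tauto
theorem sat_equ : Sat D (Fml.equ φ ψ) v ↔ (Sat D φ v ↔ Sat D ψ v) := by
  simp only [Fml.equ, sat_conj, sat_impl]; tauto

end

/-- `z = {a, b}` -/
def fUp (z a b : ℕ) : Fml := .all 10 (Fml.equ (.mem 10 z) (Fml.disj (.eq 10 a) (.eq 10 b)))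

theorem sat_fUp {N : ZFSet.{u}} (hN : N.IsTransitive) {z a b : ℕ} {v : ℕ → ZFSet.{u}} (hv : ∀ i, v i ∈ N)
    (hz : z < 10) (ha : a < 10) (hb : b < 10) : Sat N.toSet (fUp z a b) v ↔ v z = {v a, v b} := by
  simp only [fUp, sat_all, sat_equ, sat_mem, sat_disj, sat_eq, Function.update_self,
    Function.update_of_ne hz.ne, Function.update_of_ne ha.ne, Function.update_of_ne hb.ne]
  constructor
  · intro h
    ext w
    rw [ZFSet.mem_pair]
    constructor
    · intro hw; exact (h w (hN _ (hv z) hw)).1 hw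
    · rintro (rfl | rfl)
      · exact (h _ (hv a)).2 (Or.inl rfl)
      · exact (h _ (hv b)).2 (Or.inr rfl)
  · intro h w _
    rw [h, ZFSet.mem_pair]

/-- `p = pair a b` -/
def fPair (p a b : ℕ) : Fml :=
  Fml.ex 9 (Fml.ex 8 (Fml.conj (fUp 9 a a) (Fml.conj (fUp 8 a b) (fUp p 9 8))))

theorem upd_mem {N : ZFSet.{u}} {v : ℕ → ZFSet.{u}} (hv : ∀ i, v i ∈ N) (n : ℕ) {x : ZFSet.{u}} (hx : x ∈ N) :
    ∀ i, Function.update v n x i ∈ N := by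
  intro i
  by_cases h : i = n
  · subst h; simpa using hx
  · simpa [h] using hv i

theorem sat_fPair {N : ZFSet.{u}} (hN : N.IsTransitive) {p a b : ℕ} {v : ℕ → ZFSet.{u}} (hv : ∀ i, v i ∈ N)
    (hp : p < 8) (ha : a < 8) (hb : b < 8) : Sat N.toSet (fPair p a b) v ↔ v p = ZFSet.pair (v a) (v b) := by
  have e9 : ∀ {i : ℕ}, i < 8 → i ≠ 9 := by omega
  have e8 : ∀ {i : ℕ}, i < 8 → i ≠ 8 := by omega
  simp only [fPair, sat_ex, sat_conj]
  constructor
  · rintro ⟨s, hs, t, ht, h1, h2, h3⟩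
    have hv2 := upd_mem (upd_mem hv 9 hs) 8 ht
    rw [sat_fUp hN hv2 (by omega) (by omega) (by omega)] at h1 h2 h3
    simp [Function.update_of_ne, e9 hp, e8 hp, e9 ha, e8 ha, e9 hb, e8 hb] at h1 h2 h3
    rw [h3, h1, h2]; simp [ZFSet.pair]
  · intro h
    have hs : ({v a} : ZFSet.{u}) ∈ N := hN _ (hv p) (by rw [h, ZFSet.pair]; simp)
    have ht : ({v a, v b} : ZFSet.{u}) ∈ N := hN _ (hv p) (by rw [h, ZFSet.pair]; simp)
    have hv2 := upd_mem (upd_mem hv 9 hs) 8 ht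
    refine ⟨_, hs, _, ht, ?_⟩
    rw [sat_fUp hN hv2 (by omega) (by omega) (by omega), sat_fUp hN hv2 (by omega) (by omega) (by omega),
      sat_fUp hN hv2 (by omega) (by omega) (by omega)]
    simp [Function.update_of_ne, e9 hp, e8 hp, e9 ha, e8 ha, e9 hb, e8 hb, h, ZFSet.pair]

/-- `z ∈ fapp f x` -/
def fApM (z f x : ℕ) : Fml := Fml.ex 7 (Fml.ex 6 (Fml.conj (.mem 7 f) (Fml.conj (fPair 7 x 6) (.mem z 6))))

theorem sat_fApM {N : ZFSet.{u}} (hN : N.IsTransitive) {z f x : ℕ} {v : ℕ → ZFSet.{u}} (hv : ∀ i, v i ∈ N)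
    (hz : z < 6) (hf : f < 6) (hx : x < 6) : Sat N.toSet (fApM z f x) v ↔ v z ∈ fapp (v f) (v x) := by
  have e9 : ∀ {i : ℕ}, i < 6 → i ≠ 7 := by omega
  have e8 : ∀ {i : ℕ}, i < 6 → i ≠ 6 := by omega
  simp only [fApM, sat_ex, sat_conj, mem_fapp]
  constructor
  · rintro ⟨s, hs, t, ht, h1, h2, h3⟩
    have hv2 := upd_mem (upd_mem hv 7 hs) 6 ht
    rw [sat_fPair hN hv2 (by omega) (by omega) (by omega)] at h2
    rw [sat_mem] at h1 h3
    simp [Function.update_of_ne, e9 hz, e8 hz, e9 hf, e8 hf, e9 hx, e8 hx] at h1 h2 h3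
    exact ⟨t, h2 ▸ h1, h3⟩
  · rintro ⟨t, h1, h3⟩
    have hs : ZFSet.pair (v x) t ∈ N := hN _ (hv f) h1
    have hs' : ({v x, t} : ZFSet.{u}) ∈ N := hN _ hs (by rw [ZFSet.pair]; simp)
    have ht : t ∈ N := hN _ hs' (by simp)
    have hv2 := upd_mem (upd_mem hv 7 hs) 6 ht
    refine ⟨_, hs, _, ht, ?_⟩
    rw [sat_fPair hN hv2 (by omega) (by omega) (by omega), sat_mem, sat_mem]
    simp [Function.update_of_ne, e9 hz, e8 hz, e9 hf, e8 hf, e9 hx, e8 hx, h1, h3]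

theorem fapp_sub_trans {N f x z : ZFSet.{u}} (hN : N.IsTransitive) (hf : f ∈ N) (hz : z ∈ fapp f x) : z ∈ N := by
  obtain ⟨t, h1, h3⟩ := mem_fapp.1 hz
  have hs : ZFSet.pair x t ∈ N := hN _ hf h1
  have hs' : ({x, t} : ZFSet.{u}) ∈ N := hN _ hs (by rw [ZFSet.pair]; simp)
  have ht : t ∈ N := hN _ hs' (by simp)
  exact hN _ ht h3

/-- `y = fapp f x` -/
def fApE (f x y : ℕ) : Fml := .all 5 (Fml.equ (.mem 5 y) (fApM 5 f x))

theorem sat_fApE {N : ZFSet.{u}} (hN : N.IsTransitive) {f x y : ℕ} {v : ℕ → ZFSet.{u}} (hv : ∀ i, v i ∈ N)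
    (hf : f < 5) (hx : x < 5) (hy : y < 5) : Sat N.toSet (fApE f x y) v ↔ v y = fapp (v f) (v x) := by
  have key : ∀ z ∈ N, Sat N.toSet (Fml.equ (.mem 5 y) (fApM 5 f x)) (Function.update v 5 z) ↔
      (z ∈ v y ↔ z ∈ fapp (v f) (v x)) := by
    intro z hz
    rw [sat_equ, sat_mem, sat_fApM hN (upd_mem hv 5 hz) (by omega) (by omega) (by omega)]
    simp [Function.update_of_ne, hf.ne, hx.ne, hy.ne]
  rw [fApE, sat_all]
  constructor
  · intro h
    ext z
    constructor
    · intro hz; have hzN := hN _ (hv y) hz; exact ((key z hzN).1 (h z hzN)).1 hz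
    · intro hz; have hzN := fapp_sub_trans hN (hv f) hz; exact ((key z hzN).1 (h z hzN)).2 hz
  · intro h z hz
    rw [key z hz, h]

/-- `0 = f, 1 = κ, 2 = A, 3 = h`; `∀ x ∈ κ, (x ∈ A ↔ f x ∈ h x)`.  We let index `4` be `x` and recycle. -/
def fMemA : Fml := .all 4 (.impl (.mem 4 1) (Fml.equ (.mem 4 2) (Fml.ex 1 (Fml.conj (fApE 0 4 1) (fApM 1 3 4)))))

/-- `∀ x ∈ κ, ∃ y, y = f x` -/
def fTot : Fml := .all 4 (.impl (.mem 4 1) (Fml.ex 1 (fApE 0 4 1)))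

def asg (a b c d : ZFSet.{u}) : ℕ → ZFSet.{u}
  | 0 => a
  | 1 => b
  | 2 => c
  | _ => d

theorem asg_mem {N a b c d : ZFSet.{u}} (ha : a ∈ N) (hb : b ∈ N) (hc : c ∈ N) (hd : d ∈ N) :
    ∀ i, asg a b c d i ∈ N := by
  intro i; unfold asg; split <;> assumption

theorem map_asg (j : ZFSet.{u} → ZFSet.{u}) (a b c d : ZFSet.{u}) :
    (fun i => j (asg a b c d i)) = asg (j a) (j b) (j c) (j d) := by
  funext i; unfold asg; split <;> rfl

theorem sat_fMemA {N a b c d : ZFSet.{u}} (hN : N.IsTransitive)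
    (ha : a ∈ N) (hb : b ∈ N) (hc : c ∈ N) (hd : d ∈ N) : Sat N.toSet fMemA (asg a b c d) ↔
      ∀ x ∈ b, (x ∈ c ↔ ∃ y ∈ N, y = fapp a x ∧ y ∈ fapp d x) := by
  have hv := asg_mem ha hb hc hd
  rw [fMemA, sat_all]
  have key : ∀ x ∈ N, ∀ y ∈ N, (Sat N.toSet (Fml.conj (fApE 0 4 1) (fApM 1 3 4))
      (Function.update (Function.update (asg a b c d) 4 x) 1 y) ↔ y = fapp a x ∧ y ∈ fapp d x) := by
    intro x hx y hy
    have hv2 := upd_mem (upd_mem hv 4 hx) 1 hy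
    rw [sat_conj, sat_fApE hN hv2 (by omega) (by omega) (by omega),
      sat_fApM hN hv2 (by omega) (by omega) (by omega)]
    simp [asg]
  have key2 : ∀ x ∈ N, (Sat N.toSet (.impl (.mem 4 1) (Fml.equ (.mem 4 2) (Fml.ex 1 (Fml.conj (fApE 0 4 1) (fApM 1 3 4)))))
      (Function.update (asg a b c d) 4 x) ↔ (x ∈ b → (x ∈ c ↔ ∃ y ∈ N, y = fapp a x ∧ y ∈ fapp d x))) := by
    intro x hx
    rw [sat_impl, sat_equ, sat_ex, sat_mem, sat_mem]
    refine imp_congr (by simp [asg]) (iff_congr (by simp [asg]) ?_)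
    constructor
    · rintro ⟨y, hy, h⟩; exact ⟨y, hy, (key x hx y hy).1 h⟩
    · rintro ⟨y, hy, h⟩; exact ⟨y, hy, (key x hx y hy).2 h⟩
  constructor
  · intro h x hx; have := hN _ hb hx; exact (key2 x this).1 (h x this) hx
  · intro h x hx; exact (key2 x hx).2 (h x)

theorem sat_fTot {N a b c d : ZFSet.{u}} (hN : N.IsTransitive)
    (ha : a ∈ N) (hb : b ∈ N) (hc : c ∈ N) (hd : d ∈ N) : Sat N.toSet fTot (asg a b c d) ↔
      ∀ x ∈ b, fapp a x ∈ N := by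
  have hv := asg_mem ha hb hc hd
  rw [fTot, sat_all]
  have key2 : ∀ x ∈ N, (Sat N.toSet (.impl (.mem 4 1) (Fml.ex 1 (fApE 0 4 1)))
      (Function.update (asg a b c d) 4 x) ↔ (x ∈ b → fapp a x ∈ N)) := by
    intro x hx
    rw [sat_impl, sat_ex, sat_mem]
    refine imp_congr (by simp [asg]) ?_
    constructor
    · rintro ⟨y, hy, h⟩
      rw [sat_fApE hN (upd_mem (upd_mem hv 4 hx) 1 hy) (by omega) (by omega) (by omega)] at h
      simp [asg] at h
      exact h ▸ hy
    · intro hy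
      refine ⟨_, hy, ?_⟩
      rw [sat_fApE hN (upd_mem (upd_mem hv 4 hx) 1 hy) (by omega) (by omega) (by omega)]
      simp [asg]
  constructor
  · intro h x hx; have := hN _ hb hx; exact (key2 x this).1 (h x this) hx
  · intro h x hx; exact (key2 x hx).2 (h x)

section
variable {κ U : ZFSet.{u}}

theorem Big_mem (h : UF κ M U) {A : ZFSet.{u}} (hA : A ⊆ κ) : Big κ U (fun ξ => ξ ∈ A) ↔ A ∈ U := by
  have : ZFSet.sep (fun ξ => ξ ∈ A) κ = A := by
    ext x; rw [ZFSet.mem_sep]; exact ⟨fun h => h.2, fun h => ⟨hA h, h⟩⟩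
  rw [Big, this]

theorem emb_exists (h : UF κ M U) (hw : UWF κ M U) :
    IsUltrapowerEmb κ M U (upSet κ M U) (fun x => piU κ M U (cst κ x)) := by
  have hM := h.tm.tm0
  have hk := h.k
  refine ⟨upSet_trans hw, fun x hx => piU_mem (cst_FS h hx), ?_, ?_, ?_⟩
  · intro φ v hv
    rw [los h hw φ (fun n => cst κ (v n)) (fun i => cst_FS h (hv i)), ← Big.const h (p := Sat M.toSet φ v)]
    refine Big.congr fun ξ hξ => ?_
    simp only [fapp_cst hξ]
  · intro a ha
    obtain ⟨f, hf, rfl⟩ := mem_upSet.1 ha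
    have hfM := (mem_FS.1 hf).1
    refine ⟨f, hfM, (mem_FS.1 hf).2, fun ξ hξ => hM.fapp_mem hfM (hM.trans _ hk hξ), ?_⟩
    have hL := los h hw (fApE 0 1 2) (asg (cst κ f) (idf κ) f f)
      (asg_mem (cst_FS h hfM) (idf_FS h) hf hf)
    rw [map_asg, sat_fApE (upSet_trans hw) (asg_mem (piU_mem (cst_FS h hfM)) (piU_mem (idf_FS h)) (piU_mem hf)
      (piU_mem hf)) (by omega) (by omega) (by omega)] at hL
    have := hL.2 (Big.all h fun ξ hξ => by
      have hξM := hM.trans _ hk hξ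
      rw [map_asg (fun x => fapp x ξ), sat_fApE h.tm.1 (asg_mem (by rw [fapp_cst hξ]; exact hfM)
        (by rw [fapp_idf hξ]; exact hξM) (hM.fapp_mem hfM hξM) (hM.fapp_mem hfM hξM)) (by omega) (by omega) (by omega)]
      simp [asg, fapp_cst hξ, fapp_idf hξ])
    simp only [asg, piU_idf h hw] at this
    exact this.symm
  · intro A hA hAκ
    rw [← Big_mem h hAκ]
    have h2 := piU_mem_piU h hw (idf_FS h) (cst_FS h hA)
    rw [piU_idf h hw] at h2
    refine Iff.trans ?_ h2.symm
    exact Big.congr fun ξ hξ => by rw [fapp_idf hξ, fapp_cst hξ]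

theorem emb_unique (h : UF κ M U) {N : ZFSet.{u}} {j : ZFSet.{u} → ZFSet.{u}}
    (hj : IsUltrapowerEmb κ M U N j) : UWF κ M U ∧ N = upSet κ M U := by
  have hM := h.tm.tm0
  have hk := h.k
  obtain ⟨hN, hjN, hel, hsur, hder⟩ := hj
  have hκκ : κ ∈ j κ := (hder κ hk (fun _ h => h)).1 ((Big_mem h (fun _ h => h)).1 (Big.all h fun ξ h => h))
  have tot : ∀ f ∈ FS κ M, fapp (j f) κ ∈ N := by
    intro f hf
    have hfM := (mem_FS.1 hf).1
    have := hel fTot (asg f κ κ κ) (asg_mem hfM hk hk hk)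
    rw [map_asg, sat_fTot h.tm.1 hfM hk hk hk, sat_fTot hN (hjN _ hfM) (hjN _ hk) (hjN _ hk) (hjN _ hk)] at this
    exact this.1 (fun ξ hξ => hM.fapp_mem hfM (hM.trans _ hk hξ)) κ hκκ
  have mem : ∀ f ∈ FS κ M, ∀ g ∈ FS κ M, (ZFSet.pair f g ∈ eU κ M U ↔ fapp (j f) κ ∈ fapp (j g) κ) := by
    intro f hf g hg
    have hfM := (mem_FS.1 hf).1
    have hgM := (mem_FS.1 hg).1
    have hA : ZFSet.sep (fun ξ => fapp f ξ ∈ fapp g ξ) κ ∈ M := hM.sep dpa hk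
    set A := ZFSet.sep (fun ξ => fapp f ξ ∈ fapp g ξ) κ with hAdef
    have hAκ : A ⊆ κ := fun x hx => (ZFSet.mem_sep.1 hx).1
    have := hel fMemA (asg f κ A g) (asg_mem hfM hk hA hgM)
    rw [map_asg, sat_fMemA h.tm.1 hfM hk hA hgM, sat_fMemA hN (hjN _ hfM) (hjN _ hk) (hjN _ hA) (hjN _ hgM)] at this
    have h2 := this.1 (fun ξ hξ => by
      rw [hAdef, ZFSet.mem_sep]
      constructor
      · rintro ⟨-, h2⟩; exact ⟨_, hM.fapp_mem hfM (hM.trans _ hk hξ), rfl, h2⟩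
      · rintro ⟨y, -, rfl, h2⟩; exact ⟨hξ, h2⟩) κ hκκ
    rw [pair_mem_eU]
    constructor
    · rintro ⟨-, -, hb⟩
      obtain ⟨y, -, rfl, hy⟩ := h2.1 ((hder A hA hAκ).1 hb)
      exact hy
    · intro hb
      exact ⟨hf, hg, (hder A hA hAκ).2 (h2.2 ⟨_, tot f hf, rfl, hb⟩)⟩
  have hw : UWF κ M U := by
    have : ∀ x f, f ∈ FS κ M → fapp (j f) κ = x → Acc (erel (eU κ M U)) f := by
      intro x
      induction x using ZFSet.inductionOn with
      | _ x ih =>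
      rintro f hf rfl
      refine ⟨f, fun g hg => ?_⟩
      have hg' : ZFSet.pair g f ∈ eU κ M U := hg
      have hgF := (pair_mem_eU.1 hg').1
      exact ih _ ((mem g hgF f hf).1 hg') g hgF rfl
    exact fun f hf => this _ f hf rfl
  have eq : ∀ x f, f ∈ FS κ M → fapp (j f) κ = x → x = piU κ M U f := by
    intro x
    induction x using ZFSet.inductionOn with
    | _ x ih =>
    rintro f hf rfl
    ext y
    rw [mem_piU hw hf]
    constructor
    · intro hy
      obtain ⟨g, hg, hgf, -, rfl⟩ := hsur y (hN _ (tot f hf) hy)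
      have hgF : g ∈ FS κ M := mem_FS.2 ⟨hg, hgf⟩
      exact ⟨g, hgF, (pair_mem_eU.1 ((mem g hgF f hf).2 hy)).2.2, ih _ hy g hgF rfl⟩
    · rintro ⟨g, hg, hb, rfl⟩
      have := (mem g hg f hf).1 (pair_mem_eU.2 ⟨hg, hf, hb⟩)
      rwa [← ih _ this g hg rfl]
  refine ⟨hw, ?_⟩
  ext y
  rw [mem_upSet]
  constructor
  · intro hy
    obtain ⟨g, hg, hgf, -, rfl⟩ := hsur y hy
    have hgF : g ∈ FS κ M := mem_FS.2 ⟨hg, hgf⟩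
    exact ⟨g, hgF, eq _ g hgF rfl⟩
  · rintro ⟨f, hf, rfl⟩
    rw [← eq _ f hf rfl]; exact tot f hf

theorem MU_spec (hκ : IsCard κ) (hU : IsSUMeasure κ U) :
    IsMUModel κ U (colSet κ U) ∧ MU κ U = colSet κ U := by
  have hex := hU.2.2
  have hs : IsMUModel κ U (MU κ U) := by rw [MU, dif_pos hex]; exact hex.choose_spec
  have := ((isMUModel_iff hκ).1 hs).2.2.2
  exact ⟨this ▸ hs, this⟩

theorem UF.of (hκ : IsCard κ) (hU : IsSUMeasure κ U) : UF κ (colSet κ U) U := by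
  obtain ⟨h, -⟩ := MU_spec hκ hU
  exact ⟨h.1.1, h.1.2.1, h.2.2.1, ICard.of_model hκ h.1.1.tm0 h.1.2.2⟩

theorem NU_eq (hκ : IsCard κ) (hU : IsSUMeasure κ U) (hw : UWF κ (colSet κ U) U) :
    NU κ U = upSet κ (colSet κ U) U := by
  have hF := UF.of hκ hU
  have hex : ∃ p : ZFSet.{u} × (ZFSet.{u} → ZFSet.{u}), IsUltrapowerEmb κ (MU κ U) U p.1 p.2 :=
    ⟨(_, _), by rw [(MU_spec hκ hU).2]; exact emb_exists hF hw⟩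
  have hs := hex.choose_spec
  rw [NU, upData, dif_pos hex]
  nth_rewrite 1 [(MU_spec hκ hU).2] at hs
  exact (emb_unique hF hs).2

end

theorem tm_FS (hM : TM0 M) {s t : (ℕ → ZFSet.{u}) → ZFSet.{u}} (hs : Tm M s) (ht : Tm M t) :
    Tm M (fun v => FS (s v) (t v)) := by
  have h : Tm M (fun v => FS (v 0) (v 1)) := by unfold FS; exact dpa3
  exact h.sub2 (f := FS) hs ht

theorem tm_eU (hM : TM0 M) {s t r : (ℕ → ZFSet.{u}) → ZFSet.{u}} (hs : Tm M s) (ht : Tm M t) (hr : Tm M r) :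
    Tm M (fun v => eU (s v) (t v) (r v)) := by
  have h : Tm M (fun v => eU (v 0) (v 1) (v 2)) := by
    unfold eU
    have := tm_FS hM (hM.vr 0) (hM.vr 1)
    refine Tm.sep hM (P := fun q v => ZFSet.sep (fun ξ => fapp (pfst q) ξ ∈ fapp (psnd q) ξ) (v 0) ∈ v 2)
      (Tm.prod hM this this) ?_
    exact dpa3
  exact h.sub3 (f := eU) hs ht hr

theorem tm_piU (hM : TM0 M) {s t r w : (ℕ → ZFSet.{u}) → ZFSet.{u}} (hs : Tm M s) (ht : Tm M t) (hr : Tm M r) (hw : Tm M w) :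
    Tm M (fun v => piU (s v) (t v) (r v) (w v)) := tm_coll hM (tm_eU hM hs ht hr) hw

theorem tm_upSet (hM : TM0 M) {s t r : (ℕ → ZFSet.{u}) → ZFSet.{u}} (hs : Tm M s) (ht : Tm M t) (hr : Tm M r) :
    Tm M (fun v => upSet (s v) (t v) (r v)) := by
  have h : Tm M (fun v => upSet (v 0) (v 1) (v 2)) := by
    unfold upSet
    refine Tm.img hM (f := fun x v => piU (v 0) (v 1) (v 2) x) (tm_FS hM (hM.vr 0) (hM.vr 1)) ?_
    exact tm_piU hM (hM.vr 1) (hM.vr 2) (hM.vr 3) (hM.vr 0)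
  exact h.sub3 (f := upSet) hs ht hr

/-! ### Well-foundedness -/
section
variable {κ U : ZFSet.{u}}

theorem UF.omega_mem (h : UF κ M U) : ZFSet.omega ∈ κ := by
  have hM := h.tm.tm0
  have hk := h.k
  rcases (isOrdinal_omega.{u}.subset_iff_eq_or_mem h.ic.ord).1 h.ic.omega_sub with e | e
  · exfalso
    have hF : grf (fun ξ => ⋃₀ ξ) κ ∈ FS κ M := grf_FS h dpa
    have hFM := (mem_FS.1 hF).1
    have h0 : (∅ : ZFSet.{u}) ∈ κ := by rw [← e]; exact nt_mem_omega 0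
    obtain ⟨γ, hγ, hb⟩ := Big.normal h hF ((Big.tail h h0).mono h dpa fun ξ hξ h1 => by
      rw [fapp_grf hξ]
      rw [← e] at hξ
      obtain ⟨n, rfl⟩ := mem_omega.1 hξ
      rcases n with _ | n
      · exact absurd h1 (ZFSet.notMem_empty _)
      · rw [nt_succ_U]; exact nt_lt (Nat.lt_succ_self n))
    obtain ⟨ξ, hξ, h1, h2⟩ := (hb.inter h (Big.tail h (h.ic.succ_mem hγ))).ex h
    rw [fapp_grf hξ] at h1
    have : γ ∈ ⋃₀ ξ := ZFSet.mem_sUnion.2 ⟨_, h2, ZFSet.mem_insert _ _⟩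
    rw [h1] at this
    exact ZFSet.mem_irrefl _ this
  · exact e

theorem seq_bdd (hic : ICard κ) {ℳ : ZFSet.{u}} (hℳ : TM0 ℳ) (hk : κ ∈ ℳ)
    (hw : ∀ A ∈ ℳ, A ⊆ κ → ∃ M U, UF κ M U ∧ A ∈ M) {g : ZFSet.{u}} (hg : g ∈ ℳ)
    (hgκ : ∀ n ∈ ZFSet.omega, fapp g n ∈ κ) : ∃ β ∈ κ, ∀ n ∈ ZFSet.omega, fapp g n ∈ β := by
  have hA : img (fun n => gp κ n (fapp g n)) ZFSet.omega ∈ ℳ := by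
    have hM := hℳ
    exact hM.cl dpa3
  set A := img (fun n => gp κ n (fapp g n)) ZFSet.omega with hAdef
  obtain ⟨M, U, h, hAM⟩ := hw A hA (fun x hx => by
    rw [hAdef, mem_img] at hx
    obtain ⟨n, hn, rfl⟩ := hx
    exact hic.gp_mem (hic.omega_sub hn) (hgκ n hn))
  have hM := h.tm.tm0
  have hk := h.k
  by_contra hc
  push Not at hc
  obtain ⟨f, hf, hfF, hfs⟩ := choice_fn h.tm
    (P := fun ξ n => n ∈ ZFSet.omega ∧ ∃ η ∈ κ, η ∉ ξ ∧ gp κ n η ∈ A) dpa3 hk (fun ξ hξ => by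
      obtain ⟨n, hn, hx⟩ := hc ξ hξ
      exact ⟨n, hM.trans _ hM.omega hn, hn, _, hgκ n hn, hx, by rw [hAdef, mem_img]; exact ⟨n, hn, rfl⟩⟩)
  obtain ⟨γ, hγ, hb⟩ := Big.normal h (mem_FS.2 ⟨hf, hfF⟩) ((Big.tail h h.omega_mem).mono h dpa fun ξ hξ h1 =>
    (hic.ord.mem hξ).isTransitive _ h1 (hfs ξ hξ).2.1)
  obtain ⟨ξ0, hξ0, h1⟩ := hb.ex h
  have hγω : γ ∈ ZFSet.omega := by rw [← h1]; exact (hfs ξ0 hξ0).2.1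
  obtain ⟨ξ, hξ, h2, h3⟩ := (hb.inter h (Big.tail h (hgκ γ hγω))).ex h
  obtain ⟨-, -, η, hη, hηξ, hm⟩ := hfs ξ hξ
  rw [h2, hAdef, mem_img] at hm
  obtain ⟨m, hm, he⟩ := hm
  obtain ⟨rfl, rfl⟩ := gp_inj hic.ord hγ hη (hic.omega_sub hm) (hgκ m hm) he
  exact hηξ h3

theorem uwf_of {ℳ : ZFSet.{u}} (hℳ : IsTransModel ℳ) (hk : κ ∈ ℳ)
    (hw : ∀ A ∈ ℳ, A ⊆ κ → ∃ M U, UF κ M U ∧ A ∈ M)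
    (h : UF κ M U) (hMM : M ∈ ℳ) (hUM : U ∈ ℳ) {I : ZFSet.{u}} (hI : I ∈ ℳ)
    (hIκ : ∀ ξ ∈ I, ξ ∈ κ) (hub : ∀ α ∈ κ, ∃ ξ ∈ I, ξ ∉ α)
    (hc : ∀ X ∈ U, ∃ α ∈ κ, ∀ ξ ∈ I, ξ ∉ α → ξ ∈ X) : UWF κ M U := by
  have hL := hℳ.tm0
  intro f0 hf0
  by_contra hna
  have hFS : FS κ M ∈ ℳ := hL.cl (tm_FS hL (Tm.const hk) (Tm.const hMM))
  have he : eU κ M U ∈ ℳ := hL.cl (tm_eU hL (Tm.const hk) (Tm.const hMM) (Tm.const hUM))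
  set e := eU κ M U with hedef
  have hS : ZFSet.sep (fun f => ¬ Acc (erel e) f) (FS κ M) ∈ ℳ :=
    hL.sep (Dp.not (dp_acc hL (Tm.const he) (hL.vr 0))) hFS
  set S := ZFSet.sep (fun f => ¬ Acc (erel e) f) (FS κ M) with hSdef
  obtain ⟨r, hr, hwo⟩ := hℳ.wo S hS
  have hf0S : f0 ∈ S := ZFSet.mem_sep.2 ⟨hf0, hna⟩
  have hf0M := hL.trans _ hS hf0S
  set st : ZFSet.{u} → ZFSet.{u} → ZFSet.{u} := fun _ f => lst r (ZFSet.sep (fun g => ZFSet.pair g f ∈ e) S) with hst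
  have hstS : ∀ f ∈ S, st ∅ f ∈ S ∧ ZFSet.pair (st ∅ f) f ∈ e := by
    intro f hf
    have := lst_spec hwo (c := ZFSet.sep (fun g => ZFSet.pair g f ∈ e) S) (fun x hx => (ZFSet.mem_sep.1 hx).1) (by
      by_contra hc
      push Not at hc
      refine (ZFSet.mem_sep.1 hf).2 ⟨f, fun g hg => ?_⟩
      by_contra hga
      have hg' : ZFSet.pair g f ∈ e := hg
      have hgF : g ∈ FS κ M := (pair_mem_eU.1 hg').1
      exact hc g (ZFSet.mem_sep.2 ⟨ZFSet.mem_sep.2 ⟨hgF, hga⟩, hg'⟩))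
    exact ZFSet.mem_sep.1 this.1
  set F : ZFSet.{u} → ZFSet.{u} := fun n => orec (fun _ => f0) st ∅ n with hF
  have hTst : Tm ℳ (fun v => st (v 0) (v 1)) := by
    have hM := hL
    exact dpa3
  have hTF : ∀ {s : (ℕ → ZFSet.{u}) → ZFSet.{u}}, Tm ℳ s → Tm ℳ (fun v => F (s v)) := fun hs =>
    tm_orec hL (Tm.const hf0M) hTst (Tm.const hL.empty) hs
  have hFS' : ∀ n : ℕ, F (nt n) ∈ S := by
    intro n
    induction n with
    | zero => rw [hF]; simp only [orec_zero]; exact hf0S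
    | succ n ih => rw [hF]; simp only [orec_succ]; exact (hstS _ ih).1
  have hFe : ∀ n : ℕ, ZFSet.pair (F (nt (n + 1))) (F (nt n)) ∈ e := by
    intro n
    have := (hstS _ (hFS' n)).2
    rw [hF]; simp only [orec_succ]; exact this
  have hD : Dp ℳ (fun v => v 1 ∈ κ ∧ ∀ ξ ∈ I, ξ ∉ v 1 →
      fapp (F (Insert.insert (v 0) (v 0))) ξ ∈ fapp (F (v 0)) ξ) := by
    have hM := hL
    refine Dp.and dpa (Dp.ball hM (P := fun ξ v => ξ ∉ v 1 →
      fapp (F (Insert.insert (v 0) (v 0))) ξ ∈ fapp (F (v 0)) ξ) dpa (Dp.imp dpa (Dp.mem ?_ ?_)))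
    · exact Tm.fapp hM (hTF dpa) dpa
    · exact Tm.fapp hM (hTF dpa) dpa
  obtain ⟨g, hg, -, hgs⟩ := choice_fn hℳ (P := fun n α => α ∈ κ ∧ ∀ ξ ∈ I, ξ ∉ α →
      fapp (F (Insert.insert n n)) ξ ∈ fapp (F n) ξ) hD hL.omega (fun n hn => by
    obtain ⟨n, rfl⟩ := mem_omega.1 hn
    have hb := (pair_mem_eU.1 (hFe n)).2.2
    obtain ⟨α, hα, hαs⟩ := hc _ hb
    exact ⟨α, hL.trans _ hk hα, hα, fun ξ hξ hξα => (ZFSet.mem_sep.1 (hαs ξ hξ hξα)).2⟩)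
  obtain ⟨β, hβ, hgβ⟩ := seq_bdd h.ic hL hk hw hg (fun n hn => (hgs n hn).2.1)
  obtain ⟨ξ, hξ, hξβ⟩ := hub β hβ
  have hdec : ∀ n : ℕ, fapp (F (nt (n + 1))) ξ ∈ fapp (F (nt n)) ξ := fun n =>
    (hgs _ (nt_mem_omega n)).2.2 ξ hξ fun hx => hξβ
      ((h.ic.ord.mem hβ).isTransitive _ (hgβ _ (nt_mem_omega n)) hx)
  have : ∀ x : ZFSet.{u}, ∀ n : ℕ, fapp (F (nt n)) ξ ≠ x := by
    intro x
    induction x using ZFSet.inductionOn with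
    | _ x ih =>
    rintro n rfl
    exact ih _ (hdec n) (n + 1) rfl
  exact this _ 0 rfl
end

/-! ### Definability of being certified -/

/-- automation for definability goals -/
theorem dpa4 {P : Prop} (h : P := by
  with_reducible repeat' first
    | assumption | apply TM0.vr
    | (apply Tm.const; first | assumption | (apply TM0.omega; assumption) | (apply TM0.empty; assumption))
    | apply dp_isZFunc | apply dp_trans | apply dp_wo | apply dp_acc | apply dp_tm | apply tm_lst | apply tm_coll | apply tm_preds
    | apply tm_gp | apply tm_eps | apply tm_colSet | apply tm_upSet
    | apply Dp.subset | apply Dp.not | apply Dp.ne | apply Dp.iff | apply Dp.and | apply Dp.or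
    | apply Dp.allM | apply Dp.exM | apply Dp.ball | apply Dp.bex | apply Dp.mem | apply Dp.eq | apply Dp.imp
    | apply Tm.pair | apply Tm.singleton | apply Tm.upair | apply Tm.union | apply Tm.inter | apply Tm.diff | apply Tm.insert | apply Tm.sUnion
    | apply Tm.prod | apply Tm.fapp | apply Tm.pfst | apply Tm.psnd | apply Tm.ite | apply Tm.sep | apply Tm.img | apply Tm.grf | apply TM0.omega | apply TM0.empty | apply Dp.trivM) : P := h

theorem dp_muf (hM : TM0 M) {s t r : (ℕ → ZFSet.{u}) → ZFSet.{u}} (hs : Tm M s) (ht : Tm M t) (hr : Tm M r) :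
    Dp M (fun v => IsMUltrafilter (s v) (t v) (r v)) := by
  refine Dp.sub3 (P := IsMUltrafilter) ?_ hs ht hr
  unfold IsMUltrafilter tailSet compl
  exact dpa4

theorem dp_wa (hM : TM0 M) {s t r : (ℕ → ZFSet.{u}) → ZFSet.{u}} (hs : Tm M s) (ht : Tm M t) (hr : Tm M r) :
    Dp M (fun v => WeaklyAmenable (s v) (t v) (r v)) := by
  refine Dp.sub3 (P := WeaklyAmenable) ?_ hs ht hr
  refine Dp.congr (P := fun v => ∀ X ∈ v 1, (∃ f ∈ v 1, IsZFunc (v 0) f ∧ ∀ y ∈ X, ∃ ξ ∈ v 0, fapp f ξ = y) →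
    X ∩ v 2 ∈ v 1) dpa4 fun v hv => ?_
  exact Iff.rfl

def CertI (κ C N W : ZFSet.{u}) : Prop := ∃ I ∈ N, (∀ ξ ∈ I, ξ ∈ κ) ∧ (∀ α ∈ κ, ∃ ξ ∈ I, ξ ∉ α) ∧
  ∀ X ∈ C, X ⊆ κ → (X ∈ W ↔ ∃ α ∈ κ, ∀ ξ ∈ I, ξ ∉ α → ξ ∈ X)

def CertB (κ Vk N W : ZFSet.{u}) : Prop :=
  W ∈ N ∧ (∀ A ∈ W, A ⊆ κ) ∧ IsTransModel (colSet κ W) ∧ κ ∈ colSet κ W ∧ Vk ∈ colSet κ W ∧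
  IsMUltrafilter κ (colSet κ W) W ∧ WeaklyAmenable κ (colSet κ W) W ∧ CertI κ (colSet κ W) N W

theorem dp_certI (hM : TM0 M) {s t r w : (ℕ → ZFSet.{u}) → ZFSet.{u}} (hs : Tm M s) (ht : Tm M t) (hr : Tm M r)
    (hw : Tm M w) : Dp M (fun v => CertI (s v) (t v) (r v) (w v)) := by
  refine Dp.sub4 (P := CertI) ?_ hs ht hr hw
  unfold CertI
  exact dpa4

theorem dp_certB (hM : TM0 M) {s t r w : (ℕ → ZFSet.{u}) → ZFSet.{u}} (hs : Tm M s) (ht : Tm M t) (hr : Tm M r)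
    (hw : Tm M w) : Dp M (fun v => CertB (s v) (t v) (r v) (w v)) := by
  refine Dp.sub4 (P := CertB) ?_ hs ht hr hw
  unfold CertB
  have h1 : Tm M (fun v => colSet (v 0) (v 3)) := dpa4
  have h2 := dp_muf hM (hM.vr 0) h1 (hM.vr 3)
  have h3 := dp_wa hM (hM.vr 0) h1 (hM.vr 3)
  have h4 := dp_certI hM (hM.vr 0) h1 (hM.vr 2) (hM.vr 3)
  exact dpa4

section
variable {κ Vk ℳ : ZFSet.{u}}

theorem zcard_union_le (x y : ZFSet.{u}) : zcard (x ∪ y) ≤ zcard x + zcard y := by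
  have : (x ∪ y).toSet = x.toSet ∪ y.toSet := by ext z; exact ZFSet.mem_union
  rw [zcard, this]; exact Cardinal.mk_union_le _ _

theorem zcard_colSet (hic : ICard κ) {W : ZFSet.{u}} (h : zcard W ≤ zcard κ) : zcard (colSet κ W) ≤ zcard κ := by
  have h1 : zcard (codes κ W) ≤ zcard κ := by
    refine (zcard_union_le _ _).trans ?_
    refine Cardinal.add_le_of_le hic.inf h (le_trans ?_ h)
    refine zcard_le_of_surj (fun A => ZFSet.sep (fun ξ => ξ ∉ A) κ) fun b hb => ?_
    obtain ⟨A, hA, rfl⟩ := mem_img.1 hb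
    exact ⟨A, hA, rfl⟩
  refine le_trans (zcard_le_of_surj (x := ZFSet.prod (codes κ W) κ)
    (fun q => coll (ER κ (pfst q)) (psnd q)) fun b hb => ?_) ((zcard_prod _ _).trans ?_)
  · obtain ⟨A, hA, rfl⟩ := mem_img.1 hb
    exact ⟨A, hA, rfl⟩
  · exact (mul_le_mul' h1 le_rfl).trans (Cardinal.mul_eq_self hic.inf).le

theorem cert_iff (hic : ICard κ) (hVk : ∀ x, x ∈ Vk ↔ ZFSet.rank x < ZFSet.rank κ) {N W : ZFSet.{u}}
    (hz : zcard W ≤ zcard κ) : CertifiedRamseyMeasureIn N κ W ↔ CertB κ Vk N W := by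
  have hV : ∀ v, (∀ x, x ∈ v ↔ ZFSet.rank x < ZFSet.rank κ) → v = Vk := fun v hv => by
    ext x; rw [hv, hVk]
  constructor
  · rintro ⟨h1, h2, h3, I, hI, h4⟩
    obtain ⟨hm, he⟩ := MU_spec hic.card h2
    obtain ⟨v, hv, hv'⟩ := hm.2.1
    rw [he] at h3
    rw [Certifies, he] at h4
    refine ⟨h1, h2.2.1, hm.1.1, hm.1.2.1, hV v hv' ▸ hv, hm.2.2.1, h3, I, hI, h4⟩
  · rintro ⟨h1, h2, h3, h4, h5, h6, h7, I, hI, h8⟩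
    have hm : IsMUModel κ W (colSet κ W) := by
      rw [isMUModel_iff hic.card]
      refine ⟨⟨h3, h4, le_antisymm (zcard_colSet hic hz) (zcard_mono fun x hx => h3.1 _ h4 hx)⟩,
        ⟨Vk, h5, hVk⟩, h6, rfl⟩
    have hS : IsSUMeasure κ W := by
      refine ⟨le_antisymm hz ?_, h2, _, hm⟩
      refine zcard_le_of_inj (tailSet κ) h6.2.1 fun a ha b hb hab => ?_
      have key : ∀ a ∈ κ, ∀ b ∈ κ, tailSet κ a = tailSet κ b → a ∉ b := by
        intro a ha b hb e hab
        have : a ∈ tailSet κ a := ZFSet.mem_sep.2 ⟨ha, ZFSet.mem_irrefl a⟩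
        rw [e] at this
        exact (ZFSet.mem_sep.1 this).2 hab
      rcases (hic.ord.mem ha).mem_trichotomous (hic.ord.mem hb) with h | h | h
      · exact absurd h (key a ha b hb hab)
      · exact h
      · exact absurd h (key b hb a ha hab.symm)
    have he := (MU_spec hic.card hS).2
    refine ⟨h1, hS, he ▸ h7, I, hI, ?_⟩
    rw [Certifies, he]; exact h8

/-- the ambient context -/
structure Cx (κ Vk ℳ : ZFSet.{u}) : Prop where
  ic : ICard κ
  tm : IsTransModel ℳ
  k : κ ∈ ℳ
  hw : ∀ A ∈ ℳ, A ⊆ κ → ∃ M U, UF κ M U ∧ A ∈ M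
  vm : Vk ∈ ℳ
  hVk : ∀ x, x ∈ Vk ↔ ZFSet.rank x < ZFSet.rank κ

def up (κ W : ZFSet.{u}) : ZFSet.{u} := upSet κ (colSet κ W) W

theorem tm_up (hM : TM0 M) {s t : (ℕ → ZFSet.{u}) → ZFSet.{u}} (hs : Tm M s) (ht : Tm M t) :
    Tm M (fun v => up (s v) (t v)) := by unfold up; exact tm_upSet hM hs (tm_colSet hM hs ht) ht

section
variable {W : ZFSet.{u}}

theorem Cx.uwf (c : Cx κ Vk ℳ) (h : CertifiedRamseyMeasureIn ℳ κ W) : UWF κ (colSet κ W) W := by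
  obtain ⟨h1, h2, h3, I, hI, h4⟩ := h
  have hL := c.tm.tm0
  have hF := UF.of c.ic.card h2
  rw [Certifies, (MU_spec c.ic.card h2).2] at h4
  refine uwf_of c.tm c.k c.hw hF (hL.cl (tm_colSet hL (Tm.const c.k) (Tm.const h1))) h1 hI h4.1 h4.2.1 fun X hX => ?_
  have := hF.uf.1 X hX
  exact (h4.2.2 X this.1 this.2).1 hX

theorem Cx.nu (c : Cx κ Vk ℳ) (h : CertifiedRamseyMeasureIn ℳ κ W) : NU κ W = up κ W :=
  NU_eq c.ic.card h.2.1 (c.uwf h)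

theorem Cx.mu (c : Cx κ Vk ℳ) (h : CertifiedRamseyMeasureIn ℳ κ W) : MU κ W = colSet κ W :=
  (MU_spec c.ic.card h.2.1).2

theorem Cx.up_tm0 (c : Cx κ Vk ℳ) (h : CertifiedRamseyMeasureIn ℳ κ W) : TM0 (up κ W) :=
  upSet_tm0 (UF.of c.ic.card h.2.1) (c.uwf h)

theorem Cx.sub_up (c : Cx κ Vk ℳ) (h : CertifiedRamseyMeasureIn ℳ κ W) {A : ZFSet.{u}} (hA : A ∈ colSet κ W) (hk : A ⊆ κ) :
    A ∈ up κ W := sub_upSet (UF.of c.ic.card h.2.1) (c.uwf h) hA hk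

theorem Cx.k_up (c : Cx κ Vk ℳ) (h : CertifiedRamseyMeasureIn ℳ κ W) : κ ∈ up κ W :=
  c.sub_up h (UF.of c.ic.card h.2.1).k (fun _ h => h)

theorem Cx.up_mem (c : Cx κ Vk ℳ) (h : CertifiedRamseyMeasureIn ℳ κ W) : up κ W ∈ ℳ :=
  c.tm.tm0.cl (tm_up c.tm.tm0 (Tm.const c.k) (Tm.const h.1))

theorem Cx.up_up (c : Cx κ Vk ℳ) (h : CertifiedRamseyMeasureIn ℳ κ W) {W' : ZFSet.{u}} (h' : W' ∈ up κ W) :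
    up κ W' ∈ up κ W :=
  (c.up_tm0 h).cl (tm_up (c.up_tm0 h) (Tm.const (c.k_up h)) (Tm.const h'))

theorem Cert.mono {N N' W : ZFSet.{u}} (hN : N ⊆ N') (h : CertifiedRamseyMeasureIn N κ W) :
    CertifiedRamseyMeasureIn N' κ W := by
  obtain ⟨h1, h2, h3, I, hI, h4⟩ := h
  exact ⟨hN h1, h2, h3, I, hN hI, h4⟩

theorem Cx.up_sub (c : Cx κ Vk ℳ) (h : CertifiedRamseyMeasureIn ℳ κ W) : up κ W ⊆ ℳ :=
  fun x hx => c.tm.1 _ (c.up_mem h) hx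

theorem Cx.zc (c : Cx κ Vk ℳ) (h : CertifiedRamseyMeasureIn ℳ κ W) {W' : ZFSet.{u}} (h' : W' ∈ up κ W) :
    zcard W' ≤ zcard κ := by
  have h1 : zcard W' ≤ zcard (up κ W) := zcard_mono fun x hx => (c.up_tm0 h).trans _ h' hx
  refine h1.trans ?_
  have h2 : zcard (up κ W) ≤ zcard (FS κ (colSet κ W)) :=
    zcard_le_of_surj (piU κ (colSet κ W) W) fun b hb => by
      obtain ⟨f, hf, rfl⟩ := mem_upSet.1 hb; exact ⟨f, hf, rfl⟩
  have h3 : zcard (FS κ (colSet κ W)) ≤ zcard (colSet κ W) := zcard_mono fun x hx => (mem_FS.1 hx).1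
  exact h2.trans (h3.trans (MU_spec c.ic.card h.2.1).1.1.2.2.le)

end
end

/-! ### The main argument -/

section
variable {κ Vk ℳ : ZFSet.{u}}

theorem G_iff (C : ZFSet.{u} → ZFSet.{u} → ZFSet.{u} → Prop) (κ : ZFSet.{u}) (α : Ordinal.{u+1}) (N : ZFSet.{u}) :
    oGEin C κ α N ↔ ∀ A ∈ N, A ⊆ κ → ∀ β < α, ∃ W ∈ N, C N κ W ∧ AGood κ A W ∧ oGEin C κ β (NU κ W) := by
  rw [oGEin, WellFounded.fix_eq]; exact Iff.rfl

/-- von Neumann rank in the next universe -/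
def rho (x : ZFSet.{u}) : Ordinal.{u+1} := (ZFSet.mem_wf.apply x).rank

theorem lt_rho {x : ZFSet.{u}} {β : Ordinal.{u+1}} : β < rho x ↔ ∃ y ∈ x, β ≤ rho y := by
  rw [rho, Acc.rank_eq, Ordinal.lt_iSup_iff]
  constructor
  · rintro ⟨⟨y, hy⟩, h⟩; exact ⟨y, hy, Order.lt_succ_iff.1 h⟩
  · rintro ⟨y, hy, h⟩; exact ⟨⟨y, hy⟩, Order.lt_succ_iff.2 h⟩

theorem rho_onto {N : ZFSet.{u}} (hN : N.IsTransitive) {β : Ordinal.{u+1}} :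
    ∀ x : ZFSet.{u}, x ⊆ N → β < rho x → ∃ y ∈ N, rho y = β := by
  intro x
  induction x using ZFSet.inductionOn with
  | _ x ih =>
    intro hx hb
    obtain ⟨y, hy, h⟩ := lt_rho.1 hb
    rcases h.eq_or_lt with h | h
    · exact ⟨y, hx hy, h.symm⟩
    · exact ih y hy (hN _ (hx hy)) h

theorem G_le (c : Cx κ Vk ℳ) (α : Ordinal.{u+1}) : ∀ W, CertifiedRamseyMeasureIn ℳ κ W →
    oGEin CertifiedRamseyMeasureIn κ α (NU κ W) → α ≤ rho (up κ W) := by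
  induction α using WellFoundedLT.induction with
  | _ α ih =>
    intro W hW hG
    refine le_of_forall_lt fun β hβ => ?_
    rw [c.nu hW, G_iff] at hG
    obtain ⟨W', hW', hC, -, hG'⟩ := hG κ (c.k_up hW) (fun _ h => h) β hβ
    exact lt_rho.2 ⟨_, c.up_up hW hW', ih β hβ W' (Cert.mono (c.up_sub hW) hC) hG'⟩

theorem wit_ne (c : Cx κ Vk ℳ) {𝒰 : ZFSet.{u}} (h : IsWitnessIn CertifiedRamseyMeasureIn ℳ κ 𝒰) : ∃ U, U ∈ 𝒰 := by
  obtain ⟨U, hU, -⟩ := h.2.2 κ c.k (fun _ h => h)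
  exact ⟨U, hU⟩

theorem acc_aux (c : Cx κ Vk ℳ) (x : ZFSet.{u}) : ∀ 𝒰 U, IsWitnessIn CertifiedRamseyMeasureIn ℳ κ 𝒰 → U ∈ 𝒰 →
    up κ U = x → Acc (MOrderIn CertifiedRamseyMeasureIn ℳ κ) 𝒰 := by
  induction x using ZFSet.inductionOn with
  | _ x ih =>
    intro 𝒰 U h𝒰 hU hx
    refine ⟨_, fun 𝒲 hW => ?_⟩
    have hC := h𝒰.2.1 U hU
    have h1 := hW.2.2.1 U hU
    rw [c.nu hC] at h1
    obtain ⟨W, hW1, hW2, -, -⟩ := h1 κ (c.k_up hC) (fun _ h => h)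
    exact ih (up κ W) (hx ▸ c.up_up hC hW2) 𝒲 W hW.1 hW1 rfl

theorem acc_of (c : Cx κ Vk ℳ) {𝒰 : ZFSet.{u}} (h : IsWitnessIn CertifiedRamseyMeasureIn ℳ κ 𝒰) :
    Acc (MOrderIn CertifiedRamseyMeasureIn ℳ κ) 𝒰 := by
  obtain ⟨U, hU⟩ := wit_ne c h
  exact acc_aux c _ 𝒰 U h hU rfl

theorem rank_imp (c : Cx κ Vk ℳ) (α : Ordinal.{u+1}) : ∀ 𝒰, IsWitnessIn CertifiedRamseyMeasureIn ℳ κ 𝒰 →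
    α ≤ relRank (MOrderIn CertifiedRamseyMeasureIn ℳ κ) 𝒰 → ∀ U ∈ 𝒰, oGEin CertifiedRamseyMeasureIn κ α (NU κ U) := by
  induction α using WellFoundedLT.induction with
  | _ α ih =>
    intro 𝒰 h𝒰 hα U hU
    rw [G_iff]
    intro A hA hk β hβ
    have h1 := hβ.trans_le hα
    rw [relRank, dif_pos (acc_of c h𝒰), Acc.rank_eq, Ordinal.lt_iSup_iff] at h1
    obtain ⟨⟨𝒲, h𝒲⟩, h1⟩ := h1
    have h2 : β ≤ relRank (MOrderIn CertifiedRamseyMeasureIn ℳ κ) 𝒲 := by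
      rw [relRank, dif_pos (acc_of c h𝒲.1)]; exact Order.lt_succ_iff.1 h1
    obtain ⟨W, hW1, hW2, hW3, hW4⟩ := h𝒲.2.2.1 U hU A hA hk
    exact ⟨W, hW2, hW4, hW3, ih β hβ 𝒲 h𝒲.1 h2 W hW1⟩

/-- measures lying in some ultrapower of a member of `𝒰` -/
def DZ (κ Vk 𝒰 : ZFSet.{u}) : ZFSet.{u} :=
  ZFSet.sep (fun W => ∃ U ∈ 𝒰, CertB κ Vk (up κ U) W) (⋃₀ (img (fun U => up κ U) 𝒰))

def HT (κ Vk D x g : ZFSet.{u}) : ZFSet.{u} :=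
  ZFSet.sep (fun W => ∀ A ∈ up κ W, A ⊆ κ → ∀ y ∈ x, ∃ W' ∈ up κ W, CertB κ Vk (up κ W) W' ∧
    A ∈ colSet κ W' ∧ W' ∈ fapp g y) D

theorem mem_DZ {𝒰 W : ZFSet.{u}} : W ∈ DZ κ Vk 𝒰 ↔ ∃ U ∈ 𝒰, CertB κ Vk (up κ U) W := by
  rw [DZ, ZFSet.mem_sep, ZFSet.mem_sUnion]
  refine ⟨fun h => h.2, fun h => ⟨?_, h⟩⟩
  obtain ⟨U, hU, h⟩ := h
  exact ⟨up κ U, mem_img.2 ⟨U, hU, rfl⟩, h.1⟩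

theorem DZ_mem (c : Cx κ Vk ℳ) {𝒰 : ZFSet.{u}} (h : 𝒰 ∈ ℳ) : DZ κ Vk 𝒰 ∈ ℳ := by
  have hM := c.tm.tm0
  have hk := c.k
  have hv := c.vm
  refine hM.cl ?_
  unfold DZ
  have h0 : Tm ℳ (fun v => up κ (v 0)) := tm_up hM (Tm.const hk) (hM.vr 0)
  have h1 := dp_certB hM (Tm.const hk) (Tm.const hv) h0 (hM.vr 1)
  exact Tm.sep hM (P := fun W _ => ∃ U ∈ 𝒰, CertB κ Vk (up κ U) W)
    (Tm.sUnion hM (Tm.img hM (f := fun U _ => up κ U) (Tm.const h) h0))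
    (Dp.bex hM (P := fun U v => CertB κ Vk (up κ U) (v 0)) (Tm.const h) h1)

theorem tm_HT (c : Cx κ Vk ℳ) {D : ZFSet.{u}} (hD : D ∈ ℳ) :
    Tm ℳ (fun v => (fun _ x g => HT κ Vk D x g : ZFSet.{u} → ZFSet.{u} → ZFSet.{u} → ZFSet.{u}) (v 0) (v 1) (v 2)) := by
  have hM := c.tm.tm0
  have hk := c.k
  have hv := c.vm
  unfold HT
  have h0 : ∀ i, Tm ℳ (fun v => up κ (v i)) := fun i => tm_up hM (Tm.const hk) (hM.vr i)
  have h00 := h0 0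
  have h03 := h0 3
  have h02 := h0 2
  have h1 := dp_certB hM (Tm.const hk) (Tm.const hv) (h0 3) (hM.vr 0)
  exact dpa4

theorem rank_of (c : Cx κ Vk ℳ) (α : Ordinal.{u+1}) : ∀ 𝒰, IsWitnessIn CertifiedRamseyMeasureIn ℳ κ 𝒰 →
    (∀ U ∈ 𝒰, oGEin CertifiedRamseyMeasureIn κ α (NU κ U)) →
    α ≤ relRank (MOrderIn CertifiedRamseyMeasureIn ℳ κ) 𝒰 := by
  induction α using WellFoundedLT.induction with
  | _ α ih =>
    intro 𝒰 h𝒰 hG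
    refine le_of_forall_lt fun β hβ => ?_
    obtain ⟨U0, hU0⟩ := wit_ne c h𝒰
    have hC := h𝒰.2.1
    have hM := c.tm.tm0
    have hX : (up κ U0).IsTransitive := fun y hy z hz => (c.up_tm0 (hC _ hU0)).trans _ hy hz
    obtain ⟨x, hx, hxβ⟩ := rho_onto hX _ (fun _ h => h) (hβ.trans_le (G_le c α U0 (hC _ hU0) (hG _ hU0)))
    have hDM := DZ_mem c h𝒰.1
    set D := DZ κ Vk 𝒰 with hD
    have hXM := c.up_mem (hC _ hU0)
    set X := up κ U0 with hXdef
    -- members of D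
    have hcB : ∀ U ∈ 𝒰, ∀ W, W ∈ up κ U → (CertifiedRamseyMeasureIn (up κ U) κ W ↔ CertB κ Vk (up κ U) W) :=
      fun U hU W hW => cert_iff c.ic c.hVk (c.zc (hC U hU) hW)
    have hDC : ∀ W ∈ D, CertifiedRamseyMeasureIn ℳ κ W := by
      intro W hW
      obtain ⟨U, hU, h⟩ := mem_DZ.1 hW
      exact Cert.mono (c.up_sub (hC U hU)) ((hcB U hU W h.1).2 h)
    have hDD : ∀ W ∈ D, ∀ W', CertifiedRamseyMeasureIn (up κ W) κ W' → W' ∈ D := by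
      intro W hW W' h'
      obtain ⟨U, hU, h⟩ := mem_DZ.1 hW
      have hs : up κ W ⊆ up κ U := fun z hz => (c.up_tm0 (hC U hU)).trans _ (c.up_up (hC U hU) h.1) hz
      exact mem_DZ.2 ⟨U, hU, (hcB U hU W' (hs h'.1)).1 (Cert.mono hs h')⟩
    let T := wfr (HT κ Vk D) (eps X)
    have key : ∀ y : ZFSet.{u}, y ∈ X → ∀ W, W ∈ T y ↔ W ∈ D ∧ oGEin CertifiedRamseyMeasureIn κ (rho y) (NU κ W) := by
      intro y
      induction y using ZFSet.inductionOn with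
      | _ y ihy =>
        intro hy W
        have e : T y = HT κ Vk D y (grf T y) := by
          have := wfr_eq (H := HT κ Vk D) (acc_eps X y)
          rw [preds_eps hX hy] at this
          exact this
        rw [e, HT, ZFSet.mem_sep]
        refine and_congr_right fun hWD => ?_
        have hWC := hDC W hWD
        rw [c.nu hWC, G_iff]
        have hcW : ∀ W' ∈ up κ W, (CertifiedRamseyMeasureIn (up κ W) κ W' ↔ CertB κ Vk (up κ W) W') :=
          fun W' h => cert_iff c.ic c.hVk (c.zc hWC h)
        constructor
        · intro h A hA hk γ hγ
          obtain ⟨z, hz, hzγ⟩ := lt_rho.1 hγ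
          obtain ⟨W', h1, h2, h3, h4⟩ := h A hA hk z hz
          have h2' := (hcW W' h1).2 h2
          rw [fapp_grf hz, ihy z hz (hX _ hy hz)] at h4
          refine ⟨W', h1, h2', ?_, ?_⟩
          · rw [AGood, c.mu (Cert.mono (c.up_sub hWC) h2')]; exact h3
          · have h5 := h4.2
            rw [G_iff] at h5 ⊢
            exact fun B hB hk δ hδ => h5 B hB hk δ (hδ.trans_le hzγ)
        · intro h A hA hk z hz
          obtain ⟨W', h1, h2, h3, h4⟩ := h A hA hk (rho z) (lt_rho.2 ⟨z, hz, le_rfl⟩)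
          refine ⟨W', h1, (hcW W' h1).1 h2, ?_, ?_⟩
          · rw [AGood, c.mu (Cert.mono (c.up_sub hWC) h2)] at h3; exact h3
          · rw [fapp_grf hz, ihy z hz (hX _ hy hz)]
            exact ⟨hDD W hWD W' h2, h4⟩
    have hTM : T x ∈ ℳ := by
      refine hM.cl ?_
      exact Tm.sub3 (f := fun _ e y => wfr (HT κ Vk D) e y) (tm_wfr (G := fun _ x g => HT κ Vk D x g) hM (tm_HT c hDM))
        (Tm.const c.k) (tm_eps hM (Tm.const hXM)) (Tm.const (hM.trans _ hXM hx))
    have hget : ∀ U ∈ 𝒰, ∀ A ∈ up κ U, A ⊆ κ → ∃ W ∈ T x, W ∈ up κ U ∧ AGood κ A W ∧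
        CertifiedRamseyMeasureIn (up κ U) κ W := by
      intro U hU A hA hk
      have h1 := hG U hU
      rw [c.nu (hC U hU), G_iff] at h1
      obtain ⟨W, h2, h3, h4, h5⟩ := h1 A hA hk β hβ
      exact ⟨W, (key x hx W).2 ⟨mem_DZ.2 ⟨U, hU, (hcB U hU W h2).1 h3⟩, hxβ ▸ h5⟩, h2, h4, h3⟩
    have hwit : IsWitnessIn CertifiedRamseyMeasureIn ℳ κ (T x) := by
      refine ⟨hTM, fun W hW => hDC W ((key x hx W).1 hW).1, fun A hA hk => ?_⟩
      obtain ⟨U, hU, hAU⟩ := h𝒰.2.2 A hA hk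
      rw [AGood, c.mu (hC U hU)] at hAU
      obtain ⟨W, h1, -, h2, -⟩ := hget U hU A (c.sub_up (hC U hU) hAU hk) hk
      exact ⟨W, h1, h2⟩
    have hlt : MOrderIn CertifiedRamseyMeasureIn ℳ κ (T x) 𝒰 := by
      refine ⟨hwit, h𝒰, fun U hU A hA hk => ?_, fun W hW => ?_⟩
      · rw [c.nu (hC U hU)] at hA ⊢
        exact hget U hU A hA hk
      · obtain ⟨U, hU, h⟩ := mem_DZ.1 ((key x hx W).1 hW).1
        exact ⟨U, hU, by rw [c.nu (hC U hU)]; exact h.1⟩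
    have h1 := ih β hβ (T x) hwit fun W hW => hxβ ▸ ((key x hx W).1 hW).2
    refine h1.trans_lt ?_
    rw [relRank, relRank, dif_pos (acc_of c hwit), dif_pos (acc_of c h𝒰)]
    exact Acc.rank_lt_of_rel (acc_of c h𝒰) hlt

theorem Cx.of (hκ : IsCard κ) (hℳ : Practical κ ℳ) {𝒰 : ZFSet.{u}}
    (h𝒰 : IsWitnessIn CertifiedRamseyMeasureIn ℳ κ 𝒰) : ∃ Vk, Cx κ Vk ℳ := by
  obtain ⟨hm, hk, -⟩ := hℳ
  obtain ⟨U, hU, -⟩ := h𝒰.2.2 κ hk (fun _ h => h)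
  have hC := h𝒰.2.1 U hU
  obtain ⟨v, hv, hv'⟩ := (MU_spec hκ hC.2.1).1.2.1
  have hL := hm.tm0
  refine ⟨v, (UF.of hκ hC.2.1).ic, hm, hk, fun A hA hk => ?_,
    hL.trans _ (hL.cl (tm_colSet hL (Tm.const hk) (Tm.const hC.1))) hv, hv'⟩
  obtain ⟨U, hU, hAU⟩ := h𝒰.2.2 A hA hk
  have hC := h𝒰.2.1 U hU
  rw [AGood, (MU_spec hκ hC.2.1).2] at hAU
  exact ⟨_, _, UF.of hκ hC.2.1, hAU⟩

end

/-- Let `α` be an ordinal and let `ℳ` be practical for `κ`. Then, in `ℳ`,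
a witness collection `𝒰` of certified Ramsey measures on `κ` satisfies `o*_Ram(𝒰) ≥ α`
if and only if `N_U ⊨ o*_Ram(κ) ≥ α` for every `U ∈ 𝒰`. -/
theorem certified_rank_ge_iff (κ ℳ : ZFSet) (hκ : IsCard κ) (hℳ : Practical κ ℳ)
    (α : Ordinal) (𝒰 : ZFSet)
    (h𝒰 : IsWitnessIn CertifiedRamseyMeasureIn ℳ κ 𝒰) :
    α ≤ relRank (MOrderIn CertifiedRamseyMeasureIn ℳ κ) 𝒰 ↔
      ∀ U ∈ 𝒰.toSet, oGEin CertifiedRamseyMeasureIn κ α (NU κ U) := by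
  obtain ⟨Vk, c⟩ := Cx.of hκ hℳ h𝒰
  exact ⟨fun h U hU => rank_imp c α 𝒰 h𝒰 h U hU, fun h => rank_of c α 𝒰 h𝒰 h⟩

end MPaper
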